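/- Let d ≥ 1, 0 < α < 1, 1 < p < ∞, and let 𝕂₁, 𝕂₂ be classical Calderón–Zygmund operators, each of the form (𝕂_iσ)(x) = c_i σ(x) + lim_{ε→0} ∫_{|x−y|>ε} k_i(x−y) σ(y) dy with c_i ∈ ℝ and k_i smooth away from the origin, positively homogeneous of degree −d, and with zero mean on spheres centered at the origin. Then for every vector field η ∈ C^{1+α}(ℝ^d; ℝ^d) the commutator with the composition, [η·∇, 𝕂₁∘𝕂₂]σ = η·∇(𝕂₁𝕂₂σ) − 𝕂₁𝕂₂(η·∇σ), defined for smooth compactly supported σ, satisfies ‖[η·∇, 𝕂₁∘𝕂₂]σ‖_{α,p} ≤ C ‖η‖_{C^{1+α}(ℝ^d)} ‖σ‖_{α,p}, and hence extends to a bounded linear operator on C^{α,p}. -/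

import Mathlib

open MeasureTheory Real Set Filter Topology

noncomputable section

/-- `ℝ^d` (with the sup norm). -/
abbrev Euc (d : ℕ) : Type := Fin d → ℝ

/-- `d × d` real matrices (with the sup norm). -/
abbrev Mat (d : ℕ) : Type := Fin d → Fin d → ℝ

/-- `f` belongs to `C^α(ℝ^d)` with (both components of the) norm bounded by `M`. -/
def InCa {d : ℕ} {F : Type*} [NormedAddCommGroup F] (α M : ℝ) (f : Euc d → F) : Prop :=
  (∀ x, ‖f x‖ ≤ M) ∧ ∀ x y, ‖f x - f y‖ ≤ M * ‖x - y‖ ^ α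

/-- `f` belongs to `C^{α,p} = C^α(ℝ^d) ∩ L^p(ℝ^d)` with norm bounded by `M`. -/
def InCap {d : ℕ} {F : Type*} [NormedAddCommGroup F] (α p M : ℝ) (f : Euc d → F) : Prop :=
  InCa α M f ∧ eLpNorm f (ENNReal.ofReal p) volume ≤ ENNReal.ofReal M

/-- `f` belongs to `C^{1+α}(ℝ^d)` with norm bounded by `M`. -/
def InC1a {d : ℕ} {F : Type*} [NormedAddCommGroup F] [NormedSpace ℝ F] (α M : ℝ)
    (f : Euc d → F) : Prop :=
  Differentiable ℝ f ∧ (∀ x, ‖f x‖ ≤ M) ∧ InCa α M (fderiv ℝ f)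

/-- `f` belongs to `C^{1+α,p} = C^{1+α}(ℝ^d) ∩ W^{1,p}(ℝ^d)` with norm bounded by `M`. -/
def InC1ap {d : ℕ} {F : Type*} [NormedAddCommGroup F] [NormedSpace ℝ F] (α p M : ℝ)
    (f : Euc d → F) : Prop :=
  Differentiable ℝ f ∧ (∀ x, ‖f x‖ ≤ M) ∧ InCap α p M (fderiv ℝ f) ∧
    eLpNorm f (ENNReal.ofReal p) volume ≤ ENNReal.ofReal M

/-- The heat kernel `g_t`. -/
def heatKer (d : ℕ) (t : ℝ) (x : Euc d) : ℝ :=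
  (4 * π * t) ^ (-(d : ℝ) / 2) * Real.exp (-(∑ i, x i ^ 2) / (4 * t))

/-- Convolution with the heat kernel. -/
def heatConv {d : ℕ} {F : Type*} [NormedAddCommGroup F] [NormedSpace ℝ F] [CompleteSpace F]
    (t : ℝ) (f : Euc d → F) (x : Euc d) : F :=
  ∫ y : Euc d, heatKer d t (x - y) • f y

/-- `𝕃(f)(t) = e^{tΔ} f` (with `e^{0Δ} = Id`). -/
def opL {d : ℕ} {F : Type*} [NormedAddCommGroup F] [NormedSpace ℝ F] [CompleteSpace F]
    (f : Euc d → F) (t : ℝ) : Euc d → F :=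
  if t = 0 then f else heatConv t f

/-- The kernel of `e^{tΔ}ℍ`, `ℍ = I + R ⊗ R` the Leray projector: the inverse Fourier
transform of the (real, even, integrable for `t > 0`) symbol
`(δ_{mn} - ξ_mξ_n/|ξ|²) e^{-4π²t|ξ|²}`. -/
def lerayHeatKer (d : ℕ) (t : ℝ) (x : Euc d) (m n : Fin d) : ℝ :=
  ∫ ξ : Euc d, ((if m = n then (1 : ℝ) else 0) - ξ m * ξ n / (∑ i, ξ i ^ 2)) *
    Real.exp (-(4 * π ^ 2) * t * (∑ i, ξ i ^ 2)) * Real.cos (2 * π * ∑ i, x i * ξ i)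

/-- `div σ` for a matrix-valued field, `(div σ)_n = ∑_j ∂_j σ_{jn}`. -/
def divMat {d : ℕ} (σ : Euc d → Mat d) (y : Euc d) (n : Fin d) : ℝ :=
  ∑ j, fderiv ℝ (fun z => σ z j n) y (Pi.single j 1)

/-- `div u` for a vector field. -/
def divVec {d : ℕ} (u : Euc d → Euc d) (x : Euc d) : ℝ :=
  ∑ j, fderiv ℝ u x (Pi.single j 1) j

/-- `(∇u)_{mn} = ∂_n u_m`, as a matrix. -/
def gradMat {d : ℕ} (u : Euc d → Euc d) (x : Euc d) : Mat d :=
  fun m n => fderiv ℝ u x (Pi.single n 1) m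

/-- `𝕌(σ)(t) = ∫₀ᵗ e^{(t-s)Δ} ℍ div σ(s) ds`. -/
def opU {d : ℕ} (σ : ℝ → Euc d → Mat d) (t : ℝ) (x : Euc d) : Euc d := fun m =>
  ∫ s in (0 : ℝ)..t, ∫ y : Euc d, ∑ n, lerayHeatKer d (t - s) (x - y) m n * divMat (σ s) y n

/-- `𝔾(σ)(t) = ∫₀ᵗ e^{(t-s)Δ} ∇ℍ div σ(s) ds`. -/
def opG {d : ℕ} (σ : ℝ → Euc d → Mat d) (t : ℝ) (x : Euc d) : Mat d := fun m j =>
  ∫ s in (0 : ℝ)..t, ∫ y : Euc d, ∑ n,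
    fderiv ℝ (fun z => lerayHeatKer d (t - s) z m n) (x - y) (Pi.single j 1) * divMat (σ s) y n

/-- Sup norm functional. -/
def supN {X : Type*} {F : Type*} [NormedAddCommGroup F] (f : X → F) : ℝ := ⨆ x, ‖f x‖

/-- Hölder seminorm functional. -/
def holN {d : ℕ} {F : Type*} [NormedAddCommGroup F] (α : ℝ) (f : Euc d → F) : ℝ :=
  ⨆ q : Euc d × Euc d, ‖f q.1 - f q.2‖ / ‖q.1 - q.2‖ ^ α

/-- The `C^{α,p}` norm functional. -/
def capN {d : ℕ} {F : Type*} [NormedAddCommGroup F] (α p : ℝ) (f : Euc d → F) : ℝ :=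
  supN f + holN α f + (eLpNorm f (ENNReal.ofReal p) volume).toReal

/-- The `C^{1+α,p}` norm functional. -/
def c1apN {d : ℕ} {F : Type*} [NormedAddCommGroup F] [NormedSpace ℝ F] (α p : ℝ)
    (f : Euc d → F) : ℝ :=
  supN f + capN α p (fderiv ℝ f) + (eLpNorm f (ENNReal.ofReal p) volume).toReal

/-- `L^∞(0,T;Y)` norm of a path, w.r.t. a norm functional `N` on `Y`. -/
def linfN {Y : Type*} (T : ℝ) (N : Y → ℝ) (f : ℝ → Y) : ℝ :=
  ⨆ t : Icc (0 : ℝ) T, N (f (t : ℝ))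

/-- `C^β(0,T;Y)` norm of a path, w.r.t. a norm functional `N` on `Y`. -/
def cbN {Y : Type*} [Sub Y] (T β : ℝ) (N : Y → ℝ) (f : ℝ → Y) : ℝ :=
  linfN T N f +
    ⨆ q : Icc (0 : ℝ) T × Icc (0 : ℝ) T,
      N (f (q.1 : ℝ) - f (q.2 : ℝ)) / |(q.1 : ℝ) - (q.2 : ℝ)| ^ β

/-- The (classical, principal value) convolution operator with kernel `k`. -/
def pvConv {d : ℕ} {F : Type*} [NormedAddCommGroup F] [NormedSpace ℝ F] [CompleteSpace F]
    (k : Euc d → ℝ) (f : Euc d → F) (x : Euc d) : F :=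
  limUnder (𝓝[>] (0 : ℝ)) fun ε => ∫ y in {y : Euc d | ε < ‖x - y‖}, k (x - y) • f y

/-- The (notional) spatial inverse of a flow map. -/
def invX {d : ℕ} (X : ℝ → Euc d → Euc d) (s : ℝ) : Euc d → Euc d := Function.invFun (X s)

/-- The Lagrangian nonlinearity `𝒰(X,τ) = 𝕃(u₀)∘X + 𝕌(τ∘X⁻¹)∘X`. -/
def calU {d : ℕ} (u₀ : Euc d → Euc d) (X : ℝ → Euc d → Euc d) (τ : ℝ → Euc d → Mat d)
    (t : ℝ) (a : Euc d) : Euc d :=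
  opL u₀ t (X t a) + opU (fun s y => τ s (invX X s y)) t (X t a)

/-- The Lagrangian velocity gradient `g = 𝕃(∇u₀)∘X + 𝔾(τ∘X⁻¹)∘X`. -/
def lagG {d : ℕ} (u₀ : Euc d → Euc d) (X : ℝ → Euc d → Euc d) (τ : ℝ → Euc d → Mat d)
    (t : ℝ) (a : Euc d) : Mat d :=
  opL (gradMat u₀) t (X t a) + opG (fun s y => τ s (invX X s y)) t (X t a)

/-- The Lagrangian nonlinearity `𝒯(X,τ) = F(g,τ)`. -/
def calT {d : ℕ} (F : Mat d → Mat d → Mat d) (u₀ : Euc d → Euc d) (X : ℝ → Euc d → Euc d)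
    (τ : ℝ → Euc d → Mat d) (t : ℝ) (a : Euc d) : Mat d :=
  F (lagG u₀ X τ t a) (τ t a)

/-- `v ⊗ v`. -/
def outer {d : ℕ} (w : Euc d) : Mat d := fun m n => w m * w n

/-- `𝕌(∇w)` for a time dependent matrix field `w`, assembled as a matrix. -/
def opUgrad {d : ℕ} (w : ℝ → Euc d → Mat d) (t : ℝ) (x : Euc d) : Mat d := fun m j =>
  opU (fun s y => fderiv ℝ (w s) y (Pi.single j 1)) t x m

/-- The Navier–Stokes Lagrangian nonlinearity
`𝒱(X,τ,v) = 𝕃(u₀)∘X + 𝕌(τ∘X⁻¹)∘X − 𝕌((v⊗v)∘X⁻¹)∘X`. -/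
def calV {d : ℕ} (u₀ : Euc d → Euc d) (X : ℝ → Euc d → Euc d) (τ : ℝ → Euc d → Mat d)
    (v : ℝ → Euc d → Euc d) (t : ℝ) (a : Euc d) : Euc d :=
  calU u₀ X τ t a - opU (fun s y => outer (v s (invX X s y))) t (X t a)

/-- The Navier–Stokes Lagrangian velocity gradient
`g = 𝕃(∇u₀)∘X + 𝔾(τ∘X⁻¹)∘X − 𝕌(∇((v⊗v)∘X⁻¹))∘X`. -/
def lagGns {d : ℕ} (u₀ : Euc d → Euc d) (X : ℝ → Euc d → Euc d) (τ : ℝ → Euc d → Mat d)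
    (v : ℝ → Euc d → Euc d) (t : ℝ) (a : Euc d) : Mat d :=
  lagG u₀ X τ t a - opUgrad (fun s y => outer (v s (invX X s y))) t (X t a)

/-- The Navier–Stokes Lagrangian nonlinearity `𝒯(X,τ,v) = F(g,τ)`. -/
def calTns {d : ℕ} (F : Mat d → Mat d → Mat d) (u₀ : Euc d → Euc d) (X : ℝ → Euc d → Euc d)
    (τ : ℝ → Euc d → Mat d) (v : ℝ → Euc d → Euc d) (t : ℝ) (a : Euc d) : Mat d :=
  F (lagGns u₀ X τ v t a) (τ t a)

/-- The space–time commutator `[η·∇, 𝔾](σ)`. -/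
def commG {d : ℕ} (η : ℝ → Euc d → Euc d) (σ : ℝ → Euc d → Mat d) (t : ℝ) (x : Euc d) :
    Mat d :=
  fderiv ℝ (opG σ t) x (η t x) - opG (fun s y => fderiv ℝ (σ s) y (η s y)) t x

/-- The space–time commutator `[η·∇, 𝕌](σ)`. -/
def commU {d : ℕ} (η : ℝ → Euc d → Euc d) (σ : ℝ → Euc d → Mat d) (t : ℝ) (x : Euc d) :
    Euc d :=
  fderiv ℝ (opU σ t) x (η t x) - opU (fun s y => fderiv ℝ (σ s) y (η s y)) t x

/-- The total mass of the polar surface measure of the unit sphere of `Euc d`. -/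
def radConst (d : ℕ) : ℝ := d * (volume : Measure (Euc d)).real (Metric.ball 0 1)

theorem radConst_nonneg (d : ℕ) : 0 ≤ radConst d := by unfold radConst; positivity

theorem nontrivial_euc {d : ℕ} (hd : 1 ≤ d) : Nontrivial (Euc d) := by
  have : Nonempty (Fin d) := ⟨⟨0, hd⟩⟩
  infer_instance

theorem pow_mul_rpow_sub {d : ℕ} (hd : 1 ≤ d) (s : ℝ) {y : ℝ} (hy : 0 < y) :
    y ^ (d - 1) * y ^ (s - d) = y ^ (s - 1) := by
  rw [← Real.rpow_natCast y (d - 1), ← Real.rpow_add hy]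
  congr 1
  push_cast [hd]
  ring

theorem integrableOn_norm_rpow_ball {d : ℕ} (hd : 1 ≤ d) {s : ℝ} (hs : 0 < s) (r : ℝ) :
    IntegrableOn (fun z : Euc d => ‖z‖ ^ (s - d)) (Metric.ball 0 r) := by
  have := nontrivial_euc hd
  rw [integrableOn_fun_norm_addHaar (μ := (volume : Measure (Euc d)))
    (f := fun y : ℝ => y ^ (s - d))]
  rcases le_or_gt r 0 with hr | hr
  · simp [Ioo_eq_empty_of_le hr]
  have : IntegrableOn (fun y : ℝ => y ^ (s - 1)) (Ioo 0 r) := by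
    rw [← integrableOn_Ioc_iff_integrableOn_Ioo,
      ← intervalIntegrable_iff_integrableOn_Ioc_of_le hr.le]
    exact intervalIntegral.intervalIntegrable_rpow' (by linarith)
  refine this.congr_fun (fun y hy => ?_) measurableSet_Ioo
  simp only [Module.finrank_fintype_fun_eq_card, Fintype.card_fin, smul_eq_mul]
  exact (pow_mul_rpow_sub hd s hy.1).symm

theorem setIntegral_norm_rpow_ball {d : ℕ} (hd : 1 ≤ d) {s r : ℝ} (hs : 0 < s) (hr : 0 < r) :
    ∫ z in Metric.ball (0 : Euc d) r, ‖z‖ ^ (s - d) = radConst d * (r ^ s / s) := by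
  have := nontrivial_euc hd
  have h := integral_fun_norm_addHaar (volume : Measure (Euc d))
    ((Iio r).indicator fun y : ℝ => y ^ (s - d))
  have e1 : ∫ z in Metric.ball (0 : Euc d) r, ‖z‖ ^ (s - d) =
      ∫ z : Euc d, (Iio r).indicator (fun y : ℝ => y ^ (s - d)) ‖z‖ := by
    rw [← integral_indicator measurableSet_ball]
    congr 1; ext z; simp [indicator]
  have e2 : ∫ y in Ioi (0 : ℝ), y ^ (d - 1) • (Iio r).indicator (fun y : ℝ => y ^ (s - d)) y =
      r ^ s / s := by
    have : ∫ y in Ioi (0 : ℝ), y ^ (d - 1) • (Iio r).indicator (fun y : ℝ => y ^ (s - d)) y =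
        ∫ y in Ioi (0 : ℝ), (Iio r).indicator (fun y : ℝ => y ^ (s - 1)) y := by
      refine setIntegral_congr_fun measurableSet_Ioi fun y hy => ?_
      by_cases hyr : y < r
      · simp only [mem_Iio, hyr, indicator_of_mem, smul_eq_mul]
        exact pow_mul_rpow_sub hd s hy
      · simp [hyr]
    rw [this, setIntegral_indicator measurableSet_Iio, Ioi_inter_Iio,
      ← integral_Ioc_eq_integral_Ioo, ← intervalIntegral.integral_of_le hr.le,
      integral_rpow (Or.inl (by linarith))]
    simp [hs.ne']
  rw [e1, h]
  simp only [Module.finrank_fintype_fun_eq_card, Fintype.card_fin]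
  rw [e2]
  simp [radConst, mul_assoc]

theorem integrableOn_norm_rpow_far {d : ℕ} (hd : 1 ≤ d) {s r : ℝ} (hs : 0 < s) (hr : 0 < r) :
    IntegrableOn (fun z : Euc d => ‖z‖ ^ (-s - d)) {z | r ≤ ‖z‖} := by
  have := nontrivial_euc hd
  have hm : MeasurableSet {z : Euc d | r ≤ ‖z‖} := measurableSet_le measurable_const measurable_norm
  have h := integrable_fun_norm_addHaar (μ := (volume : Measure (Euc d)))
    (f := (Ici r).indicator fun y : ℝ => y ^ (-s - d))
  rw [← integrable_indicator_iff hm]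
  refine (h.2 ?_).congr (Eventually.of_forall fun z => by simp [indicator])
  have : IntegrableOn ((Ici r).indicator fun y : ℝ => y ^ (-s - 1)) (Ioi 0) := by
    have h1 : IntegrableOn (fun y : ℝ => y ^ (-s - 1)) (Ici r) := by
      rw [integrableOn_Ici_iff_integrableOn_Ioi]
      exact integrableOn_Ioi_rpow_of_lt (by linarith) hr
    exact ((integrable_indicator_iff measurableSet_Ici).2 h1).integrableOn
  refine this.congr_fun (fun y hy => ?_) measurableSet_Ioi
  simp only [Module.finrank_fintype_fun_eq_card, Fintype.card_fin]
  by_cases hyr : r ≤ y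
  · simp only [mem_Ici, hyr, indicator_of_mem, smul_eq_mul]
    exact (pow_mul_rpow_sub hd (-s) hy).symm
  · simp [hyr]

theorem setIntegral_norm_rpow_far {d : ℕ} (hd : 1 ≤ d) {s r : ℝ} (hs : 0 < s) (hr : 0 < r) :
    ∫ z in {z : Euc d | r ≤ ‖z‖}, ‖z‖ ^ (-s - d) = radConst d * (r ^ (-s) / s) := by
  have := nontrivial_euc hd
  have hm : MeasurableSet {z : Euc d | r ≤ ‖z‖} := measurableSet_le measurable_const measurable_norm
  have h := integral_fun_norm_addHaar (volume : Measure (Euc d))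
    ((Ici r).indicator fun y : ℝ => y ^ (-s - d))
  have e1 : ∫ z in {z : Euc d | r ≤ ‖z‖}, ‖z‖ ^ (-s - d) =
      ∫ z : Euc d, (Ici r).indicator (fun y : ℝ => y ^ (-s - d)) ‖z‖ := by
    rw [← integral_indicator hm]
    rfl
  have e2 : ∫ y in Ioi (0 : ℝ), y ^ (d - 1) • (Ici r).indicator (fun y : ℝ => y ^ (-s - d)) y =
      r ^ (-s) / s := by
    have : ∫ y in Ioi (0 : ℝ), y ^ (d - 1) • (Ici r).indicator (fun y : ℝ => y ^ (-s - d)) y =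
        ∫ y in Ioi (0 : ℝ), (Ici r).indicator (fun y : ℝ => y ^ (-s - 1)) y := by
      refine setIntegral_congr_fun measurableSet_Ioi fun y hy => ?_
      by_cases hyr : r ≤ y
      · simp only [mem_Ici, hyr, indicator_of_mem, smul_eq_mul]
        exact pow_mul_rpow_sub hd (-s) hy
      · simp [hyr]
    rw [this, setIntegral_indicator measurableSet_Ici,
      show Ioi (0 : ℝ) ∩ Ici r = Ici r from
        inter_eq_self_of_subset_right (fun y hy => hr.trans_le hy),
      integral_Ici_eq_integral_Ioi, integral_Ioi_rpow_of_lt (by linarith) hr]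
    rw [sub_add_cancel, neg_div_neg_eq]
  rw [e1, h]
  simp only [Module.finrank_fintype_fun_eq_card, Fintype.card_fin]
  rw [e2]
  simp [radConst, mul_assoc]

theorem measurableSet_norm_sub_lt {d : ℕ} (x : Euc d) (r : ℝ) :
    MeasurableSet {y : Euc d | ‖x - y‖ < r} :=
  (isOpen_lt (by fun_prop) continuous_const).measurableSet

theorem measurableSet_le_norm_sub {d : ℕ} (x : Euc d) (r : ℝ) :
    MeasurableSet {y : Euc d | r ≤ ‖x - y‖} :=
  (isClosed_le continuous_const (by fun_prop)).measurableSet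

theorem setIntegral_comp_sub_left {d : ℕ} {F : Type*} [NormedAddCommGroup F] [NormedSpace ℝ F]
    (S : Set (Euc d)) (g : Euc d → F) (x : Euc d) :
    ∫ y in {y | x - y ∈ S}, g (x - y) = ∫ z in S, g z :=
  (Measure.measurePreserving_sub_left volume x).setIntegral_preimage_emb
    (MeasurableEquiv.subLeft x).measurableEmbedding g S

theorem integrableOn_comp_sub_left {d : ℕ} {F : Type*} [NormedAddCommGroup F]
    (S : Set (Euc d)) (g : Euc d → F) (x : Euc d) :
    IntegrableOn (fun y => g (x - y)) {y | x - y ∈ S} ↔ IntegrableOn g S :=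
  (Measure.measurePreserving_sub_left volume x).integrableOn_comp_preimage
    (MeasurableEquiv.subLeft x).measurableEmbedding

/-- A function dominated by `B |x - y|^{s-d}` near `x` has integral at most a multiple of
`B r^s` over the ball of radius `r`. -/
theorem norm_setIntegral_near_le {d : ℕ} (hd : 1 ≤ d) {s r B : ℝ} (hs : 0 < s) (hr : 0 < r)
    {F : Type*} [NormedAddCommGroup F] [NormedSpace ℝ F]
    (x : Euc d) {g : Euc d → F} (hg : ∀ y, ‖x - y‖ < r → ‖g y‖ ≤ B * ‖x - y‖ ^ (s - d)) :
    ‖∫ y in {y | ‖x - y‖ < r}, g y‖ ≤ B * (radConst d * (r ^ s / s)) := by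
  have e : {y : Euc d | ‖x - y‖ < r} = {y | x - y ∈ Metric.ball (0 : Euc d) r} := by ext; simp
  have hi : IntegrableOn (fun y => ‖x - y‖ ^ (s - d)) {y | ‖x - y‖ < r} := by
    rw [e]
    exact (integrableOn_comp_sub_left _ (fun z : Euc d => ‖z‖ ^ (s - d)) x).2
      (integrableOn_norm_rpow_ball hd hs r)
  refine (norm_integral_le_of_norm_le (hi.const_mul B)
    (ae_restrict_of_forall_mem (measurableSet_norm_sub_lt x r) hg)).trans_eq ?_
  rw [integral_const_mul, e, setIntegral_comp_sub_left _ (fun z : Euc d => ‖z‖ ^ (s - d)) x,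
    setIntegral_norm_rpow_ball hd hs hr]

/-- A function dominated by `B |x - y|^{-s-d}` far from `x` has integral at most a multiple of
`B r^{-s}` outside the ball of radius `r`. -/
theorem norm_setIntegral_far_le {d : ℕ} (hd : 1 ≤ d) {s r B : ℝ} (hs : 0 < s) (hr : 0 < r)
    {F : Type*} [NormedAddCommGroup F] [NormedSpace ℝ F]
    (x : Euc d) {g : Euc d → F} (hg : ∀ y, r ≤ ‖x - y‖ → ‖g y‖ ≤ B * ‖x - y‖ ^ (-s - d)) :
    ‖∫ y in {y | r ≤ ‖x - y‖}, g y‖ ≤ B * (radConst d * (r ^ (-s) / s)) := by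
  have e : {y : Euc d | r ≤ ‖x - y‖} = {y | x - y ∈ {z : Euc d | r ≤ ‖z‖}} := rfl
  have hi : IntegrableOn (fun y => ‖x - y‖ ^ (-s - d)) {y | r ≤ ‖x - y‖} := by
    rw [e]
    exact (integrableOn_comp_sub_left _ (fun z : Euc d => ‖z‖ ^ (-s - d)) x).2
      (integrableOn_norm_rpow_far hd hs hr)
  refine (norm_integral_le_of_norm_le (hi.const_mul B)
    (ae_restrict_of_forall_mem (measurableSet_le_norm_sub x r) hg)).trans_eq ?_
  rw [integral_const_mul, e, setIntegral_comp_sub_left _ (fun z : Euc d => ‖z‖ ^ (-s - d)) x,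
    setIntegral_norm_rpow_far hd hs hr]

/-- A function dominated by `B |x - y|^{-d}` has bounded integrals over the subsets of the annulus
`a ≤ |x - y| < b`. -/
theorem norm_setIntegral_annulus_le {d : ℕ} (hd : 1 ≤ d) {a b B : ℝ} (ha : 0 < a) (hb : 0 < b)
    (hB : 0 ≤ B) {F : Type*} [NormedAddCommGroup F] [NormedSpace ℝ F]
    (x : Euc d) {S : Set (Euc d)} (hS : MeasurableSet S)
    (hSa : ∀ y ∈ S, a ≤ ‖x - y‖) (hSb : ∀ y ∈ S, ‖x - y‖ ≤ b)
    {g : Euc d → F} (hg : ∀ y ∈ S, ‖g y‖ ≤ B * ‖x - y‖ ^ (-(d : ℝ))) :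
    ‖∫ y in S, g y‖ ≤ B * (radConst d * (b / a)) := by
  have h := norm_setIntegral_far_le hd (s := 1) (r := a) (B := B * b) one_pos ha x
    (g := S.indicator g) fun y hy => ?_
  · rw [setIntegral_indicator hS, show {y | a ≤ ‖x - y‖} ∩ S = S from
      inter_eq_self_of_subset_right hSa] at h
    refine h.trans_eq ?_
    rw [Real.rpow_neg_one]; field_simp
  · have hp : 0 < ‖x - y‖ := ha.trans_le hy
    by_cases hyS : y ∈ S
    · rw [indicator_of_mem hyS]
      refine (hg y hyS).trans ?_
      rw [mul_assoc]
      refine mul_le_mul_of_nonneg_left ?_ hB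
      have : ‖x - y‖ ^ (-(d : ℝ)) = ‖x - y‖ * ‖x - y‖ ^ (-1 - (d : ℝ)) := by
        rw [← Real.rpow_one_add' hp.le (by ring_nf; simp; omega)]; congr 1; ring
      rw [this]
      exact mul_le_mul_of_nonneg_right (hSb y hyS) (by positivity)
    · rw [indicator_of_notMem hyS, norm_zero]; positivity

/-- The constant in the Hölder bound for singular integrals. -/
def holderConst (d : ℕ) (α : ℝ) : ℝ :=
  radConst d * (2 ^ α / α) + radConst d * (3 ^ α / α) + radConst d * (2 ^ (α - 1) / (1 - α)) +
    (1 + radConst d * 3)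

theorem holderConst_nonneg (d : ℕ) {α : ℝ} (hα0 : 0 < α) (hα1 : α < 1) : 0 ≤ holderConst d α := by
  have := radConst_nonneg d
  have : 0 < 1 - α := by linarith
  unfold holderConst
  positivity

/-- A singular integral, applied to increments of a Hölder function, is Hölder. -/
theorem holder_singular {d : ℕ} (hd : 1 ≤ d) {α : ℝ} (hα0 : 0 < α) (hα1 : α < 1) {A M : ℝ}
    {N : Euc d → Euc d → ℝ} {f : Euc d → ℝ} (hN : ∀ x, Integrable (N x))
    (hsize : ∀ x y, |N x y| ≤ A * ‖x - y‖ ^ (-(d : ℝ)))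
    (hreg : ∀ x x' y, 2 * ‖x - x'‖ ≤ ‖x - y‖ →
      |N x y - N x' y| ≤ A * ‖x - x'‖ * ‖x - y‖ ^ (-1 - (d : ℝ)))
    (hcanc : ∀ x r, 0 < r → |∫ y in {y | r ≤ ‖x - y‖}, N x y| ≤ A)
    (hf : Continuous f) (hfb : ∃ B, ∀ x, |f x| ≤ B)
    (hfM : ∀ x y, |f x - f y| ≤ M * ‖x - y‖ ^ α) (x x' : Euc d) :
    |(∫ y, N x y * (f y - f x)) - ∫ y, N x' y * (f y - f x')| ≤
      holderConst d α * A * M * ‖x - x'‖ ^ α := by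
  rcases eq_or_ne x x' with rfl | hne
  · simp [Real.zero_rpow hα0.ne']
  have := nontrivial_euc hd
  set h := ‖x - x'‖ with hh
  have hpos : 0 < h := by rw [hh]; exact norm_pos_iff.2 (sub_ne_zero.2 hne)
  obtain ⟨B, hB⟩ := hfb
  have hM : 0 ≤ M := by
    have := (abs_nonneg _).trans (hfM x x')
    exact nonneg_of_mul_nonneg_left this (Real.rpow_pos_of_pos hpos _)
  have hA : 0 ≤ A := (abs_nonneg _).trans (hcanc x 1 one_pos)
  have hInt : ∀ u v, Integrable fun y => N u y * (f y - f v) := fun u v =>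
    (hN u).mul_bdd (c := B + B) (by fun_prop) (Eventually.of_forall fun y =>
      (norm_sub_le _ _).trans (add_le_add (hB y) (hB v)))
  set S : Set (Euc d) := {y | ‖x - y‖ < 2 * h} with hSdef
  have hS : MeasurableSet S := measurableSet_norm_sub_lt x _
  have hSc : Sᶜ = {y | 2 * h ≤ ‖x - y‖} := by ext; simp [hSdef]
  have htri : ∀ y, ‖x' - y‖ ≤ h + ‖x - y‖ := fun y => by
    have : x' - y = (x - y) - (x - x') := by abel
    rw [this]; linarith [norm_sub_le (x - y) (x - x')]
  have htri' : ∀ y, ‖x - y‖ ≤ h + ‖x' - y‖ := fun y => by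
    have : x - y = (x' - y) + (x - x') := by abel
    rw [this]; linarith [norm_add_le (x' - y) (x - x')]
  have hprod : ∀ u v, |N u v * (f v - f u)| ≤ A * M * ‖u - v‖ ^ (α - d) := by
    intro u v
    rcases eq_or_ne u v with rfl | huv
    · simp only [sub_self, mul_zero, abs_zero]; positivity
    have hp : 0 < ‖u - v‖ := norm_pos_iff.2 (sub_ne_zero.2 huv)
    rw [abs_mul]
    calc |N u v| * |f v - f u| ≤ (A * ‖u - v‖ ^ (-(d : ℝ))) * (M * ‖u - v‖ ^ α) := by
          refine mul_le_mul (hsize u v) ?_ (abs_nonneg _) (by positivity)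
          rw [abs_sub_comm]; exact hfM u v
      _ = A * M * ‖u - v‖ ^ (α - d) := by
          rw [sub_eq_add_neg α, Real.rpow_add hp]; ring
  have b1 : |∫ y in S, N x y * (f y - f x)| ≤ A * M * (radConst d * ((2 * h) ^ α / α)) := by
    rw [← Real.norm_eq_abs]
    exact norm_setIntegral_near_le hd hα0 (by positivity) x fun y _ => hprod x y
  have b2 : |∫ y in S, N x' y * (f y - f x')| ≤ A * M * (radConst d * ((3 * h) ^ α / α)) := by
    have := norm_setIntegral_near_le hd hα0 (r := 3 * h) (B := A * M) (by positivity) x'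
      (g := S.indicator fun y => N x' y * (f y - f x')) fun y _ => by
        refine (norm_indicator_le_norm_self _ _).trans (hprod x' y)
    rw [setIntegral_indicator hS, show {y | ‖x' - y‖ < 3 * h} ∩ S = S from
      inter_eq_self_of_subset_right fun y (hy : ‖x - y‖ < 2 * h) =>
        show ‖x' - y‖ < 3 * h by linarith [htri y]] at this
    exact this
  have b3 : |∫ y in Sᶜ, (N x y - N x' y) * (f y - f x)| ≤
      A * h * M * (radConst d * ((2 * h) ^ (-(1 - α)) / (1 - α))) := by
    rw [hSc, ← Real.norm_eq_abs]
    refine norm_setIntegral_far_le hd (sub_pos.2 hα1) (by positivity) x fun y hy => ?_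
    have hp : 0 < ‖x - y‖ := lt_of_lt_of_le (by positivity) hy
    rw [Real.norm_eq_abs, abs_mul]
    calc |N x y - N x' y| * |f y - f x|
        ≤ (A * h * ‖x - y‖ ^ (-1 - (d : ℝ))) * (M * ‖x - y‖ ^ α) := by
          refine mul_le_mul (hreg x x' y hy) ?_ (abs_nonneg _) (by positivity)
          rw [abs_sub_comm]; exact hfM x y
      _ = A * h * M * ‖x - y‖ ^ (-(1 - α) - d) := by
          rw [show -(1 - α) - (d : ℝ) = (-1 - d) + α by ring, Real.rpow_add hp]; ring
  have b4 : |∫ y in Sᶜ, N x' y| ≤ A * (1 + radConst d * 3) := by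
    have hsub : {y | 3 * h ≤ ‖x' - y‖} ⊆ Sᶜ := by
      rw [hSc]; intro y (hy : 3 * h ≤ ‖x' - y‖); show 2 * h ≤ ‖x - y‖; linarith [htri y]
    have e := setIntegral_union (μ := volume) (f := N x')
      (disjoint_sdiff_right (s := {y | 3 * h ≤ ‖x' - y‖}) (t := Sᶜ))
      (hS.compl.diff (measurableSet_le_norm_sub _ _)) (hN x').integrableOn (hN x').integrableOn
    rw [union_sdiff_self, union_eq_self_of_subset_left hsub] at e
    rw [e]
    have h1 := hcanc x' (3 * h) (by positivity)
    have h2 : |∫ y in Sᶜ \ {y | 3 * h ≤ ‖x' - y‖}, N x' y| ≤ A * (radConst d * (3 * h / h)) := by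
      rw [← Real.norm_eq_abs]
      refine norm_setIntegral_annulus_le hd hpos (by positivity) hA x'
        (hS.compl.diff (measurableSet_le_norm_sub _ _)) ?_ ?_ fun y _ => hsize x' y
      · rintro y ⟨hy, -⟩
        rw [hSc] at hy
        have : 2 * h ≤ ‖x - y‖ := hy
        linarith [htri' y]
      · rintro y ⟨-, hy⟩
        exact (not_le.1 hy).le
    rw [mul_div_assoc, div_self hpos.ne', mul_one] at h2
    calc _ ≤ _ := abs_add_le _ _
      _ ≤ A + A * (radConst d * 3) := add_le_add h1 h2
      _ = _ := by ring
  have key : (∫ y, N x y * (f y - f x)) - ∫ y, N x' y * (f y - f x') =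
      (∫ y in S, N x y * (f y - f x)) - (∫ y in S, N x' y * (f y - f x')) +
      ((∫ y in Sᶜ, (N x y - N x' y) * (f y - f x)) + (f x' - f x) * ∫ y in Sᶜ, N x' y) := by
    have e2 : (∫ y in Sᶜ, N x y * (f y - f x)) - (∫ y in Sᶜ, N x' y * (f y - f x')) =
      (∫ y in Sᶜ, (N x y - N x' y) * (f y - f x)) + (f x' - f x) * ∫ y in Sᶜ, N x' y := by
      rw [← integral_const_mul, ← integral_sub (hInt _ _).integrableOn (hInt _ _).integrableOn,
        ← integral_add]
      · congr 1; ext y; ring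
      · have := (hInt x x).sub (hInt x' x)
        refine (this.congr (Eventually.of_forall fun y => ?_)).integrableOn
        simp only [Pi.sub_apply]; ring
      · exact ((hN x').const_mul _).integrableOn
    rw [← e2, ← integral_add_compl hS (hInt x x), ← integral_add_compl hS (hInt x' x')]
    ring
  rw [key]
  have b5 : |(f x' - f x) * ∫ y in Sᶜ, N x' y| ≤ (M * h ^ α) * (A * (1 + radConst d * 3)) := by
    rw [abs_mul]
    refine mul_le_mul ?_ b4 (abs_nonneg _) (by positivity)
    rw [abs_sub_comm]; exact hfM x x'
  have e3 : A * h * M * (radConst d * ((2 * h) ^ (-(1 - α)) / (1 - α))) =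
      A * M * (radConst d * (2 ^ (α - 1) / (1 - α))) * h ^ α := by
    rw [Real.mul_rpow (by norm_num) hpos.le, show -(1 - α) = α - 1 by ring,
      Real.rpow_sub_one hpos.ne']
    field_simp
  rw [e3] at b3
  rw [Real.mul_rpow (by norm_num) hpos.le] at b1 b2
  calc _ ≤ |∫ y in S, N x y * (f y - f x)| + |∫ y in S, N x' y * (f y - f x')| +
        (|∫ y in Sᶜ, (N x y - N x' y) * (f y - f x)| + |(f x' - f x) * ∫ y in Sᶜ, N x' y|) :=
        (abs_add_le _ _).trans (add_le_add (abs_sub _ _) (abs_add_le _ _))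
    _ ≤ _ := add_le_add (add_le_add b1 b2) (add_le_add b3 b5)
    _ = _ := by unfold holderConst; ring

/-- Regularized Calderón–Zygmund convolution kernels with constant `A`. -/
structure IsCZ {d : ℕ} (A : ℝ) (K : Euc d → ℝ) : Prop where
  contDiff : ContDiff ℝ 1 K
  compact : HasCompactSupport K
  size : ∀ z, |K z| ≤ A * ‖z‖ ^ (-(d : ℝ))
  grad : ∀ z, ‖fderiv ℝ K z‖ ≤ A * ‖z‖ ^ (-1 - (d : ℝ))
  canc : ∀ r, 0 < r → |∫ z in {z | ‖z‖ < r}, K z| ≤ A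

/-- Convolution with `K`. -/
def czT {d : ℕ} (K f : Euc d → ℝ) (x : Euc d) : ℝ := ∫ y, K (x - y) * f y

theorem norm_sub_le_of_fderiv_decay {d : ℕ} {F : Type*} [NormedAddCommGroup F] [NormedSpace ℝ F]
    {G : Euc d → F} (hG : Differentiable ℝ G) {A s : ℝ} (hA : 0 ≤ A) (hs : 0 ≤ s)
    (hgrad : ∀ z, ‖fderiv ℝ G z‖ ≤ A * ‖z‖ ^ (-s)) {a b : Euc d} (hab : 2 * ‖a - b‖ ≤ ‖a‖) :
    ‖G a - G b‖ ≤ A * 2 ^ s * ‖a‖ ^ (-s) * ‖a - b‖ := by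
  rcases eq_or_ne a 0 with rfl | ha
  · have : b = 0 := norm_le_zero_iff.1 (by simp at hab; linarith)
    simp [this]
  have hp : 0 < ‖a‖ := norm_pos_iff.2 ha
  refine (convex_closedBall a (‖a‖ / 2)).norm_image_sub_le_of_norm_fderiv_le (𝕜 := ℝ)
    (C := A * 2 ^ s * ‖a‖ ^ (-s)) (fun w _ => hG w) (fun w hw => ?_)
    (by rw [mem_closedBall_iff_norm']; linarith) (Metric.mem_closedBall_self (by positivity))
  refine (hgrad w).trans ?_
  rw [mul_assoc]
  refine mul_le_mul_of_nonneg_left ?_ hA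
  have hw' : ‖a‖ / 2 ≤ ‖w‖ := by
    rw [mem_closedBall_iff_norm'] at hw
    have := norm_sub_norm_le a w
    linarith
  refine (Real.rpow_le_rpow_of_nonpos (by positivity) hw' (by linarith)).trans_eq ?_
  rw [Real.div_rpow hp.le (by norm_num), Real.rpow_neg (by norm_num : (0 : ℝ) ≤ 2)]
  field_simp

section
variable {d : ℕ} {A : ℝ} {K : Euc d → ℝ}

theorem IsCZ.nonneg (hK : IsCZ A K) : 0 ≤ A := (abs_nonneg _).trans (hK.canc 1 one_pos)

theorem IsCZ.integrable (hK : IsCZ A K) : Integrable K :=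
  hK.contDiff.continuous.integrable_of_hasCompactSupport hK.compact

theorem IsCZ.abs_integral_le (hK : IsCZ A K) : |∫ z, K z| ≤ A := by
  obtain ⟨r, hr0, hr⟩ := hK.compact.isCompact.isBounded.subset_ball_lt 0 0
  have h := hK.canc r hr0
  rwa [setIntegral_eq_integral_of_forall_compl_eq_zero] at h
  intro z hz
  by_contra hne
  exact hz (by simpa using hr (subset_tsupport _ hne))

theorem IsCZ.sub_le (hK : IsCZ A K) {a b : Euc d} (hab : 2 * ‖a - b‖ ≤ ‖a‖) :
    |K a - K b| ≤ 2 ^ (d + 1) * A * ‖a - b‖ * ‖a‖ ^ (-1 - (d : ℝ)) := by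
  have := norm_sub_le_of_fderiv_decay (hK.contDiff.differentiable one_ne_zero) hK.nonneg
    (s := 1 + d) (by positivity) (fun z => by rw [neg_add']; exact hK.grad z) hab
  rw [neg_add', show (2 : ℝ) ^ (1 + (d : ℝ)) = 2 ^ (d + 1) by
    rw [add_comm]; exact_mod_cast Real.rpow_natCast 2 (d + 1)] at this
  calc _ ≤ _ := this
    _ = _ := by ring

theorem IsCZ.integrable_mul (hK : IsCZ A K) {f : Euc d → ℝ} (hf : LocallyIntegrable f)
    (x : Euc d) : Integrable fun y => K (x - y) * f y := by
  have h1 : Continuous fun y => K (x - y) := hK.contDiff.continuous.comp (by fun_prop)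
  have h2 : HasCompactSupport fun y => K (x - y) :=
    hK.compact.comp_homeomorph (Homeomorph.subLeft x)
  exact hf.integrable_smul_left_of_hasCompactSupport h1 h2

theorem IsCZ.abs_setIntegral_far_le (hK : IsCZ A K) (x : Euc d) {r : ℝ} (hr : 0 < r) :
    |∫ y in {y | r ≤ ‖x - y‖}, K (x - y)| ≤ 2 * A := by
  rw [show {y | r ≤ ‖x - y‖} = {y | x - y ∈ {z : Euc d | ‖z‖ < r}ᶜ} by ext; simp,
    setIntegral_comp_sub_left]
  have hm : MeasurableSet {z : Euc d | ‖z‖ < r} := measurableSet_lt measurable_norm measurable_const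
  have := integral_add_compl hm hK.integrable
  rw [← eq_sub_iff_add_eq'] at this
  rw [this]
  calc _ ≤ _ := abs_sub _ _
    _ ≤ A + A := add_le_add hK.abs_integral_le (hK.canc r hr)
    _ = _ := by ring

theorem czT_eq_add (hK : IsCZ A K) {f : Euc d → ℝ} (hf : LocallyIntegrable f) (x : Euc d) :
    czT K f x = (∫ y, K (x - y) * (f y - f x)) + f x * ∫ z, K z := by
  have h1 := hK.integrable_mul hf x
  have h2 : Integrable fun y => K (x - y) := hK.integrable.comp_sub_left x
  simp_rw [mul_sub]
  rw [integral_sub h1 (h2.mul_const _), integral_mul_const, integral_sub_left_eq_self K volume x,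
    czT]
  ring

/-- Regularized Calderón–Zygmund operators are bounded in the Hölder seminorm. -/
theorem czT_holder (hd : 1 ≤ d) {α : ℝ} (hα0 : 0 < α) (hα1 : α < 1) (hK : IsCZ A K)
    {f : Euc d → ℝ} {M : ℝ} (hf : Continuous f) (hfb : ∃ B, ∀ x, |f x| ≤ B)
    (hfM : ∀ x y, |f x - f y| ≤ M * ‖x - y‖ ^ α) (x x' : Euc d) :
    |czT K f x - czT K f x'| ≤
      (holderConst d α * 2 ^ (d + 1) + 1) * A * M * ‖x - x'‖ ^ α := by
  have hA := hK.nonneg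
  have h2 : (1 : ℝ) ≤ 2 ^ (d + 1) := one_le_pow₀ (by norm_num)
  have h := holder_singular hd hα0 hα1 (A := 2 ^ (d + 1) * A) (M := M) (N := fun x y => K (x - y))
    (f := f) (fun x => hK.integrable.comp_sub_left x)
    (fun x y => (hK.size _).trans (mul_le_mul_of_nonneg_right (by nlinarith) (by positivity)))
    (fun x x' y hy => by
      have := hK.sub_le (a := x - y) (b := x' - y) (by simpa using hy)
      simpa using this)
    (fun x r hr => (hK.abs_setIntegral_far_le x hr).trans
      (mul_le_mul_of_nonneg_right (by
        rw [pow_succ]; linarith [one_le_pow₀ (n := d) (by norm_num : (1 : ℝ) ≤ 2)]) hA))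
    hf hfb hfM x x'
  rw [czT_eq_add hK hf.locallyIntegrable, czT_eq_add hK hf.locallyIntegrable]
  have h3 : |(f x - f x') * ∫ z, K z| ≤ M * ‖x - x'‖ ^ α * A := by
    rw [abs_mul]
    exact mul_le_mul (hfM x x') hK.abs_integral_le (abs_nonneg _) ((abs_nonneg _).trans (hfM x x'))
  calc _ = |((∫ y, K (x - y) * (f y - f x)) - ∫ y, K (x' - y) * (f y - f x')) +
        (f x - f x') * ∫ z, K z| := by congr 1; ring
    _ ≤ _ := abs_add_le _ _
    _ ≤ _ := add_le_add h h3
    _ = _ := by ring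

end

theorem abs_sub_le_rpow_of_lipschitz {d : ℕ} {α : ℝ} (hα0 : 0 < α) (hα1 : α < 1)
    {h : Euc d → ℝ} {L S : ℝ} (hL0 : 0 ≤ L) (hL : ∀ x y, |h x - h y| ≤ L * ‖x - y‖)
    (hS : ∀ x, |h x| ≤ S) (x y : Euc d) : |h x - h y| ≤ (L + 2 * S) * ‖x - y‖ ^ α := by
  have hS0 : 0 ≤ S := (abs_nonneg _).trans (hS x)
  have hp : 0 ≤ ‖x - y‖ ^ α := by positivity
  rcases le_total ‖x - y‖ 1 with h1 | h1
  · have : ‖x - y‖ ≤ ‖x - y‖ ^ α := Real.self_le_rpow_of_le_one (norm_nonneg _) h1 hα1.le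
    have := mul_le_mul_of_nonneg_left this hL0
    nlinarith [hL x y]
  · have : 1 ≤ ‖x - y‖ ^ α := Real.one_le_rpow h1 hα0.le
    have h2 : |h x - h y| ≤ 2 * S := (abs_sub _ _).trans (by linarith [hS x, hS y])
    nlinarith

/-- The Cauchy–Schwarz inequality for integrals. -/
theorem integral_mul_sq_le {X : Type*} [MeasurableSpace X] {μ : Measure X} {f g : X → ℝ}
    (hf : MemLp f 2 μ) (hg : MemLp g 2 μ) :
    (∫ x, f x * g x ∂μ) ^ 2 ≤ (∫ x, f x ^ 2 ∂μ) * ∫ x, g x ^ 2 ∂μ := by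
  have hfg : Integrable (fun x => f x * g x) μ := hf.integrable_mul hg
  have h : ∀ t : ℝ, 0 ≤ (∫ x, g x ^ 2 ∂μ) * (t * t) + (2 * ∫ x, f x * g x ∂μ) * t +
      ∫ x, f x ^ 2 ∂μ := by
    intro t
    have : 0 ≤ ∫ x, (f x + t * g x) ^ 2 ∂μ := integral_nonneg fun x => sq_nonneg _
    have e : ∀ x, (f x + t * g x) ^ 2 = (f x ^ 2 + (2 * t) * (f x * g x)) + (t * t) * g x ^ 2 :=
      fun x => by ring
    simp_rw [e] at this
    have hsum : Integrable (fun x => f x ^ 2 + (2 * t) * (f x * g x)) μ :=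
      hf.integrable_sq.add (hfg.const_mul _)
    rw [integral_add hsum (hg.integrable_sq.const_mul _), integral_add hf.integrable_sq (hfg.const_mul _), integral_const_mul, integral_const_mul]
      at this
    linarith
  have := discrim_le_zero h
  unfold discrim at this
  linarith

section
variable {d : ℕ} {A : ℝ} {K : Euc d → ℝ}

theorem czT_eq_convolution (K f : Euc d → ℝ) :
    czT K f = convolution f K (ContinuousLinearMap.mul ℝ ℝ) volume := by
  ext x
  simp only [czT, convolution, ContinuousLinearMap.mul_apply']
  congr 1; ext y; ring

theorem IsCZ.contDiff_czT (hK : IsCZ A K) {f : Euc d → ℝ} (hf : LocallyIntegrable f) :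
    ContDiff ℝ 1 (czT K f) := by
  rw [czT_eq_convolution]
  exact hK.compact.contDiff_convolution_right _ hf hK.contDiff

theorem czT_hasCompactSupport {f : Euc d → ℝ} (hK : HasCompactSupport K)
    (hf : HasCompactSupport f) : HasCompactSupport (czT K f) := by
  rw [czT_eq_convolution]
  exact hf.convolution _ hK

theorem czT_eq_zero {f : Euc d → ℝ} {R ρ : ℝ} (hK : ∀ z, R < ‖z‖ → K z = 0)
    (hf : ∀ z, ρ < ‖z‖ → f z = 0) {x : Euc d} (hx : R + ρ < ‖x‖) : czT K f x = 0 := by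
  refine integral_eq_zero_of_ae (Eventually.of_forall fun y => ?_)
  rcases le_or_gt ‖y‖ ρ with hy | hy
  · have := norm_sub_norm_le x y
    simp [hK (x - y) (by linarith)]
  · simp [hf y hy]

theorem IsCZ.comp_neg (hK : IsCZ A K) : IsCZ A (fun z => K (-z)) where
  contDiff := hK.contDiff.comp contDiff_neg
  compact := hK.compact.comp_homeomorph (Homeomorph.neg _)
  size z := by simpa using hK.size (-z)
  grad z := by
    have : fderiv ℝ (fun z => K (-z)) z = -fderiv ℝ K (-z) := by
      simpa using fderiv_comp_smul (𝕜 := ℝ) (f := K) (x := z) (-1)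
    rw [this, norm_neg]
    simpa using hK.grad (-z)
  canc r hr := by
    have : ∫ z in {z : Euc d | ‖z‖ < r}, K (-z) = ∫ z in {z : Euc d | ‖z‖ < r}, K z := by
      have := setIntegral_comp_sub_left {z : Euc d | ‖z‖ < r} K 0
      simpa using this
    rw [this]
    exact hK.canc r hr

theorem integral_czT_mul (hK : IsCZ A K) {f g : Euc d → ℝ} (hf : Integrable f)
    (hg : Integrable g) :
    ∫ x, czT K f x * g x = ∫ y, f y * czT (fun z => K (-z)) g y := by
  obtain ⟨B, hB⟩ := hK.compact.exists_bound_of_continuous hK.contDiff.continuous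
  have hi : Integrable (Function.uncurry fun x y : Euc d => K (x - y) * (g x * f y))
      (volume.prod volume) :=
    (hg.mul_prod hf).bdd_mul (c := B)
      ((hK.contDiff.continuous.comp (by fun_prop)).aestronglyMeasurable)
      (Eventually.of_forall fun p => hB _)
  calc ∫ x, czT K f x * g x = ∫ x, ∫ y, K (x - y) * (g x * f y) := by
        congr 1; ext x
        rw [czT, ← integral_mul_const]; congr 1; ext y; ring
    _ = ∫ y, ∫ x, K (x - y) * (g x * f y) := integral_integral_swap hi
    _ = _ := by
        congr 1; ext y
        rw [czT, ← integral_const_mul]; congr 1; ext x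
        rw [neg_sub]; ring

theorem exists_support_radius {f : Euc d → ℝ} (hf : HasCompactSupport f) :
    ∃ ρ, 0 ≤ ρ ∧ ∀ z, ρ < ‖z‖ → f z = 0 := by
  obtain ⟨r, hr0, hr⟩ := hf.isCompact.isBounded.subset_closedBall_lt 0 0
  refine ⟨r, hr0.le, fun z hz => ?_⟩
  by_contra hne
  have := hr (subset_tsupport _ hne)
  simp at this
  linarith

theorem hasCompactSupport_of_radius {f : Euc d → ℝ} {ρ : ℝ} (h : ∀ z, ρ < ‖z‖ → f z = 0) :
    HasCompactSupport f :=
  HasCompactSupport.of_support_subset_isCompact (isCompact_closedBall 0 ρ) fun z hz => by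
    by_contra hn
    exact hz (h z (by simpa using hn))

/-- The square integral of a Hölder function supported in a ball. -/
theorem integral_sq_le_of_holder (hd : 1 ≤ d) {f : Euc d → ℝ} {H s : ℝ} (hs : 0 ≤ s) (hH : 0 ≤ H)
    (hf : ∀ z, s < ‖z‖ → f z = 0) (hfH : ∀ x y, |f x - f y| ≤ H * ‖x - y‖ ^ (1 / 2 : ℝ)) :
    ∫ x, f x ^ 2 ≤ H ^ 2 * (2 * s + 1) ^ (d + 2) := by
  have := nontrivial_euc hd
  have : Nonempty (Fin d) := ⟨⟨0, hd⟩⟩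
  have hb : ∀ x, |f x| ≤ H * (2 * s + 1) := by
    intro x
    rcases lt_or_ge s ‖x‖ with hx | hx
    · rw [hf x hx, abs_zero]; positivity
    · set y : Euc d := fun _ => s + 1
      have hy : ‖y‖ = s + 1 := by
        simp only [y, pi_norm_const, Real.norm_eq_abs]; exact abs_of_nonneg (by linarith)
      have h1 := hfH x y
      rw [hf y (by linarith), sub_zero] at h1
      refine h1.trans (mul_le_mul_of_nonneg_left ?_ hH)
      calc ‖x - y‖ ^ (1 / 2 : ℝ) ≤ (2 * s + 1) ^ (1 / 2 : ℝ) :=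
            Real.rpow_le_rpow (norm_nonneg _) ((norm_sub_le _ _).trans (by linarith)) (by norm_num)
        _ ≤ 2 * s + 1 := Real.rpow_le_self_of_one_le (by linarith) (by norm_num)
  have e : ∫ x, f x ^ 2 = ∫ x in Metric.closedBall (0 : Euc d) s, f x ^ 2 := by
    refine (setIntegral_eq_integral_of_forall_compl_eq_zero fun x hx => ?_).symm
    rw [hf x (by simpa using hx)]; simp
  rw [e]
  have h2 := norm_setIntegral_le_of_norm_le_const (μ := volume)
    (s := Metric.closedBall (0 : Euc d) s) (f := fun x => f x ^ 2) (C := (H * (2 * s + 1)) ^ 2)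
    measure_closedBall_lt_top fun x _ => by
      rw [Real.norm_eq_abs, abs_pow]; exact pow_le_pow_left₀ (abs_nonneg _) (hb x) 2
  refine (le_abs_self _).trans (h2.trans ?_)
  have h3 : volume.real (Metric.closedBall (0 : Euc d) s) = (2 * s) ^ d := by
    rw [Measure.real, Real.volume_pi_closedBall _ hs, ENNReal.toReal_ofReal (by positivity)]
    simp
  rw [h3, mul_pow, pow_add, mul_comm ((2 * s + 1) ^ d), ← mul_assoc]
  gcongr
  linarith

/-- The iterates of `T* T`. -/
def czU (K f : Euc d → ℝ) : Euc d → ℝ := czT (fun z => K (-z)) (czT K f)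

theorem IsCZ.continuous_czT (hK : IsCZ A K) {f : Euc d → ℝ} (hf : Continuous f) :
    Continuous (czT K f) := (hK.contDiff_czT hf.locallyIntegrable).continuous

theorem IsCZ.iterate_czU (hK : IsCZ A K) {f : Euc d → ℝ} (hf : Continuous f)
    (hfc : HasCompactSupport f) (m : ℕ) :
    Continuous ((czU K)^[m] f) ∧ HasCompactSupport ((czU K)^[m] f) := by
  induction m with
  | zero => exact ⟨hf, hfc⟩
  | succ m ih =>
    rw [Function.iterate_succ_apply']
    exact ⟨hK.comp_neg.continuous_czT (hK.continuous_czT ih.1),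
      czT_hasCompactSupport hK.comp_neg.compact (czT_hasCompactSupport hK.compact ih.2)⟩

theorem integral_czU_mul (hK : IsCZ A K) {f g : Euc d → ℝ} (hf : Continuous f)
    (hfc : HasCompactSupport f) (hg : Continuous g) (hgc : HasCompactSupport g) :
    ∫ x, czU K f x * g x = ∫ x, f x * czU K g x := by
  have hK' := hK.comp_neg
  have i1 := hf.integrable_of_hasCompactSupport hfc (μ := volume)
  have i2 := hg.integrable_of_hasCompactSupport hgc (μ := volume)
  have i3 := (hK.continuous_czT hf).integrable_of_hasCompactSupport
    (czT_hasCompactSupport hK.compact hfc) (μ := volume)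
  have i4 := (hK.continuous_czT hg).integrable_of_hasCompactSupport
    (czT_hasCompactSupport hK.compact hgc) (μ := volume)
  rw [czU, integral_czT_mul hK' i3 i2]
  simp only [neg_neg]
  exact integral_czT_mul hK i1 i4

theorem integral_iterate_czU_mul (hK : IsCZ A K) (m : ℕ) {f g : Euc d → ℝ} (hf : Continuous f)
    (hfc : HasCompactSupport f) (hg : Continuous g) (hgc : HasCompactSupport g) :
    ∫ x, (czU K)^[m] f x * g x = ∫ x, f x * (czU K)^[m] g x := by
  induction m generalizing g with
  | zero => rfl
  | succ m ih =>
    have h1 := hK.iterate_czU hf hfc m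
    have h2 := hK.iterate_czU hg hgc 1
    rw [Function.iterate_succ_apply', integral_czU_mul hK h1.1 h1.2 hg hgc,
      ih (g := czU K g) h2.1 h2.2, Function.iterate_succ_apply]

/-- The bound for the `L²` operator norm squared. -/
def l2Const (d : ℕ) (A : ℝ) : ℝ := ((holderConst d (1 / 2) * 2 ^ (d + 1) + 1) * A) ^ 2 + 1

theorem l2Const_pos (d : ℕ) (A : ℝ) : 0 < l2Const d A := by unfold l2Const; positivity

theorem iterate_czU_holder (hd : 1 ≤ d) (hK : IsCZ A K) {f : Euc d → ℝ} {M : ℝ}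
    (hf : Continuous f) (hfc : HasCompactSupport f)
    (hfM : ∀ x y, |f x - f y| ≤ M * ‖x - y‖ ^ (1 / 2 : ℝ)) (m : ℕ) (x y : Euc d) :
    |(czU K)^[m] f x - (czU K)^[m] f y| ≤ l2Const d A ^ m * M * ‖x - y‖ ^ (1 / 2 : ℝ) := by
  induction m generalizing x y with
  | zero => simpa using hfM x y
  | succ m ih =>
    obtain ⟨h1, h2⟩ := hK.iterate_czU hf hfc m
    rw [Function.iterate_succ_apply']
    have b1 := h2.exists_bound_of_continuous h1
    have h3 := hK.continuous_czT h1
    have b2 := (czT_hasCompactSupport hK.compact h2).exists_bound_of_continuous h3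
    have s1 := czT_holder hd (by norm_num) (by norm_num) hK h1 b1 ih
    have s2 := czT_holder hd (by norm_num) (by norm_num) hK.comp_neg h3 b2 s1 x y
    refine s2.trans ?_
    have hM : 0 ≤ M * ‖x - y‖ ^ (1 / 2 : ℝ) := (abs_nonneg _).trans (hfM x y)
    have hl := l2Const_pos d A
    calc _ = (((holderConst d (1 / 2) * 2 ^ (d + 1) + 1) * A) ^ 2) * l2Const d A ^ m *
          (M * ‖x - y‖ ^ (1 / 2 : ℝ)) := by ring
      _ ≤ l2Const d A * l2Const d A ^ m * (M * ‖x - y‖ ^ (1 / 2 : ℝ)) := by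
          gcongr
          unfold l2Const
          linarith
      _ = _ := by ring

theorem iterate_czU_support {R ρ : ℝ} {f : Euc d → ℝ} (hKR : ∀ z, R < ‖z‖ → K z = 0)
    (hfρ : ∀ z, ρ < ‖z‖ → f z = 0) (m : ℕ) (z : Euc d) (hz : ρ + m * (2 * R) < ‖z‖) :
    (czU K)^[m] f z = 0 := by
  induction m generalizing z with
  | zero => exact hfρ z (by simpa using hz)
  | succ m ih =>
    rw [Function.iterate_succ_apply']
    have h1 : ∀ z, R + (ρ + m * (2 * R)) < ‖z‖ → czT K ((czU K)^[m] f) z = 0 :=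
      fun z hz => czT_eq_zero hKR ih hz
    refine czT_eq_zero (fun z hz => hKR (-z) (by simpa using hz)) h1 ?_
    push_cast at hz
    linarith

/-- The symmetrization argument of Krein and Lax: boundedness in a Hölder seminorm implies
boundedness in `L²`. -/
theorem integral_czT_sq_le_of_holder (hd : 1 ≤ d) (hK : IsCZ A K) {f : Euc d → ℝ} {M : ℝ}
    (hf : Continuous f) (hfc : HasCompactSupport f)
    (hfM : ∀ x y, |f x - f y| ≤ M * ‖x - y‖ ^ (1 / 2 : ℝ)) :
    ∫ x, czT K f x ^ 2 ≤ l2Const d A * ∫ x, f x ^ 2 := by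
  have hD := l2Const_pos d A
  set D := l2Const d A with hDdef
  obtain ⟨R, hR0, hR⟩ := exists_support_radius hK.compact
  obtain ⟨ρ, hρ0, hρ⟩ := exists_support_radius hfc
  set u : ℕ → Euc d → ℝ := fun m => (czU K)^[m] f with hu
  set q : ℕ → ℝ := fun m => ∫ x, u m x ^ 2 with hq
  have hcont : ∀ m, Continuous (u m) := fun m => (hK.iterate_czU hf hfc m).1
  have hcs : ∀ m, HasCompactSupport (u m) := fun m => (hK.iterate_czU hf hfc m).2
  have hL2 : ∀ m, MemLp (u m) 2 := fun m => (hcont m).memLp_of_hasCompactSupport (hcs m)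
  have hq0 : ∀ m, 0 ≤ q m := fun m => integral_nonneg fun x => sq_nonneg _
  have hdouble : ∀ m, q m ^ 2 ≤ q 0 * q (2 * m) := by
    intro m
    have e : q m = ∫ x, u 0 x * u (2 * m) x := by
      simp only [hq, sq, hu]
      rw [integral_iterate_czU_mul hK m hf hfc (hcont m) (hcs m), two_mul]
      simp only [hu, Function.iterate_add_apply, Function.iterate_zero, id_eq]
    rw [e]
    exact integral_mul_sq_le (hL2 0) (hL2 _)
  have hM : 0 ≤ M := by
    have := nontrivial_euc hd
    obtain ⟨x, y, hxy⟩ := exists_pair_ne (Euc d)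
    have h1 : 0 < ‖x - y‖ := norm_pos_iff.2 (sub_ne_zero.2 hxy)
    exact nonneg_of_mul_nonneg_left ((abs_nonneg _).trans (hfM x y)) (Real.rpow_pos_of_pos h1 _)
  have hgrow : ∀ m : ℕ, 1 ≤ m → q m ≤ (D ^ 2) ^ m *
      (M ^ 2 * (2 * ρ + 4 * R + 1) ^ (d + 2)) * (m : ℝ) ^ (d + 2) := by
    intro m hm
    have hm' : (1 : ℝ) ≤ m := by exact_mod_cast hm
    have := integral_sq_le_of_holder hd (f := u m) (H := D ^ m * M) (s := ρ + m * (2 * R))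
      (by positivity) (by positivity) (iterate_czU_support hR hρ m)
      (iterate_czU_holder hd hK hf hfc hfM m)
    refine this.trans ?_
    calc (D ^ m * M) ^ 2 * (2 * (ρ + m * (2 * R)) + 1) ^ (d + 2)
        ≤ (D ^ m * M) ^ 2 * ((2 * ρ + 4 * R + 1) * m) ^ (d + 2) := by
          gcongr
          nlinarith
      _ = _ := by rw [mul_pow (2 * ρ + 4 * R + 1)]; ring
  have main : q 1 ≤ D ^ 2 * q 0 := by
    by_contra! hcon
    have hq00 : 0 < q 0 := by
      rcases (hq0 0).lt_or_eq with h | h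
      · exact h
      · have := hdouble 1
        rw [← h, zero_mul] at this
        rw [← h, mul_zero] at hcon
        nlinarith
    set t := q 1 / q 0 / D ^ 2 with ht
    have ht1 : 1 < t := by
      rw [ht, lt_div_iff₀ (by positivity), lt_div_iff₀ hq00]; linarith
    have hpow : ∀ n : ℕ, (q 1 / q 0) ^ 2 ^ n ≤ q (2 ^ n) / q 0 := by
      intro n
      induction n with
      | zero => simp
      | succ n ih =>
        have h1 : 0 ≤ q 1 / q 0 := div_nonneg (hq0 _) (hq0 _)
        calc (q 1 / q 0) ^ 2 ^ (n + 1) = ((q 1 / q 0) ^ 2 ^ n) ^ 2 := by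
              rw [← pow_mul, pow_succ]
          _ ≤ (q (2 ^ n) / q 0) ^ 2 := pow_le_pow_left₀ (by positivity) ih 2
          _ ≤ q (2 ^ (n + 1)) / q 0 := by
              rw [div_pow, div_le_div_iff₀ (by positivity) hq00]
              have := hdouble (2 ^ n)
              rw [← pow_succ'] at this
              nlinarith
    set c := M ^ 2 * (2 * ρ + 4 * R + 1) ^ (d + 2) / q 0 with hc
    have hup : ∀ n : ℕ, t ^ 2 ^ n ≤ c * ((2 ^ n : ℕ) : ℝ) ^ (d + 2) := by
      intro n
      rw [ht, div_pow, div_le_iff₀ (by positivity)]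
      refine (hpow n).trans ?_
      rw [div_le_iff₀ hq00]
      refine (hgrow (2 ^ n) Nat.one_le_two_pow).trans_eq ?_
      rw [hc]
      field_simp
    have hlim := (tendsto_pow_const_div_const_pow_of_one_lt (d + 2) ht1).const_mul c
    rw [mul_zero] at hlim
    have hlim2 := hlim.comp (tendsto_pow_atTop_atTop_of_one_lt (one_lt_two (α := ℕ)))
    obtain ⟨n, hn⟩ := (hlim2.eventually (gt_mem_nhds one_pos)).exists
    simp only [Function.comp_apply] at hn
    rw [← mul_div_assoc, div_lt_one (by positivity)] at hn
    exact absurd (hup n) (not_le.2 hn)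
  have hT : ∫ x, czT K f x ^ 2 = ∫ x, u 0 x * u 1 x := by
    simp only [sq, hu, Function.iterate_zero, id_eq, Function.iterate_one]
    exact integral_czT_mul hK (hf.integrable_of_hasCompactSupport hfc)
      ((hK.continuous_czT hf).integrable_of_hasCompactSupport
        (czT_hasCompactSupport hK.compact hfc))
  have h2 : (∫ x, czT K f x ^ 2) ^ 2 ≤ (D * q 0) ^ 2 := by
    rw [hT]
    refine (integral_mul_sq_le (hL2 0) (hL2 1)).trans ?_
    change q 0 * q 1 ≤ _
    nlinarith [hq0 0]
  exact le_of_sq_le_sq h2 (mul_nonneg hD.le (hq0 0))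

/-- Regularized Calderón–Zygmund operators are bounded on `L²`. -/
theorem integral_czT_sq_le (hd : 1 ≤ d) (hK : IsCZ A K) {g : Euc d → ℝ} (hg : Integrable g)
    (hg2 : MemLp g 2) (hgc : HasCompactSupport g) :
    ∫ x, czT K g x ^ 2 ≤ l2Const d A * ∫ x, g x ^ 2 := by
  have hD := l2Const_pos d A
  have hC1 := hK.contDiff_czT hg.locallyIntegrable
  have hcs := czT_hasCompactSupport hK.compact hgc
  set h := czT K g with hh
  obtain ⟨L, hL⟩ := hC1.lipschitzWith_of_hasCompactSupport hcs one_ne_zero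
  obtain ⟨S, hS⟩ := hcs.exists_bound_of_continuous hC1.continuous
  have hhol := abs_sub_le_rpow_of_lipschitz (α := 1 / 2) (by norm_num) (by norm_num) L.2
    (fun x y => by simpa [dist_eq_norm] using hL.dist_le_mul x y) hS
  have h1 := integral_czT_sq_le_of_holder hd hK.comp_neg hC1.continuous hcs hhol
  have hi : Integrable h := hC1.continuous.integrable_of_hasCompactSupport hcs
  have hT2 : MemLp (czT (fun z => K (-z)) h) 2 :=
    (hK.comp_neg.continuous_czT hC1.continuous).memLp_of_hasCompactSupport
      (czT_hasCompactSupport hK.comp_neg.compact hcs)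
  have e : ∫ x, h x ^ 2 = ∫ y, g y * czT (fun z => K (-z)) h y := by
    simp only [sq]; exact integral_czT_mul hK hg hi
  have h2 := integral_mul_sq_le hg2 hT2
  rw [← e] at h2
  have hg0 : 0 ≤ ∫ x, g x ^ 2 := integral_nonneg fun x => sq_nonneg _
  have hh0 : 0 ≤ ∫ x, h x ^ 2 := integral_nonneg fun x => sq_nonneg _
  rcases hh0.eq_or_lt with h3 | h3
  · rw [← h3]; positivity
  · have := h2.trans (mul_le_mul_of_nonneg_left h1 hg0)
    refine le_of_mul_le_mul_right ?_ h3
    linarith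

end

/-- The half-open cube of center `c` and half-side `r`. -/
def box {d : ℕ} (c : Euc d) (r : ℝ) : Set (Euc d) := Set.pi univ fun i => Ico (c i - r) (c i + r)

section
variable {d : ℕ}

theorem measurableSet_box (c : Euc d) (r : ℝ) : MeasurableSet (box c r) :=
  MeasurableSet.univ_pi fun _ => measurableSet_Ico

theorem norm_sub_le_of_mem_box {c x : Euc d} {r : ℝ} (hr : 0 ≤ r) (hx : x ∈ box c r) :
    ‖x - c‖ ≤ r := by
  rw [pi_norm_le_iff_of_nonneg hr]
  intro i
  have := hx i (mem_univ i)
  rw [Pi.sub_apply, Real.norm_eq_abs, abs_le]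
  constructor <;> linarith [this.1, this.2]

theorem mem_box_of_norm_sub_lt {c x : Euc d} {r : ℝ} (hx : ‖x - c‖ < r) : x ∈ box c r := by
  intro i _
  have := (norm_le_pi_norm (x - c) i).trans_lt hx
  rw [Pi.sub_apply, Real.norm_eq_abs, abs_lt] at this
  constructor <;> linarith [this.1, this.2]

theorem volume_box (c : Euc d) {r : ℝ} (hr : 0 ≤ r) :
    volume (box c r) = ENNReal.ofReal ((2 * r) ^ d) := by
  rw [box, Real.volume_pi_Ico, ENNReal.ofReal_pow (by positivity)]
  simp [← two_mul]

theorem volume_real_box (c : Euc d) {r : ℝ} (hr : 0 ≤ r) :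
    volume.real (box c r) = (2 * r) ^ d := by
  rw [Measure.real, volume_box c hr, ENNReal.toReal_ofReal (by positivity)]

theorem volume_box_ne_top (c : Euc d) {r : ℝ} (hr : 0 ≤ r) : volume (box c r) ≠ ⊤ := by
  rw [volume_box c hr]; exact ENNReal.ofReal_ne_top

/-- The centers of the dyadic children of a cube. -/
def childCenter (c : Euc d) (r : ℝ) (e : Fin d → Bool) : Euc d :=
  fun i => c i + if e i then r / 2 else -(r / 2)

theorem box_child_subset (c : Euc d) {r : ℝ} (hr : 0 < r) (e : Fin d → Bool) :
    box (childCenter c r e) (r / 2) ⊆ box c r := by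
  intro x hx i _
  have := hx i (mem_univ i)
  simp only [childCenter] at this
  split_ifs at this <;> constructor <;> linarith [this.1, this.2]

theorem exists_mem_box_child {c x : Euc d} {r : ℝ} (hx : x ∈ box c r) :
    ∃ e, x ∈ box (childCenter c r e) (r / 2) := by
  refine ⟨fun i => decide (c i ≤ x i), fun i _ => ?_⟩
  have := hx i (mem_univ i)
  simp only [childCenter]
  by_cases h : c i ≤ x i
  · simp only [h, decide_true, if_true]; constructor <;> linarith [this.1, this.2]
  · simp only [h, decide_false]
    push Not at h
    simp only [Bool.false_eq_true, if_false]
    constructor <;> linarith [this.1, this.2]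

theorem disjoint_box_child (c : Euc d) (r : ℝ) {e e' : Fin d → Bool} (h : e ≠ e') :
    Disjoint (box (childCenter c r e) (r / 2)) (box (childCenter c r e') (r / 2)) := by
  rw [Set.disjoint_left]
  intro x hx hx'
  apply h
  ext i
  have h1 := hx i (mem_univ i)
  have h2 := hx' i (mem_univ i)
  simp only [childCenter] at h1 h2
  cases he : e i <;> cases he' : e' i <;> simp [he, he'] at h1 h2 ⊢ <;> linarith [h1.1, h1.2, h2.1, h2.2]

theorem abs_le_of_average_le {f : Euc d → ℝ} {l : ℝ} {c : Euc d} {r : ℝ}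
    (hr : 0 < r) (hfi : IntegrableOn f (box c r))
    (hosc : ∀ x y, ‖x - y‖ ≤ 2 * r → |f x - f y| ≤ l)
    (havg : ∫ y in box c r, |f y| ≤ l * (2 * r) ^ d) {x : Euc d} (hx : x ∈ box c r) :
    |f x| ≤ 2 * l := by
  have hv := volume_real_box c hr.le
  have hfin := volume_box_ne_top c hr.le
  have hc : ∀ a : ℝ, ∫ _ in box c r, a = (2 * r) ^ d * a := by
    intro a; rw [setIntegral_const, hv, smul_eq_mul]
  have hci : ∀ a : ℝ, IntegrableOn (fun _ => a) (box c r) := fun a => integrableOn_const hfin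
  have h1 : ∫ _ in box c r, |f x| ≤ ∫ y in box c r, (|f y| + l) := by
    refine setIntegral_mono_on (hci _) (hfi.abs.add (hci l)) (measurableSet_box c r)
      fun y hy => ?_
    have : ‖x - y‖ ≤ 2 * r := by
      have h1 := norm_sub_le_of_mem_box hr.le hx
      have h2 := norm_sub_le_of_mem_box hr.le hy
      calc ‖x - y‖ = ‖(x - c) - (y - c)‖ := by congr 1; abel
        _ ≤ _ := norm_sub_le _ _
        _ ≤ _ := by linarith
    have := hosc x y this
    have h3 := abs_sub_abs_le_abs_sub (f x) (f y)
    linarith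
  rw [hc, integral_add hfi.abs (hci l), hc] at h1
  have hp : (0 : ℝ) < (2 * r) ^ d := by positivity
  refine le_of_mul_le_mul_left ?_ hp
  linarith

open Classical in
/-- The Calderón–Zygmund stopping time decomposition at height `l`, stopped at the scale where the
oscillation of the function is at most `l`. -/
theorem exists_stopping_boxes {f : Euc d → ℝ} (hfi : Integrable f) {l : ℝ}
    (m : ℕ) : ∀ (c : Euc d) (r : ℝ), 0 < r →
    (∀ x y, ‖x - y‖ ≤ 2 * (r / 2 ^ m) → |f x - f y| ≤ l) →
    ∫ y in box c r, |f y| ≤ l * (2 * r) ^ d →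
    ∃ S : Finset (Euc d × ℝ),
      (∀ q ∈ S, 0 < q.2 ∧ box q.1 q.2 ⊆ box c r ∧ l * (2 * q.2) ^ d < ∫ y in box q.1 q.2, |f y| ∧
        ∫ y in box q.1 q.2, |f y| ≤ 2 ^ d * l * (2 * q.2) ^ d) ∧
      (S : Set (Euc d × ℝ)).PairwiseDisjoint (fun q => box q.1 q.2) ∧
      ∀ x ∈ box c r, (∀ q ∈ S, x ∉ box q.1 q.2) → |f x| ≤ 2 * l := by
  induction m with
  | zero =>
    intro c r hr hosc havg
    refine ⟨∅, by simp, by simp, fun x hx _ => ?_⟩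
    exact abs_le_of_average_le hr hfi.integrableOn (by simpa using hosc) havg hx
  | succ m ih =>
    intro c r hr hosc havg
    have hchild : ∀ e : Fin d → Bool, ∃ S : Finset (Euc d × ℝ),
      (∀ q ∈ S, 0 < q.2 ∧ box q.1 q.2 ⊆ box (childCenter c r e) (r / 2) ∧
        l * (2 * q.2) ^ d < ∫ y in box q.1 q.2, |f y| ∧
        ∫ y in box q.1 q.2, |f y| ≤ 2 ^ d * l * (2 * q.2) ^ d) ∧
      (S : Set (Euc d × ℝ)).PairwiseDisjoint (fun q => box q.1 q.2) ∧
      ∀ x ∈ box (childCenter c r e) (r / 2), (∀ q ∈ S, x ∉ box q.1 q.2) → |f x| ≤ 2 * l := by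
      intro e
      rcases le_or_gt (∫ y in box (childCenter c r e) (r / 2), |f y|) (l * (2 * (r / 2)) ^ d)
        with h | h
      · refine ih _ _ (by positivity) (fun x y hxy => hosc x y (hxy.trans_eq ?_)) h
        rw [pow_succ]; field_simp
      · refine ⟨{(childCenter c r e, r / 2)}, ?_, by simp, ?_⟩
        · intro q hq
          obtain rfl := Finset.mem_singleton.1 hq
          refine ⟨by positivity, subset_rfl, h, ?_⟩
          calc ∫ y in box (childCenter c r e) (r / 2), |f y| ≤ ∫ y in box c r, |f y| :=
                setIntegral_mono_set hfi.abs.integrableOn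
                  (Eventually.of_forall fun y => abs_nonneg _)
                  (box_child_subset c hr e).eventuallyLE
            _ ≤ _ := havg
            _ = _ := by rw [mul_pow, mul_pow, div_pow]; field_simp
        · intro x hx hq
          exact absurd hx (hq _ (Finset.mem_singleton_self _))
    choose S hS1 hS2 hS3 using hchild
    refine ⟨Finset.univ.biUnion S, ?_, ?_, ?_⟩
    · intro q hq
      obtain ⟨e, -, hq⟩ := Finset.mem_biUnion.1 hq
      obtain ⟨h1, h2, h3⟩ := hS1 e q hq
      exact ⟨h1, h2.trans (box_child_subset c hr e), h3⟩
    · intro q hq q' hq' hne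
      obtain ⟨e, -, hq⟩ := Finset.mem_biUnion.1 hq
      obtain ⟨e', -, hq'⟩ := Finset.mem_biUnion.1 hq'
      rcases eq_or_ne e e' with rfl | he
      · exact hS2 e hq hq' hne
      · exact (disjoint_box_child c r he).mono (hS1 e q hq).2.1 (hS1 e' q' hq').2.1
    · intro x hx hq
      obtain ⟨e, he⟩ := exists_mem_box_child hx
      exact hS3 e x he fun q hqS => hq q (Finset.mem_biUnion.2 ⟨e, Finset.mem_univ _, hqS⟩)

/-- The Calderón–Zygmund decomposition of a continuous compactly supported function. -/
theorem exists_cz_boxes (hd : 1 ≤ d) {f : Euc d → ℝ} (hf : Continuous f)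
    (hfc : HasCompactSupport f) {l : ℝ} (hl : 0 < l) :
    ∃ S : Finset (Euc d × ℝ),
      (∀ q ∈ S, 0 < q.2 ∧ l * (2 * q.2) ^ d < ∫ y in box q.1 q.2, |f y| ∧
        ∫ y in box q.1 q.2, |f y| ≤ 2 ^ d * l * (2 * q.2) ^ d) ∧
      (S : Set (Euc d × ℝ)).PairwiseDisjoint (fun q => box q.1 q.2) ∧
      ∀ x, (∀ q ∈ S, x ∉ box q.1 q.2) → |f x| ≤ 2 * l := by
  have hfi : Integrable f := hf.integrable_of_hasCompactSupport hfc
  obtain ⟨ρ, hρ0, hρ⟩ := exists_support_radius hfc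
  have huc := hfc.uniformContinuous_of_continuous hf
  obtain ⟨δ, hδ, hδf⟩ := Metric.uniformContinuous_iff.1 huc l hl
  set I := ∫ y, |f y| with hI
  have hI0 : 0 ≤ I := integral_nonneg fun y => abs_nonneg _
  set r := max (ρ + 1) (I / l + 1) with hr
  have hr1 : 1 ≤ r := (by linarith : (1 : ℝ) ≤ ρ + 1).trans (le_max_left _ _)
  have hr0 : 0 < r := by linarith
  obtain ⟨m, hm⟩ : ∃ m : ℕ, 2 * (r / 2 ^ m) < δ := by
    obtain ⟨m, hm⟩ := pow_unbounded_of_one_lt (2 * r / δ) (one_lt_two (α := ℝ))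
    refine ⟨m, ?_⟩
    rw [div_lt_iff₀ hδ] at hm
    rw [← mul_div_assoc, div_lt_iff₀ (by positivity)]
    linarith
  obtain ⟨S, h1, h2, h3⟩ := exists_stopping_boxes hfi (l := l) m 0 r hr0
    (fun x y hxy => by
      have := hδf (a := x) (b := y) (by rw [dist_eq_norm]; linarith)
      rw [Real.dist_eq] at this
      exact this.le)
    (by
      calc ∫ y in box 0 r, |f y| ≤ I :=
            setIntegral_le_integral hfi.abs (Eventually.of_forall fun y => abs_nonneg _)
        _ = l * (I / l) := by field_simp
        _ ≤ l * (2 * r) ^ d := by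
            gcongr
            calc I / l ≤ r := by linarith [le_max_right (ρ + 1) (I / l + 1)]
              _ ≤ 2 * r := by linarith
              _ ≤ (2 * r) ^ d := le_self_pow₀ (by linarith) (by omega))
  refine ⟨S, fun q hq => ⟨(h1 q hq).1, (h1 q hq).2.2⟩, h2, fun x hx => ?_⟩
  rcases lt_or_ge ‖x‖ r with hxr | hxr
  · exact h3 x (mem_box_of_norm_sub_lt (by simpa using hxr)) hx
  · rw [hρ x (by linarith [le_max_left (ρ + 1) (I / l + 1)])]
    simp [hl.le]

end

theorem measure_ge_le_ofReal_integral_div {X : Type*} [MeasurableSpace X] {μ : Measure X}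
    {f : X → ℝ} (hf : Integrable f μ) (hf0 : ∀ x, 0 ≤ f x) {l : ℝ} (hl : 0 < l) :
    μ {x | l ≤ f x} ≤ ENNReal.ofReal ((∫ x, f x ∂μ) / l) := by
  have h := mul_meas_ge_le_integral_of_nonneg (Eventually.of_forall hf0) hf l
  have hfin := (hf.measure_ge_lt_top hl).ne
  rw [← ENNReal.ofReal_toReal hfin]
  refine ENNReal.ofReal_le_ofReal ?_
  rw [le_div_iff₀ hl, mul_comm]
  exact h

section
variable {d : ℕ} {A : ℝ} {K : Euc d → ℝ}

/-- The mean of `f` over a cube. -/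
def boxMean (f : Euc d → ℝ) (q : Euc d × ℝ) : ℝ := (∫ y in box q.1 q.2, f y) / (2 * q.2) ^ d

/-- The part of the Calderón–Zygmund decomposition living on a cube. -/
def badPart (f : Euc d → ℝ) (q : Euc d × ℝ) : Euc d → ℝ :=
  (box q.1 q.2).indicator fun y => f y - boxMean f q

theorem integrable_badPart {f : Euc d → ℝ} (hf : Integrable f) {q : Euc d × ℝ} (hq : 0 < q.2) :
    Integrable (badPart f q) :=
  (hf.integrableOn.sub (integrableOn_const (volume_box_ne_top q.1 hq.le))).integrable_indicator
    (measurableSet_box _ _)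

theorem integral_badPart {f : Euc d → ℝ} (hf : Integrable f) {q : Euc d × ℝ} (hq : 0 < q.2) :
    ∫ y, badPart f q y = 0 := by
  rw [badPart, integral_indicator (measurableSet_box _ _),
    integral_sub hf.integrableOn (integrableOn_const (volume_box_ne_top q.1 hq.le)),
    setIntegral_const, volume_real_box _ hq.le, boxMean, smul_eq_mul]
  have : (0 : ℝ) < (2 * q.2) ^ d := by positivity
  field_simp
  simp

theorem abs_boxMean_mul_le (f : Euc d → ℝ) {q : Euc d × ℝ} (hq : 0 < q.2) :
    |boxMean f q| * (2 * q.2) ^ d ≤ ∫ y in box q.1 q.2, |f y| := by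
  have : (0 : ℝ) < (2 * q.2) ^ d := by positivity
  rw [boxMean, abs_div, abs_of_pos this, div_mul_cancel₀ _ this.ne']
  exact abs_integral_le_integral_abs

theorem integral_abs_badPart_le {f : Euc d → ℝ} (hf : Integrable f) {q : Euc d × ℝ}
    (hq : 0 < q.2) : ∫ y, |badPart f q y| ≤ 2 * ∫ y in box q.1 q.2, |f y| := by
  have hci : IntegrableOn (fun _ => |boxMean f q|) (box q.1 q.2) :=
    integrableOn_const (volume_box_ne_top q.1 hq.le)
  have e : ∀ y, |badPart f q y| = (box q.1 q.2).indicator (fun y => |f y - boxMean f q|) y := by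
    intro y
    by_cases h : y ∈ box q.1 q.2 <;> simp [badPart, h]
  simp_rw [e]
  rw [integral_indicator (measurableSet_box _ _)]
  calc _ ≤ ∫ y in box q.1 q.2, (|f y| + |boxMean f q|) := by
        refine setIntegral_mono_on ?_ (hf.abs.integrableOn.add hci) (measurableSet_box _ _)
          fun y _ => abs_sub _ _
        exact (hf.integrableOn.sub (integrableOn_const (volume_box_ne_top q.1 hq.le))).abs
    _ = (∫ y in box q.1 q.2, |f y|) + |boxMean f q| * (2 * q.2) ^ d := by
        rw [integral_add hf.abs.integrableOn hci, setIntegral_const, volume_real_box _ hq.le,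
          smul_eq_mul, mul_comm]
    _ ≤ _ := by linarith [abs_boxMean_mul_le f hq]

theorem IsCZ.abs_czT_badPart_le (hK : IsCZ A K) {f : Euc d → ℝ} (hf : Integrable f)
    {q : Euc d × ℝ} (hq : 0 < q.2) {x : Euc d} (hx : 2 * q.2 ≤ ‖q.1 - x‖) :
    |czT K (badPart f q) x| ≤
      2 ^ (d + 2) * A * q.2 * (∫ y in box q.1 q.2, |f y|) * ‖q.1 - x‖ ^ (-1 - (d : ℝ)) := by
  have hA := hK.nonneg
  have hb := integrable_badPart hf hq
  have e : czT K (badPart f q) x = ∫ y, (K (x - y) - K (x - q.1)) * badPart f q y := by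
    simp_rw [sub_mul]
    rw [integral_sub (hK.integrable_mul hb.locallyIntegrable x) (hb.const_mul _),
      integral_const_mul, integral_badPart hf hq, czT]
    simp
  rw [e, ← Real.norm_eq_abs]
  calc _ ≤ ∫ y, 2 ^ (d + 1) * A * q.2 * ‖q.1 - x‖ ^ (-1 - (d : ℝ)) * |badPart f q y| := by
        refine norm_integral_le_of_norm_le (hb.abs.const_mul _) (Eventually.of_forall fun y => ?_)
        rw [norm_mul, Real.norm_eq_abs, Real.norm_eq_abs]
        by_cases hy : y ∈ box q.1 q.2
        · refine mul_le_mul_of_nonneg_right ?_ (abs_nonneg _)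
          have h1 := norm_sub_le_of_mem_box hq.le hy
          have e1 : x - q.1 - (x - y) = y - q.1 := by abel
          have := hK.sub_le (a := x - q.1) (b := x - y) (by
            rw [e1, norm_sub_rev x]; linarith)
          rw [e1, norm_sub_rev x, abs_sub_comm] at this
          refine this.trans ?_
          gcongr
        · simp [badPart, hy]
    _ = 2 ^ (d + 1) * A * q.2 * ‖q.1 - x‖ ^ (-1 - (d : ℝ)) * ∫ y, |badPart f q y| :=
        integral_const_mul _ _
    _ ≤ 2 ^ (d + 1) * A * q.2 * ‖q.1 - x‖ ^ (-1 - (d : ℝ)) *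
          (2 * ∫ y in box q.1 q.2, |f y|) := by
        gcongr
        exact integral_abs_badPart_le hf hq
    _ = _ := by ring

theorem sum_setIntegral_box_le {f : Euc d → ℝ} (hf : Integrable f) (hfm : Measurable f) {l : ℝ}
    (hl : 0 < l)     {S : Finset (Euc d × ℝ)}
    (hS : ∀ q ∈ S, 0 < q.2 ∧ l * (2 * q.2) ^ d < ∫ y in box q.1 q.2, |f y|)
    (hd : (S : Set (Euc d × ℝ)).PairwiseDisjoint (fun q => box q.1 q.2)) :
    ∑ q ∈ S, ∫ y in box q.1 q.2, |f y| ≤ 2 * ∫ y in {y | l / 2 < |f y|}, |f y| := by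
  have hm : MeasurableSet {y | l / 2 < |f y|} := measurableSet_lt measurable_const hfm.abs
  set F := {y | l / 2 < |f y|}.indicator fun y => |f y| with hF
  have hFi : Integrable F := hf.abs.indicator hm
  have hF0 : ∀ y, 0 ≤ F y := fun y => indicator_nonneg (fun _ _ => abs_nonneg _) _
  have h1 : ∀ q ∈ S, ∫ y in box q.1 q.2, |f y| ≤ 2 * ∫ y in box q.1 q.2, F y := by
    intro q hq
    obtain ⟨hq0, hq1⟩ := hS q hq
    have hci : IntegrableOn (fun _ => l / 2) (box q.1 q.2) :=
      integrableOn_const (volume_box_ne_top q.1 hq0.le)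
    have : ∫ y in box q.1 q.2, |f y| ≤ ∫ y in box q.1 q.2, (F y + l / 2) := by
      refine setIntegral_mono_on hf.abs.integrableOn (hFi.integrableOn.add hci)
        (measurableSet_box _ _) fun y _ => ?_
      by_cases h : l / 2 < |f y|
      · have : F y = |f y| := by simp [hF, h]
        linarith
      · have : F y = 0 := by simp only [hF, indicator, mem_ofPred_eq, h, if_false]
        linarith [not_lt.1 h]
    rw [integral_add hFi.integrableOn hci, setIntegral_const, volume_real_box _ hq0.le,
      smul_eq_mul] at this
    linarith
  calc _ ≤ ∑ q ∈ S, 2 * ∫ y in box q.1 q.2, F y := Finset.sum_le_sum h1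
    _ = 2 * ∫ y in ⋃ q ∈ S, box q.1 q.2, F y := by
        rw [← Finset.mul_sum, integral_biUnion_finset _ (fun q _ => measurableSet_box _ _) hd
          fun q _ => hFi.integrableOn]
    _ ≤ 2 * ∫ y, F y := by
        exact mul_le_mul_of_nonneg_left
          (setIntegral_le_integral hFi (Eventually.of_forall hF0)) zero_le_two
    _ = _ := by rw [hF, integral_indicator hm]

/-- The good part of the Calderón–Zygmund decomposition. -/
def goodPart (f : Euc d → ℝ) (S : Finset (Euc d × ℝ)) (x : Euc d) : ℝ :=
  f x - ∑ q ∈ S, badPart f q x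

theorem goodPart_of_notMem {f : Euc d → ℝ} {S : Finset (Euc d × ℝ)} {x : Euc d}
    (hx : ∀ q ∈ S, x ∉ box q.1 q.2) : goodPart f S x = f x := by
  rw [goodPart, Finset.sum_eq_zero, sub_zero]
  intro q hq
  simp [badPart, hx q hq]

theorem goodPart_of_mem {f : Euc d → ℝ} {S : Finset (Euc d × ℝ)} {x : Euc d}
    (hd : (S : Set (Euc d × ℝ)).PairwiseDisjoint (fun q => box q.1 q.2)) {q : Euc d × ℝ}
    (hq : q ∈ S) (hx : x ∈ box q.1 q.2) : goodPart f S x = boxMean f q := by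
  rw [goodPart, Finset.sum_eq_single q]
  · simp [badPart, hx]
  · intro q' hq' hne
    have : x ∉ box q'.1 q'.2 := fun h =>
      Set.disjoint_left.1 (hd (Finset.mem_coe.2 hq') (Finset.mem_coe.2 hq) hne) h hx
    simp [badPart, this]
  · exact fun h => absurd hq h

theorem goodPart_sq_le {f : Euc d → ℝ} {l : ℝ} {S : Finset (Euc d × ℝ)}
    (hS : ∀ q ∈ S, 0 < q.2 ∧ ∫ y in box q.1 q.2, |f y| ≤ 2 ^ d * l * (2 * q.2) ^ d)
    (hd : (S : Set (Euc d × ℝ)).PairwiseDisjoint (fun q => box q.1 q.2))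
    (hf : ∀ x, (∀ q ∈ S, x ∉ box q.1 q.2) → |f x| ≤ 2 * l) (x : Euc d) :
    goodPart f S x ^ 2 ≤ {y | |f y| ≤ 2 * l}.indicator (fun y => f y ^ 2) x +
      ∑ q ∈ S, (box q.1 q.2).indicator (fun _ => (2 ^ d * l) ^ 2) x := by
  have h1 : 0 ≤ {y | |f y| ≤ 2 * l}.indicator (fun y => f y ^ 2) x :=
    indicator_nonneg (fun _ _ => sq_nonneg _) _
  have h2 : ∀ q ∈ S, 0 ≤ (box q.1 q.2).indicator (fun _ => (2 ^ d * l) ^ 2) x :=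
    fun q _ => indicator_nonneg (fun _ _ => sq_nonneg _) _
  by_cases hx : ∀ q ∈ S, x ∉ box q.1 q.2
  · rw [goodPart_of_notMem hx, indicator_of_mem (show x ∈ {y | |f y| ≤ 2 * l} from hf x hx)]
    linarith [Finset.sum_nonneg h2]
  · push Not at hx
    obtain ⟨q, hq, hxq⟩ := hx
    rw [goodPart_of_mem hd hq hxq]
    have h3 := Finset.single_le_sum h2 hq
    rw [indicator_of_mem hxq] at h3
    obtain ⟨hq0, hq1⟩ := hS q hq
    have hp : (0 : ℝ) < (2 * q.2) ^ d := by positivity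
    have h4 : |boxMean f q| ≤ 2 ^ d * l :=
      le_of_mul_le_mul_right ((abs_boxMean_mul_le f hq0).trans hq1) hp
    have h5 : boxMean f q ^ 2 ≤ (2 ^ d * l) ^ 2 := by
      rw [← sq_abs]; exact pow_le_pow_left₀ (abs_nonneg _) h4 2
    linarith

/-- The constant in the weak type estimate. -/
def weakConst (d : ℕ) (A : ℝ) : ℝ :=
  l2Const d A * (1 + 2 * 4 ^ d) + 2 * 2 ^ d + 2 ^ (d + 2) * |A| * radConst d + 1

theorem weakConst_pos (d : ℕ) (A : ℝ) : 0 < weakConst d A := by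
  have := l2Const_pos d A
  have := radConst_nonneg d
  unfold weakConst; positivity

theorem IsCZ.weak_type (hd : 1 ≤ d) (hK : IsCZ A K) {f : Euc d → ℝ} (hf : Continuous f)
    (hfc : HasCompactSupport f) {l : ℝ} (hl : 0 < l) :
    volume {x | 2 * l < |czT K f x|} ≤ ENNReal.ofReal (weakConst d A *
      ((∫ x in {x | |f x| ≤ 2 * l}, f x ^ 2) / l ^ 2 + (∫ x in {x | l / 2 < |f x|}, |f x|) / l)) := by
  have hA := hK.nonneg
  have hfi : Integrable f := hf.integrable_of_hasCompactSupport hfc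
  have hf2 : Integrable fun x => f x ^ 2 :=
    (hf.memLp_of_hasCompactSupport hfc (p := 2)).integrable_sq
  obtain ⟨S, hS, hSd, hSf⟩ := exists_cz_boxes hd hf hfc hl
  have hS0 : ∀ q ∈ S, 0 < q.2 := fun q hq => (hS q hq).1
  have hm1 : MeasurableSet {x | |f x| ≤ 2 * l} := (isClosed_le hf.abs continuous_const).measurableSet
  set E := ∫ x in {x | |f x| ≤ 2 * l}, f x ^ 2 with hE
  set L := ∫ x in {x | l / 2 < |f x|}, |f x| with hL
  have hE0 : 0 ≤ E := integral_nonneg fun x => sq_nonneg _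
  have hL0 : 0 ≤ L := integral_nonneg fun x => abs_nonneg _
  have hSum : ∑ q ∈ S, ∫ y in box q.1 q.2, |f y| ≤ 2 * L :=
    sum_setIntegral_box_le hfi hf.measurable hl (fun q hq => ⟨(hS q hq).1, (hS q hq).2.1⟩) hSd
  have hSvol : ∑ q ∈ S, l * (2 * q.2) ^ d ≤ 2 * L :=
    (Finset.sum_le_sum fun q hq => (hS q hq).2.1.le).trans hSum
  -- the good part
  have hbi : ∀ q ∈ S, Integrable (badPart f q) := fun q hq => integrable_badPart hfi (hS0 q hq)
  have hgi : Integrable (goodPart f S) := hfi.sub (integrable_finsetSum S hbi)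
  have hcon : ∀ q ∈ S, Integrable ((box q.1 q.2).indicator fun _ : Euc d => (2 ^ d * l) ^ 2) :=
    fun q hq => (integrableOn_const (volume_box_ne_top q.1 (hS0 q hq).le)).integrable_indicator
      (measurableSet_box _ _)
  have hdom : Integrable fun x => {y | |f y| ≤ 2 * l}.indicator (fun y => f y ^ 2) x +
      ∑ q ∈ S, (box q.1 q.2).indicator (fun _ => (2 ^ d * l) ^ 2) x :=
    (hf2.indicator hm1).add (integrable_finsetSum S hcon)
  have hgsq := goodPart_sq_le (fun q hq => ⟨(hS q hq).1, (hS q hq).2.2⟩) hSd hSf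
  have hg2 : Integrable fun x => goodPart f S x ^ 2 :=
    hdom.mono' (hgi.aestronglyMeasurable.pow 2)
      (Eventually.of_forall fun x => by
        rw [Real.norm_eq_abs, abs_of_nonneg (sq_nonneg _)]; exact hgsq x)
  have hgint : ∫ x, goodPart f S x ^ 2 ≤ E + 2 * 4 ^ d * l * L := by
    calc _ ≤ ∫ x, ({y | |f y| ≤ 2 * l}.indicator (fun y => f y ^ 2) x +
          ∑ q ∈ S, (box q.1 q.2).indicator (fun _ => (2 ^ d * l) ^ 2) x) :=
          integral_mono hg2 hdom hgsq
      _ = E + ∑ q ∈ S, (2 * q.2) ^ d * (2 ^ d * l) ^ 2 := by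
          rw [integral_add (hf2.indicator hm1) (integrable_finsetSum S hcon),
            integral_indicator hm1, integral_finsetSum S hcon]
          congr 1
          refine Finset.sum_congr rfl fun q hq => ?_
          rw [integral_indicator (measurableSet_box _ _), setIntegral_const,
            volume_real_box _ (hS0 q hq).le, smul_eq_mul]
      _ = E + 4 ^ d * l * ∑ q ∈ S, l * (2 * q.2) ^ d := by
          rw [Finset.mul_sum]
          congr 1
          refine Finset.sum_congr rfl fun q _ => ?_
          rw [show (4 : ℝ) ^ d = (2 ^ d) ^ 2 by rw [← pow_mul, mul_comm, pow_mul]; norm_num]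
          ring
      _ ≤ E + 4 ^ d * l * (2 * L) := by gcongr
      _ = _ := by ring
  have hgc : HasCompactSupport (goodPart f S) := by
    have hb : Bornology.IsBounded (tsupport f ∪ ⋃ q ∈ S, Metric.closedBall q.1 q.2) := by
      refine hfc.isCompact.isBounded.union ?_
      refine (Bornology.isBounded_biUnion_finset S).2 ?_
      exact fun q _ => Metric.isBounded_closedBall
    obtain ⟨R, hR⟩ := hb.subset_closedBall 0
    refine hasCompactSupport_of_radius (ρ := R) fun z hz => ?_
    have hz' : z ∉ tsupport f ∪ ⋃ q ∈ S, Metric.closedBall q.1 q.2 := fun h => by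
      have := hR h
      rw [mem_closedBall_zero_iff] at this
      linarith
    rw [mem_union, not_or] at hz'
    rw [goodPart_of_notMem, image_eq_zero_of_notMem_tsupport hz'.1]
    intro q hq hzq
    refine hz'.2 (mem_biUnion (Finset.mem_coe.2 hq) ?_)
    rw [Metric.mem_closedBall, dist_eq_norm]
    exact norm_sub_le_of_mem_box (hS0 q hq).le hzq
  have hgL2 : MemLp (goodPart f S) 2 := (memLp_two_iff_integrable_sq hgi.aestronglyMeasurable).2 hg2
  have hTg := integral_czT_sq_le hd hK hgi hgL2 hgc
  have hTgi : Integrable fun x => czT K (goodPart f S) x ^ 2 :=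
    ((hK.contDiff_czT hgi.locallyIntegrable).continuous.memLp_of_hasCompactSupport
      (czT_hasCompactSupport hK.compact hgc) (p := 2)).integrable_sq
  have hgood : volume {x | l ≤ |czT K (goodPart f S) x|} ≤
      ENNReal.ofReal (l2Const d A * (E + 2 * 4 ^ d * l * L) / l ^ 2) := by
    calc _ ≤ volume {x | l ^ 2 ≤ czT K (goodPart f S) x ^ 2} := by
          refine measure_mono fun x hx => ?_
          rw [mem_ofPred_eq, ← sq_abs (czT _ _ _)]
          exact pow_le_pow_left₀ hl.le hx 2
      _ ≤ _ := measure_ge_le_ofReal_integral_div hTgi (fun x => sq_nonneg _) (by positivity)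
      _ ≤ _ := by
          refine ENNReal.ofReal_le_ofReal ?_
          gcongr
          exact hTg.trans (mul_le_mul_of_nonneg_left hgint (l2Const_pos d A).le)
  -- the bad part
  set H : Euc d → ℝ := fun x => ∑ q ∈ S, {x | 2 * q.2 ≤ ‖q.1 - x‖}.indicator (fun x =>
    2 ^ (d + 2) * A * q.2 * (∫ y in box q.1 q.2, |f y|) * ‖q.1 - x‖ ^ (-1 - (d : ℝ))) x with hH
  have hHi : ∀ q ∈ S, Integrable ({x | 2 * q.2 ≤ ‖q.1 - x‖}.indicator (fun x =>
      2 ^ (d + 2) * A * q.2 * (∫ y in box q.1 q.2, |f y|) * ‖q.1 - x‖ ^ (-1 - (d : ℝ)))) := by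
    intro q hq
    have h := integrableOn_norm_rpow_far hd (s := 1) (r := 2 * q.2) one_pos
      (by linarith [hS0 q hq])
    have h' := (integrableOn_comp_sub_left _ _ q.1).2 h
    exact IntegrableOn.integrable_indicator (Integrable.const_mul h' _)
      (measurableSet_le_norm_sub _ _)
  have hH0 : ∀ x, 0 ≤ H x := fun x => Finset.sum_nonneg fun q hq =>
    indicator_nonneg (fun _ _ => by
      have := (hS0 q hq).le
      have : 0 ≤ ∫ y in box q.1 q.2, |f y| := integral_nonneg fun y => abs_nonneg _
      positivity) _
  have hHint : ∫ x, H x ≤ 2 ^ (d + 2) * A * radConst d * L := by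
    rw [hH, integral_finsetSum S hHi]
    calc _ = ∑ q ∈ S, 2 ^ (d + 1) * A * radConst d * ∫ y in box q.1 q.2, |f y| := by
          refine Finset.sum_congr rfl fun q hq => ?_
          have hq0 := hS0 q hq
          rw [integral_indicator (measurableSet_le_norm_sub _ _), integral_const_mul]
          have h := setIntegral_comp_sub_left {z : Euc d | 2 * q.2 ≤ ‖z‖}
            (fun z => ‖z‖ ^ (-1 - (d : ℝ))) q.1
          rw [setIntegral_norm_rpow_far hd one_pos (by linarith)] at h
          simp only [mem_ofPred_eq] at h
          rw [h, Real.rpow_neg_one]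
          field_simp
          ring
      _ ≤ 2 ^ (d + 1) * A * radConst d * (2 * L) := by
          rw [← Finset.mul_sum]
          have := radConst_nonneg d
          gcongr
      _ = _ := by ring
  have hbad : volume {x | l ≤ H x} ≤
      ENNReal.ofReal (2 ^ (d + 2) * A * radConst d * L / l) := by
    refine (measure_ge_le_ofReal_integral_div (integrable_finsetSum S hHi) hH0 hl).trans
      (ENNReal.ofReal_le_ofReal ?_)
    gcongr
  have hstar : volume (⋃ q ∈ S, box q.1 (2 * q.2)) ≤ ENNReal.ofReal (2 * 2 ^ d * L / l) := by
    calc _ ≤ ∑ q ∈ S, volume (box q.1 (2 * q.2)) := measure_biUnion_finset_le _ _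
      _ = ENNReal.ofReal (∑ q ∈ S, (2 * (2 * q.2)) ^ d) := by
          rw [ENNReal.ofReal_sum_of_nonneg]
          · refine Finset.sum_congr rfl fun q hq => volume_box _ (by linarith [hS0 q hq])
          · intro q hq
            have := hS0 q hq
            positivity
      _ ≤ _ := by
          refine ENNReal.ofReal_le_ofReal ?_
          rw [le_div_iff₀ hl]
          calc _ = 2 ^ d * ∑ q ∈ S, l * (2 * q.2) ^ d := by
                rw [Finset.sum_mul, Finset.mul_sum]
                refine Finset.sum_congr rfl fun q _ => ?_
                rw [mul_pow 2 (2 * q.2)]; ring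
            _ ≤ 2 ^ d * (2 * L) := by gcongr
            _ = _ := by ring
  -- conclusion
  have hsub : {x | 2 * l < |czT K f x|} ⊆ {x | l ≤ |czT K (goodPart f S) x|} ∪
      ({x | l ≤ H x} ∪ ⋃ q ∈ S, box q.1 (2 * q.2)) := by
    intro x hx
    by_contra hcon
    simp only [mem_union, not_or, mem_ofPred_eq, not_le, mem_iUnion, not_exists] at hcon
    obtain ⟨h1, h2, h3⟩ := hcon
    have e : czT K f x = czT K (goodPart f S) x + ∑ q ∈ S, czT K (badPart f q) x := by
      unfold czT
      rw [← integral_finsetSum S fun q hq => hK.integrable_mul (hbi q hq).locallyIntegrable x,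
        ← integral_add (hK.integrable_mul hgi.locallyIntegrable x)
          (integrable_finsetSum S fun q hq => hK.integrable_mul (hbi q hq).locallyIntegrable x)]
      congr 1
      ext y
      rw [← Finset.mul_sum, goodPart]
      ring
    have h4 : |∑ q ∈ S, czT K (badPart f q) x| ≤ H x := by
      refine (Finset.abs_sum_le_sum_abs _ _).trans (Finset.sum_le_sum fun q hq => ?_)
      have hfar : 2 * q.2 ≤ ‖q.1 - x‖ := by
        by_contra hlt
        rw [not_le, norm_sub_rev] at hlt
        exact h3 q hq (mem_box_of_norm_sub_lt hlt)
      rw [indicator_of_mem (show x ∈ {x | 2 * q.2 ≤ ‖q.1 - x‖} from hfar)]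
      exact hK.abs_czT_badPart_le hfi (hS0 q hq) hfar
    have h5 := abs_add_le (czT K (goodPart f S) x) (∑ q ∈ S, czT K (badPart f q) x)
    rw [← e] at h5
    have hx' : 2 * l < |czT K f x| := hx
    linarith
  refine (measure_mono hsub).trans ((measure_union_le _ _).trans
    ((add_le_add hgood ((measure_union_le _ _).trans (add_le_add hbad hstar))).trans ?_))
  have hrc := radConst_nonneg d
  have hl2 := l2Const_pos d A
  rw [← ENNReal.ofReal_add (by positivity) (by positivity),
    ← ENNReal.ofReal_add (by positivity) (by positivity)]
  refine ENNReal.ofReal_le_ofReal ?_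
  have e1 : l2Const d A * (E + 2 * 4 ^ d * l * L) / l ^ 2 =
      l2Const d A * (E / l ^ 2) + l2Const d A * (2 * 4 ^ d) * (L / l) := by field_simp
  rw [e1, mul_div_assoc, mul_div_assoc, weakConst, abs_of_nonneg hA]
  have hEl : 0 ≤ E / l ^ 2 := by positivity
  have hLl : 0 ≤ L / l := by positivity
  have p1 : 0 ≤ l2Const d A * (2 * 4 ^ d) * (E / l ^ 2) := by positivity
  have p2 : 0 ≤ (2 * 2 ^ d) * (E / l ^ 2) := by positivity
  have p3 : 0 ≤ (2 ^ (d + 2) * A * radConst d) * (E / l ^ 2) := by positivity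
  have p4 : 0 ≤ l2Const d A * (L / l) := by positivity
  linarith

end

/-- The constant in Marcinkiewicz interpolation. -/
def interpConst (p : ℝ) : ℝ := 2 ^ (2 - p) / (2 - p) + 2 ^ (p - 1) / (p - 1)

theorem lintegral_tail_rpow_le {p a : ℝ} (hp1 : 1 < p) (hp2 : p < 2) (ha : 0 ≤ a) :
    ∫⁻ t in Ioi (0 : ℝ), (ENNReal.ofReal (if a ≤ 2 * t then a ^ 2 * t ^ (p - 3) else 0) +
      ENNReal.ofReal (if t / 2 < a then a * t ^ (p - 2) else 0)) ≤
      ENNReal.ofReal (interpConst p * a ^ p) := by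
  rcases ha.eq_or_lt with rfl | ha
  · rw [setLIntegral_congr_fun (g := fun _ => 0) measurableSet_Ioi]
    · simp
    · intro t ht
      simp
  have hI1 : IntegrableOn (fun t : ℝ => a ^ 2 * t ^ (p - 3)) (Ici (a / 2)) :=
    Integrable.const_mul ((integrableOn_Ici_iff_integrableOn_Ioi (by simp)).2
      (integrableOn_Ioi_rpow_of_lt (by linarith) (by positivity))) _
  have hI2 : IntegrableOn (fun t : ℝ => a * t ^ (p - 2)) (Ioo 0 (2 * a)) := by
    refine Integrable.const_mul ?_ _
    exact (intervalIntegral.integrableOn_Ioo_rpow_iff (by positivity)).2 (by linarith)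
  have e1 : ∀ t ∈ Ioi (0 : ℝ), ENNReal.ofReal (if a ≤ 2 * t then a ^ 2 * t ^ (p - 3) else 0) =
      (Ici (a / 2)).indicator (fun t => ENNReal.ofReal (a ^ 2 * t ^ (p - 3))) t := by
    intro t _
    by_cases h : a ≤ 2 * t
    · rw [if_pos h, indicator_of_mem (show t ∈ Ici (a / 2) from (by linarith : a / 2 ≤ t))]
    · rw [if_neg h, indicator_of_notMem (by simp only [mem_Ici]; intro h'; exact h (by linarith)),
        ENNReal.ofReal_zero]
  have e2 : ∀ t ∈ Ioi (0 : ℝ), ENNReal.ofReal (if t / 2 < a then a * t ^ (p - 2) else 0) =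
      (Ioo 0 (2 * a)).indicator (fun t => ENNReal.ofReal (a * t ^ (p - 2))) t := by
    intro t ht
    by_cases h : t / 2 < a
    · rw [if_pos h, indicator_of_mem (show t ∈ Ioo 0 (2 * a) from ⟨ht, by linarith⟩)]
    · rw [if_neg h, indicator_of_notMem (fun h' => h (by linarith [h'.2])), ENNReal.ofReal_zero]
  have e3 : ∀ t ∈ Ioi (0 : ℝ),
      ENNReal.ofReal (if a ≤ 2 * t then a ^ 2 * t ^ (p - 3) else 0) +
        ENNReal.ofReal (if t / 2 < a then a * t ^ (p - 2) else 0) =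
      (Ici (a / 2)).indicator (fun t => ENNReal.ofReal (a ^ 2 * t ^ (p - 3))) t +
        (Ioo 0 (2 * a)).indicator (fun t => ENNReal.ofReal (a * t ^ (p - 2))) t :=
    fun t ht => by rw [e1 t ht, e2 t ht]
  rw [setLIntegral_congr_fun measurableSet_Ioi e3, lintegral_add_left' (by
      refine AEMeasurable.indicator ?_ measurableSet_Ici
      fun_prop)]
  rw [setLIntegral_indicator measurableSet_Ici, setLIntegral_indicator measurableSet_Ioo,
    inter_eq_left.2 (show Ici (a / 2) ⊆ Ioi 0 from fun t (ht : a / 2 ≤ t) => by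
      simp only [mem_Ioi]; linarith),
    inter_eq_left.2 (show Ioo 0 (2 * a) ⊆ Ioi 0 from fun t ht => ht.1),
    ← ofReal_integral_eq_lintegral_ofReal hI1, ← ofReal_integral_eq_lintegral_ofReal hI2,
    integral_Ici_eq_integral_Ioi, integral_const_mul, integral_const_mul,
    integral_Ioi_rpow_of_lt (by linarith) (by positivity),
    ← integral_Ioc_eq_integral_Ioo, ← intervalIntegral.integral_of_le (by positivity),
    integral_rpow (Or.inl (by linarith)), ← ENNReal.ofReal_add]
  · refine ENNReal.ofReal_le_ofReal (le_of_eq ?_)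
    rw [interpConst, add_mul]
    congr 1
    · rw [Real.div_rpow ha.le (by norm_num), show (2 : ℝ) - p = -(p - 3 + 1) by ring,
        Real.rpow_neg (by norm_num : (0 : ℝ) ≤ 2),
        show a ^ p = a ^ (2 : ℕ) * a ^ (p - 3 + 1) by
          rw [← Real.rpow_natCast, ← Real.rpow_add ha]; congr 1; push_cast; ring]
      have : p - 3 + 1 ≠ 0 := by linarith
      field_simp
    · rw [Real.zero_rpow (by linarith), sub_zero, Real.mul_rpow (by norm_num) ha.le,
        show a ^ p = a * a ^ (p - 1) by
          nth_rewrite 2 [← Real.rpow_one a]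
          rw [← Real.rpow_add ha]; congr 1; ring,
        show p - 2 + 1 = p - 1 by ring]
      ring
  · refine mul_nonneg (by positivity) (div_nonneg_of_nonpos ?_ (by linarith))
    rw [neg_nonpos]; positivity
  · rw [Real.zero_rpow (by linarith), sub_zero]
    exact mul_nonneg ha.le (div_nonneg (by positivity) (by linarith))
  · filter_upwards [ae_restrict_mem measurableSet_Ioo] with t ht
    have := ht.1
    positivity
  · filter_upwards [ae_restrict_mem measurableSet_Ici] with t ht
    have : 0 < t := lt_of_lt_of_le (by positivity) ht
    positivity

section
variable {d : ℕ} {A : ℝ} {K : Euc d → ℝ}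

theorem IsCZ.lintegral_czT_rpow_le (hd : 1 ≤ d) (hK : IsCZ A K) {p : ℝ} (hp1 : 1 < p) (hp2 : p < 2)
    {f : Euc d → ℝ} (hf : Continuous f) (hfc : HasCompactSupport f) :
    ∫⁻ x, ENNReal.ofReal ((|czT K f x| / 2) ^ p) ≤
      ENNReal.ofReal (p * weakConst d A * interpConst p) * ∫⁻ x, ENNReal.ofReal (|f x| ^ p) := by
  have hW := weakConst_pos d A
  have hp0 : 0 < p := by linarith
  have hfi : Integrable f := hf.integrable_of_hasCompactSupport hfc
  have hf2 : Integrable fun x => f x ^ 2 :=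
    (hf.memLp_of_hasCompactSupport hfc (p := 2)).integrable_sq
  have hTc := hK.continuous_czT hf
  set Φ : ℝ → ℝ → ENNReal := fun t a =>
    ENNReal.ofReal (if a ≤ 2 * t then a ^ 2 * t ^ (p - 3) else 0) +
      ENNReal.ofReal (if t / 2 < a then a * t ^ (p - 2) else 0) with hΦ
  have hΦm : Measurable (Function.uncurry fun t x => Φ t |f x|) := by
    have hfm : Measurable fun q : ℝ × Euc d => |f q.2| := (hf.abs.measurable).comp measurable_snd
    refine Measurable.add (Measurable.ennreal_ofReal (Measurable.ite ?_ ?_ measurable_const))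
      (Measurable.ennreal_ofReal (Measurable.ite ?_ ?_ measurable_const))
    · exact measurableSet_le hfm (measurable_fst.const_mul 2)
    · exact (hfm.pow_const 2).mul (measurable_fst.pow_const _)
    · exact measurableSet_lt (measurable_fst.div_const 2) hfm
    · exact hfm.mul (measurable_fst.pow_const _)
  have hpt : ∀ t ∈ Ioi (0 : ℝ), volume {x | t < |czT K f x| / 2} * ENNReal.ofReal (t ^ (p - 1)) ≤
      ENNReal.ofReal (weakConst d A) * ∫⁻ x, Φ t |f x| := by
    intro t ht
    have ht0 : (0 : ℝ) < t := ht
    have hs : {x | t < |czT K f x| / 2} = {x | 2 * t < |czT K f x|} := by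
      ext x; simp only [mem_ofPred_eq, lt_div_iff₀ (zero_lt_two (α := ℝ)), mul_comm]
    have hm1 : MeasurableSet {x | |f x| ≤ 2 * t} :=
      (isClosed_le hf.abs continuous_const).measurableSet
    have hm2 : MeasurableSet {x | t / 2 < |f x|} :=
      (isOpen_lt continuous_const hf.abs).measurableSet
    have q1 : ENNReal.ofReal ((∫ x in {x | |f x| ≤ 2 * t}, f x ^ 2) * t ^ (p - 3)) =
        ∫⁻ x, ENNReal.ofReal (if |f x| ≤ 2 * t then |f x| ^ 2 * t ^ (p - 3) else 0) := by
      rw [← integral_mul_const, ofReal_integral_eq_lintegral_ofReal (hf2.mul_const _).integrableOn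
        (Eventually.of_forall fun x => by positivity), ← lintegral_indicator hm1]
      refine lintegral_congr fun x => ?_
      by_cases h : |f x| ≤ 2 * t <;> simp [h]
    have q2 : ENNReal.ofReal ((∫ x in {x | t / 2 < |f x|}, |f x|) * t ^ (p - 2)) =
        ∫⁻ x, ENNReal.ofReal (if t / 2 < |f x| then |f x| * t ^ (p - 2) else 0) := by
      rw [← integral_mul_const, ofReal_integral_eq_lintegral_ofReal
        (hfi.abs.mul_const _).integrableOn
        (Eventually.of_forall fun x => by positivity), ← lintegral_indicator hm2]
      refine lintegral_congr fun x => ?_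
      by_cases h : t / 2 < |f x| <;> simp [h]
    have hE0 : 0 ≤ ∫ x in {x | |f x| ≤ 2 * t}, f x ^ 2 := integral_nonneg fun x => sq_nonneg _
    have hL0 : 0 ≤ ∫ x in {x | t / 2 < |f x|}, |f x| := integral_nonneg fun x => abs_nonneg _
    rw [hs]
    calc _ ≤ ENNReal.ofReal (weakConst d A * ((∫ x in {x | |f x| ≤ 2 * t}, f x ^ 2) / t ^ 2 +
            (∫ x in {x | t / 2 < |f x|}, |f x|) / t)) * ENNReal.ofReal (t ^ (p - 1)) := by
          gcongr
          exact hK.weak_type hd hf hfc ht0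
      _ = ENNReal.ofReal (weakConst d A) *
            (ENNReal.ofReal ((∫ x in {x | |f x| ≤ 2 * t}, f x ^ 2) * t ^ (p - 3)) +
            ENNReal.ofReal ((∫ x in {x | t / 2 < |f x|}, |f x|) * t ^ (p - 2))) := by
          rw [← ENNReal.ofReal_mul (by positivity), ← ENNReal.ofReal_add (by positivity)
            (by positivity), ← ENNReal.ofReal_mul hW.le]
          congr 1
          rw [show t ^ (p - 1) = t ^ (p - 3) * t ^ 2 by
              rw [← Real.rpow_natCast, ← Real.rpow_add ht0]; congr 1; push_cast; ring,
            show t ^ (p - 2) = t ^ (p - 3) * t by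
              nth_rewrite 3 [← Real.rpow_one t]
              rw [← Real.rpow_add ht0]; congr 1; ring]
          field_simp
      _ = _ := by
          rw [q1, q2, hΦ, lintegral_add_left']
          refine (Measurable.ennreal_ofReal (Measurable.ite hm1 ?_ measurable_const)).aemeasurable
          exact (hf.abs.measurable.pow_const 2).mul_const _
  rw [lintegral_rpow_eq_lintegral_meas_lt_mul volume (Eventually.of_forall fun x => by positivity)
    (hTc.abs.div_const 2).measurable.aemeasurable hp0]
  calc _ ≤ ENNReal.ofReal p * ∫⁻ t in Ioi (0 : ℝ), ENNReal.ofReal (weakConst d A) *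
          ∫⁻ x, Φ t |f x| := by
        gcongr ENNReal.ofReal p * ?_
        exact setLIntegral_mono' measurableSet_Ioi hpt
    _ = ENNReal.ofReal p * (ENNReal.ofReal (weakConst d A) *
          ∫⁻ x, ∫⁻ t in Ioi (0 : ℝ), Φ t |f x|) := by
        rw [lintegral_const_mul' _ _ ENNReal.ofReal_ne_top,
          lintegral_lintegral_swap hΦm.aemeasurable]
    _ ≤ ENNReal.ofReal p * (ENNReal.ofReal (weakConst d A) *
          ∫⁻ x, ENNReal.ofReal (interpConst p * |f x| ^ p)) := by
        gcongr with x
        exact lintegral_tail_rpow_le hp1 hp2 (abs_nonneg _)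
    _ = _ := by
        have hi : 0 ≤ interpConst p :=
          add_nonneg (div_nonneg (by positivity) (by linarith))
            (div_nonneg (by positivity) (by linarith))
        simp_rw [ENNReal.ofReal_mul hi]
        rw [lintegral_const_mul' _ _ ENNReal.ofReal_ne_top, ENNReal.ofReal_mul (by positivity),
          ENNReal.ofReal_mul hp0.le]
        ring

end

section
variable {d : ℕ} {A : ℝ} {K : Euc d → ℝ}

theorem integrable_abs_rpow {f : Euc d → ℝ} (hf : Continuous f) (hfc : HasCompactSupport f) {p : ℝ}
    (hp : 0 < p) : Integrable fun x => |f x| ^ p := by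
  refine (hf.abs.rpow_const fun x => Or.inr hp.le).integrable_of_hasCompactSupport ?_
  exact hfc.comp_left (g := fun t : ℝ => |t| ^ p) (by simp [hp.ne'])

theorem exists_integral_czT_rpow_le_of_lt_two (hd : 1 ≤ d) (A : ℝ) {p : ℝ} (hp1 : 1 < p)
    (hp2 : p < 2) : ∃ C : ℝ, 0 ≤ C ∧ ∀ K : Euc d → ℝ, IsCZ A K → ∀ f : Euc d → ℝ, Continuous f →
      HasCompactSupport f → ∫ x, |czT K f x| ^ p ≤ C * ∫ x, |f x| ^ p := by
  have hW := weakConst_pos d A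
  have hi : 0 ≤ interpConst p :=
    add_nonneg (div_nonneg (by positivity) (by linarith)) (div_nonneg (by positivity) (by linarith))
  have hp0 : 0 < p := by linarith
  refine ⟨2 ^ p * (p * weakConst d A * interpConst p), by positivity, fun K hK f hf hfc => ?_⟩
  have h := hK.lintegral_czT_rpow_le hd hp1 hp2 hf hfc
  have i1 := integrable_abs_rpow hf hfc hp0
  have i2 := integrable_abs_rpow (hK.continuous_czT hf) (czT_hasCompactSupport hK.compact hfc) hp0
  have e : ∀ x, (|czT K f x| / 2) ^ p = |czT K f x| ^ p / 2 ^ p := fun x =>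
    Real.div_rpow (abs_nonneg _) (by norm_num) _
  simp_rw [e] at h
  rw [← ofReal_integral_eq_lintegral_ofReal (i2.div_const _)
    (Eventually.of_forall fun x => by positivity), ← ofReal_integral_eq_lintegral_ofReal i1
    (Eventually.of_forall fun x => by positivity), ← ENNReal.ofReal_mul (by positivity),
    ENNReal.ofReal_le_ofReal_iff (by positivity), integral_div, div_le_iff₀ (by positivity)] at h
  linarith

theorem exists_integral_czT_rpow_le_of_two_lt (hd : 1 ≤ d) (A : ℝ) {p : ℝ} (hp2 : 2 < p) :
    ∃ C : ℝ, 0 ≤ C ∧ ∀ K : Euc d → ℝ, IsCZ A K → ∀ f : Euc d → ℝ, Continuous f →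
      HasCompactSupport f → ∫ x, |czT K f x| ^ p ≤ C * ∫ x, |f x| ^ p := by
  have hp0 : 0 < p := by linarith
  have hpq : p.HolderConjugate (p / (p - 1)) := Real.HolderConjugate.conjExponent (by linarith)
  set q := p / (p - 1) with hq
  have hq1 : 1 < q := hpq.symm.lt
  have hq0 : 0 < q := by linarith
  have hq2 : q < 2 := by rw [hq, div_lt_iff₀ (by linarith)]; linarith
  obtain ⟨C, hC0, hC⟩ := exists_integral_czT_rpow_le_of_lt_two hd A hq1 hq2
  refine ⟨(C ^ (1 / q)) ^ p, by positivity, fun K hK f hf hfc => ?_⟩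
  have hu := hK.continuous_czT hf
  have huc := czT_hasCompactSupport hK.compact hfc
  set u := czT K f with hudef
  set g : Euc d → ℝ := fun x => |u x| ^ (p - 2) * u x with hg
  have hgc : Continuous g := (hu.abs.rpow_const fun x => Or.inr (by linarith)).mul hu
  have hgs : HasCompactSupport g := huc.mul_left
  have hug : ∀ x, u x * g x = |u x| ^ p := by
    intro x
    rw [hg, show u x * (|u x| ^ (p - 2) * u x) = |u x| ^ (p - 2) * |u x| ^ 2 by
      rw [sq_abs]; ring, ← Real.rpow_natCast]
    rw [← Real.rpow_add' (abs_nonneg _) (by push_cast; linarith)]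
    congr 1; push_cast; ring
  have hgq : ∀ x, |g x| ^ q = |u x| ^ p := by
    intro x
    have : |g x| = |u x| ^ (p - 1) := by
      rw [hg, abs_mul, abs_of_nonneg (by positivity : 0 ≤ |u x| ^ (p - 2))]
      nth_rewrite 2 [← Real.rpow_one |u x|]
      rw [← Real.rpow_add' (abs_nonneg _) (by linarith)]
      congr 1; ring
    rw [this, ← Real.rpow_mul (abs_nonneg _), hq]
    congr 1
    have : p - 1 ≠ 0 := by linarith
    field_simp
  have hT := hC _ hK.comp_neg g hgc hgs
  have hTg := hK.comp_neg.continuous_czT hgc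
  have hTgs := czT_hasCompactSupport hK.comp_neg.compact hgs
  set v := czT (fun z => K (-z)) g with hv
  set X := ∫ x, |u x| ^ p with hX
  set F := ∫ x, |f x| ^ p with hF
  have hX0 : 0 ≤ X := integral_nonneg fun x => by positivity
  have hF0 : 0 ≤ F := integral_nonneg fun x => by positivity
  simp_rw [hgq] at hT
  have h1 : X = ∫ y, f y * v y := by
    rw [hX, ← integral_czT_mul hK (hf.integrable_of_hasCompactSupport hfc)
      (hgc.integrable_of_hasCompactSupport hgs)]
    exact integral_congr_ae (Eventually.of_forall fun x => (hug x).symm)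
  have h2 : X ≤ F ^ (1 / p) * (C ^ (1 / q) * X ^ (1 / q)) := by
    calc X = ∫ y, f y * v y := h1
      _ ≤ ∫ y, ‖f y‖ * ‖v y‖ := by
          refine integral_mono ((hf.mul hTg).integrable_of_hasCompactSupport hfc.mul_right)
            ((hf.norm.mul hTg.norm).integrable_of_hasCompactSupport hfc.norm.mul_right) fun y => ?_
          simp only
          rw [← norm_mul]
          exact le_abs_self _
      _ ≤ (∫ y, ‖f y‖ ^ p) ^ (1 / p) * (∫ y, ‖v y‖ ^ q) ^ (1 / q) :=
          integral_mul_norm_le_Lp_mul_Lq hpq (hf.memLp_of_hasCompactSupport hfc)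
            (hTg.memLp_of_hasCompactSupport hTgs)
      _ ≤ F ^ (1 / p) * (C * X) ^ (1 / q) := by
          simp only [Real.norm_eq_abs]
          gcongr
      _ = _ := by rw [Real.mul_rpow hC0 hX0]
  rcases hX0.eq_or_lt with h3 | h3
  · rw [← h3]; positivity
  · have e : X = X ^ (1 / p) * X ^ (1 / q) := by
      rw [← Real.rpow_add h3, one_div, one_div, hpq.inv_add_inv_eq_one, Real.rpow_one]
    have h4 : X ^ (1 / p) ≤ C ^ (1 / q) * F ^ (1 / p) := by
      refine le_of_mul_le_mul_right ?_ (Real.rpow_pos_of_pos h3 (1 / q))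
      rw [← e]; linarith
    have h5 := Real.rpow_le_rpow (by positivity) h4 hp0.le
    rwa [Real.mul_rpow (by positivity) (by positivity), ← Real.rpow_mul hX0, ← Real.rpow_mul hF0,
      one_div_mul_cancel hp0.ne', Real.rpow_one, Real.rpow_one] at h5

/-- Calderón–Zygmund operators are bounded on `L^p` for `1 < p < ∞`. -/
theorem exists_integral_czT_rpow_le (hd : 1 ≤ d) (A : ℝ) {p : ℝ} (hp : 1 < p) :
    ∃ C : ℝ, 0 ≤ C ∧ ∀ K : Euc d → ℝ, IsCZ A K → ∀ f : Euc d → ℝ, Continuous f →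
      HasCompactSupport f → ∫ x, |czT K f x| ^ p ≤ C * ∫ x, |f x| ^ p := by
  rcases lt_trichotomy p 2 with h | rfl | h
  · exact exists_integral_czT_rpow_le_of_lt_two hd A hp h
  · refine ⟨l2Const d A, (l2Const_pos d A).le, fun K hK f hf hfc => ?_⟩
    simp only [Real.rpow_two, sq_abs]
    exact integral_czT_sq_le hd hK (hf.integrable_of_hasCompactSupport hfc)
      (hf.memLp_of_hasCompactSupport hfc) hfc
  · exact exists_integral_czT_rpow_le_of_two_lt hd A h

/-- A continuous cutoff equal to `1` on the ball of radius `R`. -/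
def cutoff (R : ℝ) (x : Euc d) : ℝ := max 0 (min 1 (R + 1 - ‖x‖))

theorem continuous_cutoff (R : ℝ) : Continuous (cutoff R : Euc d → ℝ) := by
  unfold cutoff; fun_prop

theorem cutoff_eq_one {R : ℝ} {x : Euc d} (hx : ‖x‖ ≤ R) : cutoff R x = 1 := by
  rw [cutoff, min_eq_left (by linarith), max_eq_right zero_le_one]

theorem cutoff_eq_zero {R : ℝ} {x : Euc d} (hx : R + 1 < ‖x‖) : cutoff R x = 0 := by
  rw [cutoff, max_eq_left]
  exact (min_le_right _ _).trans (by linarith)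

theorem abs_cutoff_le (R : ℝ) (x : Euc d) : |cutoff R x| ≤ 1 := by
  rw [cutoff, abs_of_nonneg (le_max_left _ _)]
  exact max_le zero_le_one (min_le_left _ _)

theorem exists_eLpNorm_czT_le (hd : 1 ≤ d) (A : ℝ) {p : ℝ} (hp : 1 < p) :
    ∃ C : ℝ, 0 < C ∧ ∀ K : Euc d → ℝ, IsCZ A K → ∀ f : Euc d → ℝ, Continuous f →
      eLpNorm (czT K f) (ENNReal.ofReal p) volume ≤
        ENNReal.ofReal C * eLpNorm f (ENNReal.ofReal p) volume := by
  obtain ⟨C, hC0, hC⟩ := exists_integral_czT_rpow_le hd A hp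
  have hp0 : 0 < p := by linarith
  have hp0' : ENNReal.ofReal p ≠ 0 := by simpa using hp0
  refine ⟨C ^ p⁻¹ + 1, by positivity, fun K hK f hf => ?_⟩
  have hcs : ∀ n : ℕ, HasCompactSupport fun x => cutoff n x * f x := fun n =>
    hasCompactSupport_of_radius (ρ := n + 1) fun z hz => by simp [cutoff_eq_zero hz]
  have hcont : ∀ n : ℕ, Continuous fun x => cutoff n x * f x := fun n =>
    (continuous_cutoff _).mul hf
  have hbound : ∀ n : ℕ, eLpNorm (czT K fun x => cutoff n x * f x) (ENNReal.ofReal p) volume ≤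
      ENNReal.ofReal (C ^ p⁻¹ + 1) * eLpNorm f (ENNReal.ofReal p) volume := by
    intro n
    have h := hC K hK _ (hcont n) (hcs n)
    have hT := (hK.continuous_czT (hcont n)).memLp_of_hasCompactSupport
      (czT_hasCompactSupport hK.compact (hcs n)) (μ := volume) (p := ENNReal.ofReal p)
    have hf' := (hcont n).memLp_of_hasCompactSupport (hcs n) (μ := volume) (p := ENNReal.ofReal p)
    calc _ ≤ ENNReal.ofReal (C ^ p⁻¹) *
          eLpNorm (fun x => cutoff n x * f x) (ENNReal.ofReal p) volume := by
          rw [hT.eLpNorm_eq_integral_rpow_norm hp0' ENNReal.ofReal_ne_top,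
            hf'.eLpNorm_eq_integral_rpow_norm hp0' ENNReal.ofReal_ne_top,
            ← ENNReal.ofReal_mul (by positivity), ENNReal.toReal_ofReal hp0.le,
            ← Real.mul_rpow hC0 (integral_nonneg fun x => by positivity)]
          refine ENNReal.ofReal_le_ofReal (Real.rpow_le_rpow
            (integral_nonneg fun x => by positivity) h (by positivity))
      _ ≤ _ := by
          gcongr
          · linarith
          · refine eLpNorm_mono fun x => ?_
            rw [norm_mul]
            exact mul_le_of_le_one_left (norm_nonneg _) (abs_cutoff_le _ _)
  refine (Lp.eLpNorm_lim_le_liminf_eLpNorm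
    (fun n => (hK.continuous_czT (hcont n)).aestronglyMeasurable) _
    (Eventually.of_forall fun x => ?_)).trans
    (liminf_le_of_frequently_le' (Frequently.of_forall hbound))
  obtain ⟨R, -, hR⟩ := exists_support_radius hK.compact
  obtain ⟨N, hN⟩ := exists_nat_ge (‖x‖ + R)
  refine tendsto_const_nhds.congr' ?_
  filter_upwards [eventually_ge_atTop N] with n hn
  refine integral_congr_ae (Eventually.of_forall fun y => ?_)
  rcases le_or_gt ‖x - y‖ R with h | h
  · have h1 : ‖y‖ ≤ n := by
      have h2 := norm_sub_norm_le y x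
      rw [norm_sub_rev] at h2
      have : (N : ℝ) ≤ n := by exact_mod_cast hn
      linarith
    simp [cutoff_eq_one h1]
  · simp [hR _ h]

end

section
variable {d : ℕ}

/-- Young's convolution inequality `L^1 * L^p ⊆ L^p`, in terms of lower Lebesgue integrals. -/
theorem lintegral_rpow_lintegral_sub_le {p : ℝ} (hp : 1 < p) {W F : Euc d → ENNReal}
    (hW : Measurable W) (hF : Measurable F) :
    ∫⁻ x, (∫⁻ y, W (x - y) * F y) ^ p ≤ (∫⁻ z, W z) ^ p * ∫⁻ y, F y ^ p := by
  have hpq := Real.HolderConjugate.conjExponent hp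
  set q := p.conjExponent
  have hp0 : 0 < p := hpq.pos
  have hq0 : 0 < q := hpq.symm.pos
  set I := ∫⁻ z, W z with hI
  have htr : ∀ x : Euc d, ∫⁻ y, W (x - y) = I := fun x => lintegral_sub_left_eq_self W x
  have htr' : ∀ y : Euc d, ∫⁻ x, W (x - y) = I := fun y => lintegral_sub_right_eq_self W y
  have hWx : ∀ x : Euc d, Measurable fun y => W (x - y) := fun x =>
    hW.comp (measurable_const.sub measurable_id)
  have hpt : ∀ x, (∫⁻ y, W (x - y) * F y) ^ p ≤ I ^ (p / q) * ∫⁻ y, W (x - y) * F y ^ p := by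
    intro x
    have h1 := ENNReal.lintegral_mul_le_Lp_mul_Lq (volume : Measure (Euc d)) hpq
      (f := fun y => W (x - y) ^ (1 / p) * F y) (g := fun y => W (x - y) ^ (1 / q))
      (((hWx x).pow_const _).mul hF).aemeasurable ((hWx x).pow_const _).aemeasurable
    have e1 : ∀ y, ((fun y => W (x - y) ^ (1 / p) * F y) * fun y => W (x - y) ^ (1 / q)) y =
        W (x - y) * F y := fun y => by
      simp only [Pi.mul_apply]
      rw [mul_right_comm, ← ENNReal.rpow_add_of_nonneg _ _ (by positivity) (by positivity),
        one_div, one_div, hpq.inv_add_inv_eq_one, ENNReal.rpow_one]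
    have e2 : ∀ y, (W (x - y) ^ (1 / p) * F y) ^ p = W (x - y) * F y ^ p := fun y => by
      rw [ENNReal.mul_rpow_of_nonneg _ _ hp0.le, ← ENNReal.rpow_mul, one_div_mul_cancel hp0.ne',
        ENNReal.rpow_one]
    have e3 : ∀ y, (W (x - y) ^ (1 / q)) ^ q = W (x - y) := fun y => by
      rw [← ENNReal.rpow_mul, one_div_mul_cancel hq0.ne', ENNReal.rpow_one]
    simp_rw [e1, e2, e3, htr] at h1
    calc _ ≤ ((∫⁻ y, W (x - y) * F y ^ p) ^ (1 / p) * I ^ (1 / q)) ^ p :=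
          ENNReal.rpow_le_rpow h1 hp0.le
      _ = _ := by
          rw [ENNReal.mul_rpow_of_nonneg _ _ hp0.le, ← ENNReal.rpow_mul, ← ENNReal.rpow_mul,
            one_div_mul_cancel hp0.ne', ENNReal.rpow_one, mul_comm, one_div_mul_eq_div]
  have hm : Measurable (Function.uncurry fun x y : Euc d => W (x - y) * F y ^ p) :=
    (hW.comp (measurable_fst.sub measurable_snd)).mul ((hF.comp measurable_snd).pow_const _)
  calc _ ≤ ∫⁻ x, I ^ (p / q) * ∫⁻ y, W (x - y) * F y ^ p := lintegral_mono hpt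
    _ = I ^ (p / q) * ∫⁻ x, ∫⁻ y, W (x - y) * F y ^ p :=
        lintegral_const_mul _ hm.lintegral_prod_right
    _ = I ^ (p / q) * ∫⁻ y, ∫⁻ x, W (x - y) * F y ^ p := by
        rw [lintegral_lintegral_swap hm.aemeasurable]
    _ = I ^ (p / q) * (I * ∫⁻ y, F y ^ p) := by
        congr 1
        rw [← lintegral_const_mul _ (hF.pow_const _)]
        refine lintegral_congr fun y => ?_
        have hm' : Measurable fun x => W (x - y) := hW.comp (measurable_id.sub measurable_const)
        rw [lintegral_mul_const _ hm', htr']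
    _ = _ := by
        rw [← mul_assoc]
        congr 1
        nth_rw 2 [← ENNReal.rpow_one I]
        rw [← ENNReal.rpow_add_of_nonneg _ _ (by positivity) zero_le_one]
        congr 1
        have := hpq.sub_one_mul_conj
        field_simp
        linarith

theorem eLpNorm_le_of_enorm_le_lintegral {p : ℝ} (hp : 1 < p) {w u f : Euc d → ℝ}
    (hwm : Measurable w) (hwi : Integrable w) (hw0 : ∀ z, 0 ≤ w z)
    (hf : Continuous f)
    (hu : ∀ x, ‖u x‖ₑ ≤ ∫⁻ y, ‖w (x - y)‖ₑ * ‖f y‖ₑ) :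
    eLpNorm u (ENNReal.ofReal p) volume ≤
      ENNReal.ofReal (∫ z, w z) * eLpNorm f (ENNReal.ofReal p) volume := by
  have hp0 : 0 < p := by linarith
  rw [eLpNorm_eq_lintegral_rpow_enorm_toReal (by simpa using hp0) ENNReal.ofReal_ne_top,
    eLpNorm_eq_lintegral_rpow_enorm_toReal (by simpa using hp0) ENNReal.ofReal_ne_top,
    ENNReal.toReal_ofReal hp0.le]
  have h1 := lintegral_rpow_lintegral_sub_le hp (hwm.enorm) (hf.measurable.enorm)
  have h2 : ∫⁻ z, ‖w z‖ₑ = ENNReal.ofReal (∫ z, w z) := by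
    rw [ofReal_integral_eq_lintegral_ofReal hwi (Eventually.of_forall hw0)]
    exact lintegral_congr fun z => Real.enorm_of_nonneg (hw0 z)
  rw [h2] at h1
  calc _ ≤ (ENNReal.ofReal (∫ z, w z) ^ p * ∫⁻ y, ‖f y‖ₑ ^ p) ^ (1 / p) := by
        refine ENNReal.rpow_le_rpow (le_trans (lintegral_mono fun x => ?_) h1) (by positivity)
        exact ENNReal.rpow_le_rpow (hu x) hp0.le
    _ = _ := by
        rw [ENNReal.mul_rpow_of_nonneg _ _ (by positivity), ← ENNReal.rpow_mul,
          mul_one_div_cancel hp0.ne', ENNReal.rpow_one]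

/-- A Hölder continuous function in `L^p` is bounded. -/
theorem abs_le_of_holder_of_eLpNorm {α p H L : ℝ} (hα0 : 0 < α) (hp : 1 ≤ p) (hH : 0 ≤ H)
    (hL : 0 ≤ L) {u : Euc d → ℝ} (huc : Continuous u)
    (hu : ∀ x y, ‖u x - u y‖ ≤ H * ‖x - y‖ ^ α)
    (huL : eLpNorm u (ENNReal.ofReal p) volume ≤ ENNReal.ofReal L) (x : Euc d) :
    ‖u x‖ ≤ H + L := by
  set μ := (volume : Measure (Euc d)).restrict (Metric.closedBall x (1 / 2)) with hμ
  have hμ1 : μ univ = 1 := by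
    rw [hμ, Measure.restrict_apply_univ, Real.volume_pi_closedBall _ (by norm_num)]
    norm_num
  have hprob : IsProbabilityMeasure μ := ⟨hμ1⟩
  have hp1 : (1 : ENNReal) ≤ ENNReal.ofReal p := by simpa using hp
  have hp0 : ENNReal.ofReal p ≠ 0 := by positivity
  have hc : ∀ c : ℝ, eLpNorm (fun _ : Euc d => c) (ENNReal.ofReal p) μ = ENNReal.ofReal |c| :=
    fun c => by
      rw [eLpNorm_const _ hp0 hprob.ne_zero, hμ1, ENNReal.one_rpow, mul_one, ← ofReal_norm,
        Real.norm_eq_abs]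
  have h1 : ENNReal.ofReal |u x| ≤ ENNReal.ofReal (H + L) := by
    calc ENNReal.ofReal |u x| = eLpNorm (fun _ : Euc d => u x) (ENNReal.ofReal p) μ := (hc _).symm
      _ ≤ eLpNorm (fun y => H + ‖u y‖) (ENNReal.ofReal p) μ := by
          refine eLpNorm_mono_ae ?_
          filter_upwards [ae_restrict_mem measurableSet_closedBall] with y hy
          rw [Metric.mem_closedBall, dist_comm, dist_eq_norm] at hy
          have h2 : ‖x - y‖ ^ α ≤ 1 :=
            Real.rpow_le_one (norm_nonneg _) (by linarith) hα0.le
          have h3 := hu x y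
          have h4 := norm_sub_norm_le (u x) (u y)
          have h5 : H * ‖x - y‖ ^ α ≤ H := mul_le_of_le_one_right hH h2
          rw [Real.norm_of_nonneg (r := H + ‖u y‖) (by positivity)]
          linarith
      _ ≤ eLpNorm (fun _ : Euc d => H) (ENNReal.ofReal p) μ +
          eLpNorm (fun y => ‖u y‖) (ENNReal.ofReal p) μ :=
          eLpNorm_add_le aestronglyMeasurable_const huc.norm.aestronglyMeasurable hp1
      _ ≤ ENNReal.ofReal H + ENNReal.ofReal L := by
          rw [hc, abs_of_nonneg hH, eLpNorm_norm]
          gcongr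
          exact (eLpNorm_restrict_le _ _ _ _).trans huL
      _ = _ := (ENNReal.ofReal_add hH hL).symm
  exact (ENNReal.ofReal_le_ofReal_iff (by positivity)).1 h1

theorem InCa.nonneg {F : Type*} [NormedAddCommGroup F] {α M : ℝ} {f : Euc d → F}
    (h : InCa α M f) : 0 ≤ M := (norm_nonneg _).trans (h.1 0)

theorem InCa.mono {F : Type*} [NormedAddCommGroup F] {α M M' : ℝ} {f : Euc d → F}
    (h : InCa α M f) (hM : M ≤ M') : InCa α M' f :=
  ⟨fun x => (h.1 x).trans hM, fun x y => (h.2 x y).trans (by gcongr)⟩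

theorem continuous_of_holder {F : Type*} [NormedAddCommGroup F] {α M : ℝ} (hα0 : 0 < α)
    {f : Euc d → F} (h : ∀ x y, ‖f x - f y‖ ≤ M * ‖x - y‖ ^ α) : Continuous f := by
  refine continuous_iff_continuousAt.2 fun x => ?_
  rw [ContinuousAt, tendsto_iff_norm_sub_tendsto_zero]
  have h1 : Tendsto (fun y : Euc d => M * ‖y - x‖ ^ α) (𝓝 x) (𝓝 0) := by
    have : Continuous fun y : Euc d => M * ‖y - x‖ ^ α :=
      continuous_const.mul ((continuous_id.sub continuous_const).norm.rpow_const
        fun _ => Or.inr hα0.le)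
    simpa [hα0.ne'] using this.tendsto x
  exact squeeze_zero (fun _ => norm_nonneg _) (fun y => h y x) h1

theorem InCa.continuous {F : Type*} [NormedAddCommGroup F] {α M : ℝ} (hα0 : 0 < α)
    {f : Euc d → F} (h : InCa α M f) : Continuous f := continuous_of_holder hα0 h.2

theorem InCap.nonneg {α p M : ℝ} {f : Euc d → ℝ} (h : InCap α p M f) : 0 ≤ M := h.1.nonneg

theorem InCap.mono {α p M M' : ℝ} {f : Euc d → ℝ} (h : InCap α p M f) (hM : M ≤ M') :
    InCap α p M' f :=
  ⟨h.1.mono hM, h.2.trans (ENNReal.ofReal_le_ofReal hM)⟩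

theorem InCap.continuous {α p M : ℝ} (hα0 : 0 < α) {f : Euc d → ℝ} (h : InCap α p M f) :
    Continuous f := h.1.continuous hα0

theorem InCap.memLp {α p M : ℝ} (hα0 : 0 < α) {f : Euc d → ℝ} (h : InCap α p M f) :
    MemLp f (ENNReal.ofReal p) volume :=
  ⟨(h.continuous hα0).aestronglyMeasurable, h.2.trans_lt ENNReal.ofReal_lt_top⟩

theorem inCap_of_holder {α p H L : ℝ} (hα0 : 0 < α) (hp : 1 ≤ p) (hH : 0 ≤ H) (hL : 0 ≤ L)
    {u : Euc d → ℝ} (hu : ∀ x y, ‖u x - u y‖ ≤ H * ‖x - y‖ ^ α)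
    (huL : eLpNorm u (ENNReal.ofReal p) volume ≤ ENNReal.ofReal L) : InCap α p (H + L) u :=
  ⟨⟨abs_le_of_holder_of_eLpNorm hα0 hp hH hL (continuous_of_holder hα0 hu) hu huL,
    fun x y => (hu x y).trans (by gcongr; linarith)⟩,
    huL.trans (ENNReal.ofReal_le_ofReal (by linarith))⟩

theorem InCap.add {α p M M' : ℝ} (hα0 : 0 < α) (hp : 1 ≤ p) {f g : Euc d → ℝ}
    (hf : InCap α p M f) (hg : InCap α p M' g) : InCap α p (M + M') (fun x => f x + g x) := by
  refine ⟨⟨fun x => (norm_add_le _ _).trans (add_le_add (hf.1.1 x) (hg.1.1 x)), fun x y => ?_⟩, ?_⟩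
  · rw [add_sub_add_comm, add_mul]
    exact (norm_add_le _ _).trans (add_le_add (hf.1.2 x y) (hg.1.2 x y))
  · rw [ENNReal.ofReal_add hf.nonneg hg.nonneg]
    exact (eLpNorm_add_le (hf.continuous hα0).aestronglyMeasurable
      (hg.continuous hα0).aestronglyMeasurable (by simpa using hp)).trans (add_le_add hf.2 hg.2)

theorem InCap.const_mul {α p M : ℝ} {f : Euc d → ℝ} (hf : InCap α p M f) (c : ℝ) :
    InCap α p (|c| * M) (fun x => c * f x) := by
  refine ⟨⟨fun x => ?_, fun x y => ?_⟩, ?_⟩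
  · rw [norm_mul, Real.norm_eq_abs c]
    gcongr
    exact hf.1.1 x
  · rw [← mul_sub, norm_mul, Real.norm_eq_abs c, mul_assoc]
    gcongr
    exact hf.1.2 x y
  · have : (fun x => c * f x) = c • f := rfl
    rw [this, eLpNorm_const_smul, ENNReal.ofReal_mul (abs_nonneg c), ← Real.norm_eq_abs, ofReal_norm]
    gcongr
    exact hf.2

theorem InCap.sum {α p : ℝ} (hα0 : 0 < α) (hp : 1 ≤ p) {ι : Type*} (s : Finset ι)
    {M : ι → ℝ} {f : ι → Euc d → ℝ} (h : ∀ i ∈ s, InCap α p (M i) (f i)) :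
    InCap α p (∑ i ∈ s, M i) (fun x => ∑ i ∈ s, f i x) := by
  classical
  induction s using Finset.induction_on with
  | empty => exact ⟨⟨by simp, by simp⟩, by simp⟩
  | insert a s ha ih =>
    simp only [Finset.sum_insert ha]
    exact (h a (by simp)).add hα0 hp (ih fun i hi => h i (by simp [hi]))

theorem InCap.mul {α p M M' : ℝ} {f g : Euc d → ℝ} (hg : InCa α M' g) (hf : InCap α p M f) :
    InCap α p (2 * M' * M) (fun x => g x * f x) := by
  have h0 := hg.nonneg
  have h0' := hf.nonneg
  refine ⟨⟨fun x => ?_, fun x y => ?_⟩, ?_⟩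
  · rw [norm_mul]
    calc _ ≤ M' * M := by gcongr; exacts [hg.1 x, hf.1.1 x]
      _ ≤ _ := by nlinarith [mul_nonneg h0 h0']
  · have e : g x * f x - g y * f y = g x * (f x - f y) + (g x - g y) * f y := by ring
    rw [e]
    calc _ ≤ ‖g x‖ * ‖f x - f y‖ + ‖g x - g y‖ * ‖f y‖ := by
          rw [← norm_mul, ← norm_mul]; exact norm_add_le _ _
      _ ≤ M' * (M * ‖x - y‖ ^ α) + M' * ‖x - y‖ ^ α * M := by
          gcongr
          exacts [hg.1 x, hf.1.2 x y, hg.2 x y, hf.1.1 y]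
      _ = _ := by ring
  · calc _ ≤ ENNReal.ofReal M' * eLpNorm f (ENNReal.ofReal p) volume :=
          eLpNorm_le_mul_eLpNorm_of_ae_le_mul
            (Eventually.of_forall fun x => by
              rw [norm_mul]; gcongr; exact hg.1 x) _
      _ ≤ ENNReal.ofReal M' * ENNReal.ofReal M := by gcongr; exact hf.2
      _ ≤ _ := by
          rw [← ENNReal.ofReal_mul h0]
          exact ENNReal.ofReal_le_ofReal (by nlinarith [mul_nonneg h0 h0'])

theorem exists_inCap_czT (hd : 1 ≤ d) (A : ℝ) {α p : ℝ} (hα0 : 0 < α) (hα1 : α < 1) (hp : 1 < p) :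
    ∃ C : ℝ, 0 < C ∧ ∀ K : Euc d → ℝ, IsCZ A K → ∀ (f : Euc d → ℝ) (M : ℝ), InCap α p M f →
      InCap α p (C * M) (czT K f) := by
  obtain ⟨C, hC0, hC⟩ := exists_eLpNorm_czT_le hd A hp
  have hh := holderConst_nonneg d hα0 hα1
  refine ⟨(holderConst d α * 2 ^ (d + 1) + 1) * |A| + C, by positivity, fun K hK f M hf => ?_⟩
  have hM := hf.nonneg
  rw [add_mul]
  refine inCap_of_holder hα0 hp.le (by positivity) (by positivity) (fun x y => ?_) ?_
  · rw [abs_of_nonneg hK.nonneg]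
    exact czT_holder hd hα0 hα1 hK (hf.continuous hα0) ⟨M, hf.1.1⟩ hf.1.2 x y
  · refine (hC K hK f (hf.continuous hα0)).trans ?_
    rw [ENNReal.ofReal_mul hC0.le]
    gcongr
    exact hf.2

end

section
variable {d : ℕ} {A : ℝ} {K : Euc d → ℝ}

/-- A smooth cutoff, equal to `1` for `‖z‖ ≤ ρ` and to `0` for `2 * ρ ≤ ‖z‖`. -/
def smoothCut (ρ : ℝ) (z : Euc d) : ℝ :=
  (⟨1, 2, one_pos, one_lt_two⟩ : ContDiffBump (0 : Euc d)) (ρ⁻¹ • z)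

theorem contDiff_smoothCut (ρ : ℝ) {n : ℕ∞} : ContDiff ℝ n (smoothCut ρ : Euc d → ℝ) :=
  (ContDiffBump.contDiff _).comp (contDiff_const_smul _)

theorem smoothCut_nonneg (ρ : ℝ) (z : Euc d) : 0 ≤ smoothCut ρ z := ContDiffBump.nonneg _

theorem smoothCut_le_one (ρ : ℝ) (z : Euc d) : smoothCut ρ z ≤ 1 := ContDiffBump.le_one _

theorem abs_smoothCut_le_one (ρ : ℝ) (z : Euc d) : |smoothCut ρ z| ≤ 1 := by
  rw [abs_of_nonneg (smoothCut_nonneg ρ z)]; exact smoothCut_le_one ρ z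

theorem smoothCut_eq_one {ρ : ℝ} (hρ : 0 < ρ) {z : Euc d} (hz : ‖z‖ ≤ ρ) : smoothCut ρ z = 1 := by
  refine ContDiffBump.one_of_mem_closedBall _ ?_
  rw [mem_closedBall_zero_iff, norm_smul, norm_inv, Real.norm_of_nonneg hρ.le]
  simp only
  rw [inv_mul_le_iff₀ hρ]
  linarith

theorem smoothCut_eq_zero {ρ : ℝ} (hρ : 0 < ρ) {z : Euc d} (hz : 2 * ρ ≤ ‖z‖) :
    smoothCut ρ z = 0 := by
  refine ContDiffBump.zero_of_le_dist _ ?_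
  rw [dist_zero_right, norm_smul, norm_inv, Real.norm_of_nonneg hρ.le]
  simp only
  rw [le_inv_mul_iff₀ hρ]
  linarith

theorem fderiv_smoothCut_eq_zero {ρ : ℝ} (hρ : 0 < ρ) {z : Euc d} (hz : ‖z‖ < ρ ∨ 2 * ρ < ‖z‖) :
    fderiv ℝ (smoothCut ρ : Euc d → ℝ) z = 0 := by
  rcases hz with hz | hz
  · have : smoothCut ρ =ᶠ[𝓝 z] fun _ => (1 : ℝ) := by
      filter_upwards [(isOpen_lt continuous_norm continuous_const).mem_nhds hz] with w hw
      exact smoothCut_eq_one hρ (le_of_lt hw)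
    rw [this.fderiv_eq]; simp
  · have : smoothCut ρ =ᶠ[𝓝 z] fun _ => (0 : ℝ) := by
      filter_upwards [(isOpen_lt continuous_const continuous_norm).mem_nhds hz] with w hw
      exact smoothCut_eq_zero hρ (le_of_lt hw)
    rw [this.fderiv_eq]; simp

/-- Functions with the derivative bounds of a homogeneous function of degree `0`. -/
structure IsSymbol (B : ℝ) (χ : Euc d → ℝ) : Prop where
  contDiff : ContDiff ℝ 2 χ
  size : ∀ z, |χ z| ≤ B
  grad : ∀ z, z ≠ 0 → ‖fderiv ℝ χ z‖ ≤ B * ‖z‖ ^ (-1 : ℝ)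
  hess : ∀ z, z ≠ 0 → ‖fderiv ℝ (fderiv ℝ χ) z‖ ≤ B * ‖z‖ ^ (-2 : ℝ)

theorem exists_le_mul_rpow_of_hasCompactSupport {F : Type*} [NormedAddCommGroup F]
    {G : Euc d → F} (hG : Continuous G) (hGs : ∀ z, 2 < ‖z‖ → G z = 0) {s : ℝ} (hs : 0 ≤ s) :
    ∃ B, 0 ≤ B ∧ ∀ z, z ≠ 0 → ‖G z‖ ≤ B * ‖z‖ ^ (-s) := by
  obtain ⟨C, hC⟩ := (isCompact_closedBall (0 : Euc d) 2).exists_bound_of_continuousOn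
    hG.continuousOn
  have hC0 : 0 ≤ C := (norm_nonneg _).trans (hC 0 (by simp))
  refine ⟨C * 2 ^ s, by positivity, fun z hz => ?_⟩
  have hz' : 0 < ‖z‖ := norm_pos_iff.2 hz
  rcases le_or_gt ‖z‖ 2 with h | h
  · refine (hC z (by simpa using h)).trans ?_
    rw [mul_assoc, Real.rpow_neg hz'.le]
    refine le_mul_of_one_le_right hC0 ?_
    rw [← div_eq_mul_inv, one_le_div (by positivity)]
    exact Real.rpow_le_rpow hz'.le h hs
  · rw [hGs z h, norm_zero]; positivity

theorem norm_fderiv_smul_comp_smul {E F : Type*} [NormedAddCommGroup E] [NormedSpace ℝ E]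
    [NormedAddCommGroup F] [NormedSpace ℝ F] {G : E → F} (hG : Differentiable ℝ G) (c : ℝ) (z : E) :
    ‖fderiv ℝ (fun z => c • G (c • z)) z‖ = |c| * (|c| * ‖fderiv ℝ G (c • z)‖) := by
  have hdiff : DifferentiableAt ℝ (fun z => G (c • z)) z :=
    (hG.comp (differentiable_id.const_smul c)) z
  rw [fderiv_fun_const_smul hdiff, fderiv_comp_smul, norm_smul, norm_smul, Real.norm_eq_abs]

theorem exists_isSymbol_smoothCut (d : ℕ) :
    ∃ B : ℝ, 1 ≤ B ∧ ∀ ρ : ℝ, 0 < ρ → IsSymbol B (smoothCut ρ : Euc d → ℝ) := by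
  set θ : Euc d → ℝ := smoothCut 1 with hθ
  have hc2 : ContDiff ℝ 2 θ := contDiff_smoothCut (n := 2) 1
  have hc1 : ContDiff ℝ 1 (fderiv ℝ θ) := hc2.fderiv_right (by norm_num)
  have hz1 : ∀ z : Euc d, 2 < ‖z‖ → fderiv ℝ θ z = 0 := fun z hz =>
    fderiv_smoothCut_eq_zero one_pos (Or.inr (by linarith))
  have hz2 : ∀ z : Euc d, 2 < ‖z‖ → fderiv ℝ (fderiv ℝ θ) z = 0 := fun z hz => by
    have : fderiv ℝ θ =ᶠ[𝓝 z] fun _ => 0 := by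
      filter_upwards [(isOpen_lt continuous_const continuous_norm).mem_nhds hz] with w hw
      exact hz1 w hw
    rw [this.fderiv_eq]; simp
  obtain ⟨B1, hB10, hB1⟩ := exists_le_mul_rpow_of_hasCompactSupport hc1.continuous hz1
    (s := 1) zero_le_one
  obtain ⟨B2, hB20, hB2⟩ := exists_le_mul_rpow_of_hasCompactSupport
    (hc1.continuous_fderiv one_ne_zero) hz2 (s := 2) zero_le_two
  have hsc : ∀ ρ : ℝ, (smoothCut ρ : Euc d → ℝ) = fun z => θ (ρ⁻¹ • z) := fun ρ => by
    ext z; simp [hθ, smoothCut]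
  have hscale : ∀ (ρ : ℝ), 0 < ρ → ∀ (z : Euc d) (s : ℝ),
      ‖ρ⁻¹ • z‖ ^ (-s) = ρ ^ s * ‖z‖ ^ (-s) := by
    intro ρ hρ z s
    rw [norm_smul, norm_inv, Real.norm_of_nonneg hρ.le,
      Real.mul_rpow (by positivity) (norm_nonneg _), Real.rpow_neg (by positivity), Real.inv_rpow hρ.le,
      inv_inv]
  have hne : ∀ (ρ : ℝ), 0 < ρ → ∀ z : Euc d, z ≠ 0 → ρ⁻¹ • z ≠ 0 := fun ρ hρ z hz =>
    smul_ne_zero (by positivity) hz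
  refine ⟨1 + B1 + B2, by linarith, fun ρ hρ => ⟨contDiff_smoothCut (n := 2) ρ, fun z =>
    (abs_smoothCut_le_one ρ z).trans (by linarith), fun z hz => ?_, fun z hz => ?_⟩⟩
  · rw [hsc, fderiv_comp_smul, norm_smul, norm_inv, Real.norm_of_nonneg hρ.le]
    calc _ ≤ ρ⁻¹ * (B1 * ‖ρ⁻¹ • z‖ ^ (-1 : ℝ)) := by
          gcongr; exact hB1 _ (hne ρ hρ z hz)
      _ = B1 * ‖z‖ ^ (-1 : ℝ) := by rw [hscale ρ hρ, Real.rpow_one]; field_simp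
      _ ≤ _ := by gcongr; linarith
  · have e : fderiv ℝ (smoothCut ρ : Euc d → ℝ) = fun z => ρ⁻¹ • fderiv ℝ θ (ρ⁻¹ • z) := by
      ext1 z; rw [hsc, fderiv_comp_smul]
    rw [e, norm_fderiv_smul_comp_smul (hc1.differentiable one_ne_zero), abs_of_pos (inv_pos.2 hρ)]
    calc _ ≤ ρ⁻¹ * (ρ⁻¹ * (B2 * ‖ρ⁻¹ • z‖ ^ (-2 : ℝ))) := by
          gcongr; exact hB2 _ (hne ρ hρ z hz)
      _ = B2 * ‖z‖ ^ (-2 : ℝ) := by rw [hscale ρ hρ, Real.rpow_two]; field_simp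
      _ ≤ _ := by gcongr; linarith

theorem zero_rpow_neg_dim (hd : 1 ≤ d) : (0 : ℝ) ^ (-(d : ℝ)) = 0 :=
  Real.zero_rpow (by simp; omega)

theorem zero_rpow_neg_one_sub_dim (d : ℕ) : (0 : ℝ) ^ (-1 - (d : ℝ)) = 0 :=
  Real.zero_rpow (by have : (0 : ℝ) ≤ d := d.cast_nonneg; linarith)

theorem IsCZ.apply_zero (hd : 1 ≤ d) (hK : IsCZ A K) : K 0 = 0 := by
  have := hK.size 0
  rwa [norm_zero, zero_rpow_neg_dim hd, mul_zero, abs_nonpos_iff] at this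

theorem IsCZ.fderiv_zero (hK : IsCZ A K) : fderiv ℝ K 0 = 0 := by
  have := hK.grad 0
  rwa [norm_zero, zero_rpow_neg_one_sub_dim, mul_zero, norm_le_zero_iff] at this

theorem rpow_neg_dim_mul {z : Euc d} (hz : z ≠ 0) (s : ℝ) :
    ‖z‖ ^ (-(d : ℝ)) * ‖z‖ ^ s = ‖z‖ ^ (s - (d : ℝ)) := by
  rw [← Real.rpow_add (norm_pos_iff.2 hz)]; congr 1; ring

theorem IsCZ.smoothCut_mul (hd : 1 ≤ d) (hK : IsCZ A K) {B ρ : ℝ} (hρ : 0 < ρ) (hB : 1 ≤ B)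
    (hχ : IsSymbol B (smoothCut ρ : Euc d → ℝ)) :
    IsCZ ((1 + B + 2 * radConst d) * A) (fun z => smoothCut ρ z * K z) := by
  have hA := hK.nonneg
  have hrc := radConst_nonneg d
  have hχd : Differentiable ℝ (smoothCut ρ : Euc d → ℝ) := hχ.contDiff.differentiable two_ne_zero
  have hKd : Differentiable ℝ K := hK.contDiff.differentiable one_ne_zero
  have hsz : ∀ z, |smoothCut ρ z * K z| ≤ A * ‖z‖ ^ (-(d : ℝ)) := fun z => by
    rw [abs_mul]
    exact (mul_le_of_le_one_left (abs_nonneg _) (abs_smoothCut_le_one _ _)).trans (hK.size z)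
  refine ⟨(hχ.contDiff.of_le one_le_two).mul hK.contDiff, hK.compact.mul_left, fun z => ?_,
    fun z => ?_, fun r hr => ?_⟩
  · refine (hsz z).trans ?_
    gcongr
    nlinarith
  · rw [fderiv_fun_mul (hχd z) (hKd z)]
    rcases eq_or_ne z 0 with rfl | hz
    · rw [hK.apply_zero hd, hK.fderiv_zero, norm_zero, zero_rpow_neg_one_sub_dim]; simp
    · calc _ ≤ ‖smoothCut ρ z • fderiv ℝ K z‖ + ‖K z • fderiv ℝ (smoothCut ρ) z‖ := norm_add_le _ _
        _ ≤ 1 * (A * ‖z‖ ^ (-1 - (d : ℝ))) + A * ‖z‖ ^ (-(d : ℝ)) * (B * ‖z‖ ^ (-1 : ℝ)) := by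
            rw [norm_smul, norm_smul]
            gcongr
            exacts [abs_smoothCut_le_one _ _, hK.grad z, hK.size z, hχ.grad z hz]
        _ = (1 + B) * A * ‖z‖ ^ (-1 - (d : ℝ)) := by
            rw [← rpow_neg_dim_mul hz]; ring
        _ ≤ _ := mul_le_mul_of_nonneg_right
            (mul_le_mul_of_nonneg_right (by linarith) hA) (by positivity)
  · have hm : ∀ r : ℝ, MeasurableSet {z : Euc d | ‖z‖ < r} := fun r =>
      measurableSet_lt measurable_norm measurable_const
    have hmS : MeasurableSet {z : Euc d | ρ ≤ ‖z‖ ∧ ‖z‖ ≤ 2 * ρ} :=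
      (measurableSet_le measurable_const measurable_norm).inter
        (measurableSet_le measurable_norm measurable_const)
    have hInt : Integrable fun z => smoothCut ρ z * K z :=
      (hχ.contDiff.continuous.mul hK.contDiff.continuous).integrable_of_hasCompactSupport
        hK.compact.mul_left
    have e : ∀ z, smoothCut ρ z * K z = {z | ‖z‖ < ρ}.indicator K z +
        {z | ρ ≤ ‖z‖ ∧ ‖z‖ ≤ 2 * ρ}.indicator (fun z => smoothCut ρ z * K z) z := by
      intro z
      rcases lt_or_ge ‖z‖ ρ with h | h
      · rw [indicator_of_mem (show z ∈ {z | ‖z‖ < ρ} from h),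
          indicator_of_notMem (by simp [h]), smoothCut_eq_one hρ h.le]; ring
      · rw [indicator_of_notMem (by simpa using h)]
        rcases le_or_gt ‖z‖ (2 * ρ) with h' | h'
        · rw [indicator_of_mem (show z ∈ {z | ρ ≤ ‖z‖ ∧ ‖z‖ ≤ 2 * ρ} from ⟨h, h'⟩), zero_add]
        · rw [indicator_of_notMem (by simp [h']), smoothCut_eq_zero hρ h'.le]; ring
    rw [show (fun z => smoothCut ρ z * K z) = _ from funext e]
    rw [integral_add (hK.integrable.indicator (hm _)).integrableOn
      (hInt.indicator hmS).integrableOn, setIntegral_indicator (hm _), setIntegral_indicator hmS]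
    have h1 : |∫ z in {z : Euc d | ‖z‖ < r} ∩ {z | ‖z‖ < ρ}, K z| ≤ A := by
      have : {z : Euc d | ‖z‖ < r} ∩ {z | ‖z‖ < ρ} = {z | ‖z‖ < min r ρ} := by ext; simp
      rw [this]
      exact hK.canc _ (lt_min hr hρ)
    have h2 := norm_setIntegral_annulus_le hd hρ (b := 2 * ρ) (by positivity) hA (0 : Euc d)
      ((hm r).inter hmS) (fun y hy => by simpa using hy.2.1) (fun y hy => by simpa using hy.2.2)
      (g := fun z => smoothCut ρ z * K z) (fun y _ => by
        rw [zero_sub, norm_neg]; exact hsz y)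
    rw [mul_div_assoc, div_self hρ.ne', Real.norm_eq_abs] at h2
    refine (abs_add_le _ _).trans ((add_le_add h1 h2).trans ?_)
    nlinarith [mul_nonneg hrc hA, mul_nonneg (by linarith : 0 ≤ B) hA]

/-- Calderón–Zygmund kernels with control on second derivatives. -/
structure IsCZTwo (A : ℝ) (K : Euc d → ℝ) : Prop extends IsCZ A K where
  contDiff_two : ContDiff ℝ 2 K
  hess : ∀ z, ‖fderiv ℝ (fderiv ℝ K) z‖ ≤ A * ‖z‖ ^ (-2 - (d : ℝ))

/-- The kernel `z_j ∂_v K(z)`. -/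
def coordGrad (K : Euc d → ℝ) (v : Euc d) (j : Fin d) (z : Euc d) : ℝ := z j * fderiv ℝ K z v

theorem abs_coord_le (z : Euc d) (j : Fin d) : |z j| ≤ ‖z‖ := norm_le_pi_norm z j

theorem IsCZ.abs_coordGrad_le (hK : IsCZ A K) {v : Euc d} (hv : ‖v‖ ≤ 1) (j : Fin d) (z : Euc d) :
    |coordGrad K v j z| ≤ A * ‖z‖ ^ (-(d : ℝ)) := by
  have hA := hK.nonneg
  rcases eq_or_ne z 0 with rfl | hz
  · simp only [coordGrad, Pi.zero_apply, zero_mul, abs_zero]; positivity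
  · rw [coordGrad, abs_mul]
    calc _ ≤ ‖z‖ * (A * ‖z‖ ^ (-1 - (d : ℝ)) * 1) := by
          gcongr
          · exact abs_coord_le z j
          · exact ((fderiv ℝ K z).le_opNorm v).trans (by gcongr; exact hK.grad z)
      _ = A * (‖z‖ ^ (1 : ℝ) * ‖z‖ ^ (-1 - (d : ℝ))) := by rw [Real.rpow_one]; ring
      _ = _ := by rw [← Real.rpow_add (norm_pos_iff.2 hz)]; congr 2; ring

theorem IsCZTwo.coordGrad (hd : 1 ≤ d) (hK : IsCZTwo A K) {B : ℝ} (hB : 1 ≤ B)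
    (hχ : ∀ ρ : ℝ, 0 < ρ → IsSymbol B (smoothCut ρ : Euc d → ℝ)) {v : Euc d} (hv : ‖v‖ ≤ 1)
    (j : Fin d) :
    IsCZ ((2 + B + 2 * radConst d * (2 + B)) * A) (coordGrad K v j) := by
  have hA := hK.nonneg
  have hrc := radConst_nonneg d
  have hDK : ContDiff ℝ 1 (fderiv ℝ K) := hK.contDiff_two.fderiv_right (by norm_num)
  have hDKv : ContDiff ℝ 1 fun z => fderiv ℝ K z v := hDK.clm_apply contDiff_const
  have hpj : ContDiff ℝ 2 fun z : Euc d => z j := contDiff_apply ℝ ℝ j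
  have hsupp : HasCompactSupport fun z => fderiv ℝ K z v :=
    hK.compact.fderiv (𝕜 := ℝ) |>.comp_left (g := fun L : Euc d →L[ℝ] ℝ => L v) (by simp)
  have hsz := hK.toIsCZ.abs_coordGrad_le hv j
  have hfpj : ∀ z : Euc d, fderiv ℝ (fun z : Euc d => z j) z = ContinuousLinearMap.proj j :=
    fun z => (ContinuousLinearMap.proj (R := ℝ) (φ := fun _ : Fin d => ℝ) j).hasFDerivAt.fderiv
  have hcd : ContDiff ℝ 1 (_root_.coordGrad K v j) := (hpj.of_le one_le_two).mul hDKv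
  have hcs : HasCompactSupport (_root_.coordGrad K v j) := hsupp.mul_left
  have hInt : Integrable (_root_.coordGrad K v j) :=
    hcd.continuous.integrable_of_hasCompactSupport hcs
  refine ⟨hcd, hcs, fun z => (hsz z).trans ?_, fun z => ?_, fun r hr => ?_⟩
  · gcongr
    nlinarith [mul_nonneg hrc (by linarith : 0 ≤ 2 + B)]
  · unfold _root_.coordGrad
    rw [fderiv_fun_mul (hpj.differentiable two_ne_zero z) (hDKv.differentiable one_ne_zero z), hfpj]
    have h1 : ‖fderiv ℝ (fun z => fderiv ℝ K z v) z‖ ≤ A * ‖z‖ ^ (-2 - (d : ℝ)) := by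
      have e : fderiv ℝ (fun z => fderiv ℝ K z v) z =
          (ContinuousLinearMap.apply ℝ ℝ v).comp (fderiv ℝ (fderiv ℝ K) z) :=
        ((ContinuousLinearMap.apply ℝ ℝ v).hasFDerivAt.comp z
          (hDK.differentiable one_ne_zero z).hasFDerivAt).fderiv
      rw [e]
      refine (ContinuousLinearMap.opNorm_comp_le _ _).trans ?_
      have : ‖ContinuousLinearMap.apply ℝ ℝ v‖ ≤ 1 := by
        refine ContinuousLinearMap.opNorm_le_bound _ zero_le_one fun L => ?_
        rw [ContinuousLinearMap.apply_apply, one_mul]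
        exact (L.le_opNorm v).trans (mul_le_of_le_one_right (norm_nonneg _) hv)
      exact (mul_le_of_le_one_left (norm_nonneg _) this).trans (hK.hess z)
    have h2 : ‖(ContinuousLinearMap.proj j : Euc d →L[ℝ] ℝ)‖ ≤ 1 :=
      ContinuousLinearMap.opNorm_le_bound _ zero_le_one fun z => by
        rw [one_mul]; exact abs_coord_le z j
    have h3 : ‖fderiv ℝ K z v‖ ≤ A * ‖z‖ ^ (-1 - (d : ℝ)) :=
      ((fderiv ℝ K z).le_opNorm v).trans
        ((mul_le_of_le_one_right (norm_nonneg _) hv).trans (hK.grad z))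
    have h4 : ‖z‖ * ‖z‖ ^ (-2 - (d : ℝ)) ≤ ‖z‖ ^ (-1 - (d : ℝ)) := by
      rcases eq_or_ne z 0 with rfl | hz
      · simp only [norm_zero, zero_mul]; positivity
      · rw [← Real.rpow_one_add' (norm_nonneg _) (by
          have : (0 : ℝ) ≤ d := d.cast_nonneg
          intro h; linarith)]
        exact le_of_eq (by congr 1; ring)
    calc _ ≤ ‖z j • fderiv ℝ (fun z => fderiv ℝ K z v) z‖ +
          ‖fderiv ℝ K z v • (ContinuousLinearMap.proj j : Euc d →L[ℝ] ℝ)‖ := norm_add_le _ _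
      _ ≤ ‖z‖ * (A * ‖z‖ ^ (-2 - (d : ℝ))) + A * ‖z‖ ^ (-1 - (d : ℝ)) * 1 := by
          rw [norm_smul, norm_smul]
          gcongr
          exact abs_coord_le z j
      _ ≤ 2 * A * ‖z‖ ^ (-1 - (d : ℝ)) := by nlinarith
      _ ≤ _ := by
          gcongr
          nlinarith [mul_nonneg hrc (by linarith : 0 ≤ 2 + B)]
  · set χ : Euc d → ℝ := smoothCut r with hχr
    have hs := hχ r hr
    have hχd : Differentiable ℝ χ := hs.contDiff.differentiable two_ne_zero
    have hcut := hK.toIsCZ.smoothCut_mul hd hr hB hs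
    have hKc := hK.toIsCZ.contDiff.continuous
    have hm : MeasurableSet {z : Euc d | ‖z‖ < r} := measurableSet_lt measurable_norm measurable_const
    have hmS : MeasurableSet {z : Euc d | r ≤ ‖z‖ ∧ ‖z‖ ≤ 2 * r} :=
      (measurableSet_le measurable_const measurable_norm).inter
        (measurableSet_le measurable_norm measurable_const)
    have hDχv : Continuous fun z => fderiv ℝ χ z v :=
      ((hs.contDiff.continuous_fderiv two_ne_zero).clm_apply continuous_const)
    have hann : ∀ (g : Euc d → ℝ) {b : ℝ}, 0 ≤ b → (∀ z, z ≠ 0 → |g z| ≤ b * ‖z‖ ^ (-(d : ℝ))) →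
        |∫ z in {z : Euc d | r ≤ ‖z‖ ∧ ‖z‖ ≤ 2 * r}, g z| ≤ b * (radConst d * 2) := by
      intro g b hb hg
      have h2 := norm_setIntegral_annulus_le hd hr (b := 2 * r) (by positivity) hb (0 : Euc d)
        hmS (fun y hy => by simpa using hy.1) (fun y hy => by simpa using hy.2)
        (g := g) (fun y hy => by
          rw [zero_sub, norm_neg]; exact hg y (norm_pos_iff.1 (hr.trans_le hy.1)))
      rwa [mul_div_assoc, div_self hr.ne', mul_one, Real.norm_eq_abs] at h2
    have hcgi : Integrable fun z => χ z * _root_.coordGrad K v j z :=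
      (hs.contDiff.continuous.mul hcd.continuous).integrable_of_hasCompactSupport hcs.mul_left
    -- removing the smooth cutoff
    have e1 : ∫ z in {z : Euc d | ‖z‖ < r}, _root_.coordGrad K v j z =
        (∫ z, χ z * _root_.coordGrad K v j z) -
          ∫ z in {z : Euc d | r ≤ ‖z‖ ∧ ‖z‖ ≤ 2 * r}, χ z * _root_.coordGrad K v j z := by
      rw [eq_sub_iff_add_eq, ← integral_indicator hm, ← integral_indicator hmS, ← integral_add
        (hInt.indicator hm) (hcgi.indicator hmS)]
      refine integral_congr_ae (Eventually.of_forall fun z => ?_)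
      simp only
      rcases lt_or_ge ‖z‖ r with h | h
      · rw [indicator_of_mem (show z ∈ {z | ‖z‖ < r} from h),
          indicator_of_notMem (by simp [h]), hχr, smoothCut_eq_one hr h.le]; ring
      · rw [indicator_of_notMem (by simpa using h)]
        rcases le_or_gt ‖z‖ (2 * r) with h' | h'
        · rw [indicator_of_mem (show z ∈ {z | r ≤ ‖z‖ ∧ ‖z‖ ≤ 2 * r} from ⟨h, h'⟩), zero_add]
        · rw [indicator_of_notMem (by simp [h']), hχr, smoothCut_eq_zero hr h'.le]; ring
    have hf' : ∀ z, fderiv ℝ (fun z => χ z * z j) z v = χ z * v j + z j * fderiv ℝ χ z v := by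
      intro z
      rw [fderiv_fun_mul (hχd z) (hpj.differentiable two_ne_zero z), hfpj]
      simp
    have hi1 : Integrable fun z => χ z * K z := hcut.integrable
    have hi2 : Integrable fun z => z j * fderiv ℝ χ z v * K z :=
      (((continuous_apply j).mul hDχv).mul hKc).integrable_of_hasCompactSupport hK.compact.mul_left
    have e2 : ∫ z, χ z * _root_.coordGrad K v j z =
        -(v j * (∫ z, χ z * K z) + ∫ z, z j * fderiv ℝ χ z v * K z) := by
      have h := integral_mul_fderiv_eq_neg_fderiv_mul_of_integrable (μ := volume)
        (f := fun z : Euc d => χ z * z j) (g := K) (v := v) ?_ ?_ ?_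
        (fun z _ => (hχd z).mul (hpj.differentiable two_ne_zero z))
        (fun z _ => hK.toIsCZ.contDiff.differentiable one_ne_zero z)
      · rw [← integral_const_mul, ← integral_add (hi1.const_mul _) hi2]
        calc _ = ∫ z, χ z * z j * fderiv ℝ K z v := by
              congr 1; ext z; simp only [_root_.coordGrad]; ring
          _ = _ := h
          _ = _ := by
              congr 2; ext z; rw [hf']; ring
      · simp_rw [hf']
        refine ((hi1.const_mul (v j)).add hi2).congr (Eventually.of_forall fun z => ?_)
        simp only [Pi.add_apply]; ring
      · refine hcgi.congr (Eventually.of_forall fun z => ?_)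
        simp only [_root_.coordGrad]; ring
      · exact ((hs.contDiff.continuous.mul (continuous_apply j)).mul
          hKc).integrable_of_hasCompactSupport hK.compact.mul_left
    have e3 : ∫ z, z j * fderiv ℝ χ z v * K z =
        ∫ z in {z : Euc d | r ≤ ‖z‖ ∧ ‖z‖ ≤ 2 * r}, z j * fderiv ℝ χ z v * K z := by
      refine (setIntegral_eq_integral_of_forall_compl_eq_zero fun z hz => ?_).symm
      have : fderiv ℝ χ z = 0 := by
        refine fderiv_smoothCut_eq_zero hr ?_
        by_contra hcon
        push Not at hcon
        exact hz hcon
      simp [this]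
    have b1 := hann (fun z => χ z * _root_.coordGrad K v j z) hA fun z _ => by
      rw [abs_mul]
      exact (mul_le_of_le_one_left (abs_nonneg _) (abs_smoothCut_le_one _ _)).trans (hsz z)
    have b2 := hann (fun z => z j * fderiv ℝ χ z v * K z) (b := B * A) (by positivity) fun z hz => by
      rw [abs_mul, abs_mul]
      have hz' : 0 < ‖z‖ := norm_pos_iff.2 hz
      calc _ ≤ ‖z‖ * (B * ‖z‖ ^ (-1 : ℝ) * 1) * (A * ‖z‖ ^ (-(d : ℝ))) := by
            gcongr
            · exact abs_coord_le z j
            · exact ((fderiv ℝ χ z).le_opNorm v).trans (by gcongr; exact hs.grad z hz)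
            · exact hK.size z
        _ = _ := by rw [Real.rpow_neg_one]; field_simp
    have b3 := hcut.abs_integral_le
    have b4 : |v j| ≤ 1 := (abs_coord_le v j).trans hv
    rw [e1, e2, e3]
    have b5 : |v j * ∫ z, χ z * K z| ≤ (1 + B + 2 * radConst d) * A := by
      rw [abs_mul]; exact (mul_le_of_le_one_left (abs_nonneg _) b4).trans b3
    have b6 : (1 + B + 2 * radConst d) * A + B * A * (radConst d * 2) + A * (radConst d * 2) ≤
        (2 + B + 2 * radConst d * (2 + B)) * A := by nlinarith [mul_nonneg hrc hA]
    rw [abs_le] at *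
    constructor <;> linarith [b1.1, b1.2, b2.1, b2.2, b5.1, b5.2]

end

section
variable {d : ℕ} {A α Mη : ℝ} {K : Euc d → ℝ} {η : Euc d → Euc d}

theorem clm_apply_eq_sum {F : Type*} [NormedAddCommGroup F] [NormedSpace ℝ F]
    (L : Euc d →L[ℝ] F) (u : Euc d) : L u = ∑ i, u i • L (Pi.single i 1) := by
  conv_lhs => rw [pi_eq_sum_univ' u]
  simp [map_sum]

theorem norm_single_one_le (i : Fin d) : ‖(Pi.single i 1 : Euc d)‖ ≤ 1 := by
  rw [Pi.norm_single]; simp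

theorem InC1a.nonneg (h : InC1a α Mη η) : 0 ≤ Mη := (norm_nonneg _).trans (h.2.1 0)

theorem InC1a.contDiff (hα0 : 0 < α) (h : InC1a α Mη η) : ContDiff ℝ 1 η :=
  contDiff_one_iff_fderiv.2 ⟨h.1, h.2.2.continuous hα0⟩

theorem InC1a.lipschitz (h : InC1a α Mη η) (x y : Euc d) : ‖η x - η y‖ ≤ Mη * ‖x - y‖ :=
  convex_univ.norm_image_sub_le_of_norm_fderiv_le (𝕜 := ℝ) (fun w _ => h.1 w)
    (fun w _ => h.2.2.1 w) (mem_univ _) (mem_univ _)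

theorem InC1a.taylor (hα0 : 0 < α) (h : InC1a α Mη η) (x y : Euc d) :
    ‖η x - η y - fderiv ℝ η x (x - y)‖ ≤ Mη * ‖x - y‖ ^ α * ‖x - y‖ := by
  refine (convex_segment y x).norm_image_sub_le_of_norm_fderiv_le' (𝕜 := ℝ)
    (f := η) (φ := fderiv ℝ η x) (C := Mη * ‖x - y‖ ^ α) (fun w _ => h.1 w) (fun w hw => ?_)
    (left_mem_segment ℝ y x) (right_mem_segment ℝ y x)
  refine (h.2.2.2 w x).trans ?_
  have h0 := h.nonneg
  gcongr
  obtain ⟨a, b, ha, hb, hab, rfl⟩ := hw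
  have : a • y + b • x - x = a • (y - x) := by
    rw [smul_sub, ← sub_eq_zero]
    have : a = 1 - b := by linarith
    subst this
    module
  rw [this, norm_smul, Real.norm_of_nonneg ha, norm_sub_rev y x]
  exact mul_le_of_le_one_left (norm_nonneg _) (by linarith)

theorem InC1a.inCa_coord (h : InC1a α Mη η) {v : Euc d} (hv : ‖v‖ ≤ 1) (i : Fin d) :
    InCa α Mη (fun x => fderiv ℝ η x v i) := by
  have key : ∀ L : Euc d →L[ℝ] Euc d, ‖L v i‖ ≤ ‖L‖ := fun L =>
    (norm_le_pi_norm _ i).trans ((L.le_opNorm v).trans (mul_le_of_le_one_right (norm_nonneg _) hv))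
  exact ⟨fun x => (key _).trans (h.2.2.1 x), fun x y =>
    (key (fderiv ℝ η x - fderiv ℝ η y)).trans (h.2.2.2 x y)⟩

theorem InC1a.inCa_divVec (h : InC1a α Mη η) : InCa α (d * Mη) (divVec η) := by
  refine ⟨fun x => ?_, fun x y => ?_⟩
  · refine (norm_sum_le _ _).trans ((Finset.sum_le_sum fun j _ =>
      (h.inCa_coord (norm_single_one_le j) j).1 x).trans ?_)
    simp
  · unfold divVec
    rw [← Finset.sum_sub_distrib]
    refine (norm_sum_le _ _).trans ((Finset.sum_le_sum fun j _ =>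
      (h.inCa_coord (norm_single_one_le j) j).2 x y).trans ?_)
    simp [mul_assoc]

theorem InC1a.inCa_apply (hα0 : 0 < α) (hα1 : α < 1) (h : InC1a α Mη η) (i : Fin d) :
    InCa α (2 * Mη) (fun x => η x i) := by
  have h0 := h.nonneg
  refine ⟨fun x => (norm_le_pi_norm _ i).trans ((h.2.1 x).trans (by linarith)), fun x y => ?_⟩
  have h1 : ‖η x i - η y i‖ ≤ ‖η x - η y‖ := norm_le_pi_norm (η x - η y) i
  rcases le_or_gt ‖x - y‖ 1 with hxy | hxy
  · refine h1.trans ((h.lipschitz x y).trans ?_)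
    have : ‖x - y‖ ≤ ‖x - y‖ ^ α := by
      conv_lhs => rw [← Real.rpow_one ‖x - y‖]
      rcases (norm_nonneg (x - y)).eq_or_lt with h2 | h2
      · rw [← h2, Real.zero_rpow one_ne_zero]; positivity
      · exact Real.rpow_le_rpow_of_exponent_ge h2 hxy hα1.le
    nlinarith [mul_le_mul_of_nonneg_left this h0, Real.rpow_nonneg (norm_nonneg (x - y)) α]
  · have h2 : ‖η x - η y‖ ≤ 2 * Mη :=
      (norm_sub_le _ _).trans (by linarith [h.2.1 x, h.2.1 y])
    have h3 : 1 ≤ ‖x - y‖ ^ α := Real.one_le_rpow hxy.le hα0.le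
    nlinarith

theorem HasCompactSupport.comp_sub_left {F : Type*} [Zero F] {g : Euc d → F}
    (hg : HasCompactSupport g) (x : Euc d) : HasCompactSupport fun y => g (x - y) :=
  hg.comp_homeomorph (Homeomorph.subLeft x)

theorem IsCZ.continuous_fderiv_comp (hK : IsCZ A K) (x : Euc d) :
    Continuous fun y => fderiv ℝ K (x - y) :=
  (hK.contDiff.continuous_fderiv one_ne_zero).comp (continuous_const.sub continuous_id)

theorem IsCZ.integrable_fderiv_mul (hK : IsCZ A K) {f : Euc d → ℝ} (hf : Continuous f)
    {u : Euc d → Euc d} (hu : Continuous u) (x : Euc d) :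
    Integrable fun y => fderiv ℝ K (x - y) (u y) * f y := by
  refine (((hK.continuous_fderiv_comp x).clm_apply hu).mul hf).integrable_of_hasCompactSupport ?_
  refine HasCompactSupport.mul_right ?_
  refine ((hK.compact.fderiv (𝕜 := ℝ)).comp_sub_left x).mono' fun y hy => subset_tsupport _ ?_
  intro h0
  exact hy (by simp only at h0; simp [h0])

theorem IsCZ.fderiv_czT_apply (hK : IsCZ A K) {f : Euc d → ℝ} (hf : Continuous f) (x v : Euc d) :
    fderiv ℝ (czT K f) x v = ∫ y, fderiv ℝ K (x - y) v * f y := by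
  have h := hK.compact.hasFDerivAt_convolution_right (ContinuousLinearMap.mul ℝ ℝ)
    (μ := volume) hf.locallyIntegrable hK.contDiff x
  rw [czT_eq_convolution, h.fderiv, convolution_precompR_apply _ hf.locallyIntegrable
    (hK.compact.fderiv (𝕜 := ℝ)) (hK.contDiff.continuous_fderiv one_ne_zero)]
  simp only [convolution, ContinuousLinearMap.mul_apply']
  congr 1; ext y; ring

/-- The singular part of the commutator of `η · ∇` with convolution by `K`. -/
def czC (K : Euc d → ℝ) (η : Euc d → Euc d) (f : Euc d → ℝ) (x : Euc d) : ℝ :=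
  ∫ y, fderiv ℝ K (x - y) (η x - η y) * f y

theorem IsCZ.commutator_eq (hK : IsCZ A K) {f : Euc d → ℝ} (hf : ContDiff ℝ 1 f)
    (hη : ContDiff ℝ 1 η) (x : Euc d) :
    fderiv ℝ (czT K f) x (η x) - czT K (fun y => fderiv ℝ f y (η y)) x =
      czC K η f x + czT K (fun y => divVec η y * f y) x := by
  have hKx : ContDiff ℝ 1 fun y => K (x - y) := hK.contDiff.comp (contDiff_const.sub contDiff_id)
  have hKxs : HasCompactSupport fun y => K (x - y) := hK.compact.comp_sub_left x
  have hηi : ∀ i, ContDiff ℝ 1 fun y => η y i := fun i => (contDiff_pi.1 hη) i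
  have hDηi : ∀ (i : Fin d) y v, fderiv ℝ (fun y => η y i) y v = fderiv ℝ η y v i := by
    intro i y v
    have := ((ContinuousLinearMap.proj (R := ℝ) (φ := fun _ : Fin d => ℝ) i).hasFDerivAt.comp y
      (hη.differentiable one_ne_zero y).hasFDerivAt).fderiv
    change fderiv ℝ (fun y => η y i) y = _ at this
    rw [this]; rfl
  have hDKx : ∀ y v, fderiv ℝ (fun y => K (x - y)) y v = -fderiv ℝ K (x - y) v := by
    intro y v
    have := ((hK.contDiff.differentiable one_ne_zero (x - y)).hasFDerivAt.comp y
      ((hasFDerivAt_id y).const_sub x)).fderiv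
    change fderiv ℝ (fun y => K (x - y)) y = _ at this
    rw [this]; simp
  have hcDη : ∀ i, Continuous fun y => fderiv ℝ η y (Pi.single i 1) i := fun i =>
    (continuous_apply i).comp ((hη.continuous_fderiv one_ne_zero).clm_apply continuous_const)
  have hcDf : ∀ v, Continuous fun y => fderiv ℝ f y v := fun v =>
    (hf.continuous_fderiv one_ne_zero).clm_apply continuous_const
  have hcDK : ∀ v, Continuous fun y => fderiv ℝ K (x - y) v := fun v =>
    (hK.continuous_fderiv_comp x).clm_apply continuous_const
  have hi1 : ∀ i, Integrable fun y => K (x - y) * (fderiv ℝ η y (Pi.single i 1) i * f y) := fun i =>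
    hK.integrable_mul ((hcDη i).mul hf.continuous).locallyIntegrable x
  have hi2 : ∀ i, Integrable fun y => fderiv ℝ K (x - y) (Pi.single i 1) * (η y i * f y) := fun i =>
    hK.integrable_fderiv_mul ((hηi i).continuous.mul hf.continuous) continuous_const x
  have hi3 : ∀ i, Integrable fun y => K (x - y) * (η y i * fderiv ℝ f y (Pi.single i 1)) := fun i =>
    hK.integrable_mul ((hηi i).continuous.mul (hcDf _)).locallyIntegrable x
  have hparts : ∀ i : Fin d, ∫ y, K (x - y) * (η y i * fderiv ℝ f y (Pi.single i 1)) =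
      (∫ y, fderiv ℝ K (x - y) (Pi.single i 1) * (η y i * f y)) -
        ∫ y, K (x - y) * (fderiv ℝ η y (Pi.single i 1) i * f y) := by
    intro i
    have hf' : ∀ y, fderiv ℝ (fun y => K (x - y) * η y i) y (Pi.single i 1) * f y =
        K (x - y) * (fderiv ℝ η y (Pi.single i 1) i * f y) -
          fderiv ℝ K (x - y) (Pi.single i 1) * (η y i * f y) := by
      intro y
      rw [fderiv_fun_mul (hKx.differentiable one_ne_zero y) ((hηi i).differentiable one_ne_zero y),
        add_apply, smul_apply,
        smul_apply, hDηi, hDKx, smul_eq_mul, smul_eq_mul]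
      ring
    have h := integral_mul_fderiv_eq_neg_fderiv_mul_of_integrable (μ := volume)
      (f := fun y : Euc d => K (x - y) * η y i) (g := f) (v := Pi.single i 1) ?_ ?_ ?_
      (fun y _ => (hKx.differentiable one_ne_zero y).mul ((hηi i).differentiable one_ne_zero y))
      (fun y _ => hf.differentiable one_ne_zero y)
    · simp_rw [hf'] at h
      rw [integral_sub (hi1 i) (hi2 i), neg_sub] at h
      rw [← h]
      congr 1; ext y; ring
    · simp_rw [hf']
      exact (hi1 i).sub (hi2 i)
    · exact (hi3 i).congr (Eventually.of_forall fun y => by simp only; ring)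
    · exact ((hKx.continuous.mul (hηi i).continuous).mul
        hf.continuous).integrable_of_hasCompactSupport hKxs.mul_right.mul_right
  have e1 : czT K (fun y => fderiv ℝ f y (η y)) x =
      (∫ y, fderiv ℝ K (x - y) (η y) * f y) - czT K (fun y => divVec η y * f y) x := by
    have s1 : czT K (fun y => fderiv ℝ f y (η y)) x =
        ∑ i, ∫ y, K (x - y) * (η y i * fderiv ℝ f y (Pi.single i 1)) := by
      rw [← integral_finsetSum _ fun i _ => hi3 i]
      refine integral_congr_ae (Eventually.of_forall fun y => ?_)
      simp only
      rw [clm_apply_eq_sum (fderiv ℝ f y) (η y), Finset.mul_sum]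
      rfl
    have s2 : (∫ y, fderiv ℝ K (x - y) (η y) * f y) =
        ∑ i, ∫ y, fderiv ℝ K (x - y) (Pi.single i 1) * (η y i * f y) := by
      rw [← integral_finsetSum _ fun i _ => hi2 i]
      refine integral_congr_ae (Eventually.of_forall fun y => ?_)
      simp only
      rw [clm_apply_eq_sum (fderiv ℝ K (x - y)) (η y), Finset.sum_mul]
      refine Finset.sum_congr rfl fun i _ => ?_
      rw [smul_eq_mul]; ring
    have s3 : czT K (fun y => divVec η y * f y) x =
        ∑ i, ∫ y, K (x - y) * (fderiv ℝ η y (Pi.single i 1) i * f y) := by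
      rw [← integral_finsetSum _ fun i _ => hi1 i]
      refine integral_congr_ae (Eventually.of_forall fun y => ?_)
      simp only
      rw [divVec, Finset.sum_mul, Finset.mul_sum]
    rw [s1, s2, s3, ← Finset.sum_sub_distrib]
    exact Finset.sum_congr rfl fun i _ => hparts i
  have e2 : czC K η f x = fderiv ℝ (czT K f) x (η x) -
      ∫ y, fderiv ℝ K (x - y) (η y) * f y := by
    rw [hK.fderiv_czT_apply hf.continuous, ← integral_sub
      (hK.integrable_fderiv_mul hf.continuous continuous_const x)
      (hK.integrable_fderiv_mul hf.continuous hη.continuous x), czC]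
    congr 1; ext y
    rw [map_sub, sub_mul]
  rw [e1, e2]; ring

theorem IsCZ.fderiv_czT (hK : IsCZ A K) {f : Euc d → ℝ} (hf : ContDiff ℝ 1 f) (x v : Euc d) :
    fderiv ℝ (czT K f) x v = czT K (fun y => fderiv ℝ f y v) x := by
  have h := hK.commutator_eq hf (η := fun _ => v) contDiff_const x
  have h1 : divVec (fun _ : Euc d => v) = fun _ => 0 := by
    ext y; simp [divVec]
  simpa [czC, h1, czT, sub_eq_zero] using h

theorem IsCZ.integral_kernel_eq (hK : IsCZ A K) (hη : ContDiff ℝ 1 η) (x : Euc d) :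
    ∫ y, fderiv ℝ K (x - y) (η x - η y) = -czT K (divVec η) x := by
  have h := hK.commutator_eq (f := fun _ => 1) contDiff_const hη x
  have h1 : czT K (fun _ => 1) = fun _ => ∫ z, K z := by
    ext x; simp only [czT, mul_one]; exact integral_sub_left_eq_self K volume x
  have h2 : czT K (fun _ : Euc d => (0 : ℝ)) x = 0 := by simp [czT]
  rw [h1] at h
  simp [czC, h2, -map_sub] at h
  change 0 = _ + czT K (divVec η) x at h
  linarith

/-- An integrable majorant for the regular part of the commutator kernel. -/
def remMajorant (α : ℝ) (z : Euc d) : ℝ :=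
  {z : Euc d | ‖z‖ < 1}.indicator (fun z => ‖z‖ ^ (α - d)) z +
    {z : Euc d | 1 ≤ ‖z‖}.indicator (fun z => 4 * ‖z‖ ^ (-1 - (d : ℝ))) z

theorem remMajorant_nonneg (α : ℝ) (z : Euc d) : 0 ≤ remMajorant α z :=
  add_nonneg (indicator_nonneg (fun _ _ => by positivity) _)
    (indicator_nonneg (fun _ _ => by positivity) _)

theorem measurable_remMajorant (α : ℝ) : Measurable (remMajorant α : Euc d → ℝ) :=
  ((measurable_norm.pow_const _).indicator (measurableSet_lt measurable_norm measurable_const)).add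
    (((measurable_norm.pow_const _).const_mul _).indicator
      (measurableSet_le measurable_const measurable_norm))

theorem integrable_remMajorant (hd : 1 ≤ d) (hα0 : 0 < α) :
    Integrable (remMajorant α : Euc d → ℝ) := by
  have h1 := integrableOn_norm_rpow_ball hd hα0 1
  have h2 := integrableOn_norm_rpow_far hd one_pos one_pos
  have hb : {z : Euc d | ‖z‖ < 1} = Metric.ball 0 1 := by ext; simp
  have hm1 : MeasurableSet {z : Euc d | ‖z‖ < 1} := hb ▸ measurableSet_ball
  have hm2 : MeasurableSet {z : Euc d | 1 ≤ ‖z‖} := measurableSet_le measurable_const measurable_norm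
  rw [← hb] at h1
  exact (IntegrableOn.integrable_indicator h1 hm1).add
    (IntegrableOn.integrable_indicator (Integrable.const_mul h2 4) hm2)

theorem IsCZ.abs_kernel_sub_le (hα0 : 0 < α) (hK : IsCZ A K) (hη : InC1a α Mη η)
    (x y : Euc d) :
    |fderiv ℝ K (x - y) (η x - η y) - ∑ i, ∑ j, fderiv ℝ η x (Pi.single j 1) i *
      (smoothCut 1 (x - y) * coordGrad K (Pi.single i 1) j (x - y))| ≤
      A * Mη * remMajorant α (x - y) := by
  have hA := hK.nonneg
  have hM := hη.nonneg
  set z := x - y with hz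
  have e : ∑ i, ∑ j, fderiv ℝ η x (Pi.single j 1) i *
      (smoothCut 1 z * coordGrad K (Pi.single i 1) j z) =
      smoothCut 1 z * fderiv ℝ K z (fderiv ℝ η x z) := by
    rw [clm_apply_eq_sum (fderiv ℝ K z), Finset.mul_sum]
    refine Finset.sum_congr rfl fun i _ => ?_
    rw [clm_apply_eq_sum (fderiv ℝ η x) z, Finset.sum_apply, smul_eq_mul, Finset.sum_mul,
      Finset.mul_sum]
    refine Finset.sum_congr rfl fun j _ => ?_
    simp only [coordGrad, Pi.smul_apply, smul_eq_mul]; ring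
  rw [e]
  have hgr := hK.grad z
  rcases lt_or_ge ‖z‖ 1 with h | h
  · have hw : remMajorant α z = ‖z‖ ^ (α - d) := by
      rw [remMajorant, indicator_of_mem (show z ∈ {z : Euc d | ‖z‖ < 1} from h),
        indicator_of_notMem (by simp [h]), add_zero]
    rw [hw, smoothCut_eq_one one_pos h.le, one_mul, ← map_sub]
    rcases eq_or_ne z 0 with h0 | h0
    · have : x = y := sub_eq_zero.1 (hz ▸ h0)
      simp only [h0, this, sub_self, map_zero, abs_zero]
      positivity
    · calc _ ≤ A * ‖z‖ ^ (-1 - (d : ℝ)) * (Mη * ‖z‖ ^ α * ‖z‖) :=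
            ((fderiv ℝ K z).le_opNorm _).trans
              (mul_le_mul hgr (hη.taylor hα0 x y) (norm_nonneg _) (by positivity))
        _ = A * Mη * (‖z‖ ^ (-1 - (d : ℝ)) * ‖z‖ ^ α * ‖z‖ ^ (1 : ℝ)) := by
            rw [Real.rpow_one]; ring
        _ = _ := by
            have hp := norm_pos_iff.2 h0
            rw [← Real.rpow_add hp, ← Real.rpow_add hp]; congr 2; ring
  · have hw : remMajorant α z = 4 * ‖z‖ ^ (-1 - (d : ℝ)) := by
      rw [remMajorant, indicator_of_mem (show z ∈ {z : Euc d | 1 ≤ ‖z‖} from h),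
        indicator_of_notMem (by simp [h]), zero_add]
    rw [hw]
    have b1 : |fderiv ℝ K z (η x - η y)| ≤ A * ‖z‖ ^ (-1 - (d : ℝ)) * (2 * Mη) :=
      ((fderiv ℝ K z).le_opNorm _).trans (mul_le_mul hgr
        ((norm_sub_le _ _).trans (by linarith [hη.2.1 x, hη.2.1 y])) (norm_nonneg _) (by positivity))
    have b2 : |smoothCut 1 z * fderiv ℝ K z (fderiv ℝ η x z)| ≤
        A * ‖z‖ ^ (-1 - (d : ℝ)) * (2 * Mη) := by
      rcases le_or_gt 2 ‖z‖ with h2 | h2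
      · rw [smoothCut_eq_zero one_pos (by linarith), zero_mul, abs_zero]; positivity
      · rw [abs_mul]
        refine (mul_le_of_le_one_left (abs_nonneg _) (abs_smoothCut_le_one _ _)).trans ?_
        refine ((fderiv ℝ K z).le_opNorm _).trans (mul_le_mul hgr ?_ (norm_nonneg _) (by positivity))
        refine ((fderiv ℝ η x).le_opNorm z).trans ?_
        calc _ ≤ Mη * 2 := mul_le_mul (hη.2.2.1 x) h2.le (norm_nonneg _) hM
          _ = _ := mul_comm _ _
    calc _ ≤ _ := abs_sub _ _
      _ ≤ _ := add_le_add b1 b2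
      _ = _ := by ring

end

section
variable {d : ℕ} {A A₁ α Mη : ℝ} {K : Euc d → ℝ} {η : Euc d → Euc d}

/-- The localized kernel `θ(z) z_j ∂_i K(z)`. -/
def localKernel (K : Euc d → ℝ) (i j : Fin d) (z : Euc d) : ℝ :=
  smoothCut 1 z * coordGrad K (Pi.single i 1) j z

theorem exists_isCZ_localKernel (hd : 1 ≤ d) (A : ℝ) :
    ∃ A₁ : ℝ, ∀ K : Euc d → ℝ, IsCZTwo A K → ∀ i j, IsCZ A₁ (localKernel K i j) := by
  obtain ⟨B, hB, hχ⟩ := exists_isSymbol_smoothCut d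
  exact ⟨_, fun K hK i j => (hK.coordGrad hd hB hχ (norm_single_one_le i) j).smoothCut_mul hd
    one_pos hB (hχ 1 one_pos)⟩

theorem IsCZ.integrable_kernel (hK : IsCZ A K) (hη : Continuous η) (x : Euc d) :
    Integrable fun y => fderiv ℝ K (x - y) (η x - η y) := by
  have := hK.integrable_fderiv_mul (f := fun _ => 1) continuous_const
    (u := fun y => η x - η y) (continuous_const.sub hη) x
  simpa only [mul_one] using this

theorem IsCZ.abs_setIntegral_kernel_le (hd : 1 ≤ d) (hα0 : 0 < α) (hK : IsCZ A K)
    (hL : ∀ i j, IsCZ A₁ (localKernel K i j)) (hη : InC1a α Mη η) (x : Euc d) {S : Set (Euc d)}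
    (hS : ∀ i j, |∫ y in S, localKernel K i j (x - y)| ≤ 2 * A₁) :
    |∫ y in S, fderiv ℝ K (x - y) (η x - η y)| ≤
      (d * d * (2 * A₁) + A * ∫ z : Euc d, remMajorant α z) * Mη := by
  have hA := hK.nonneg
  have hM := hη.nonneg
  have hLi : ∀ i j, Integrable fun y => fderiv ℝ η x (Pi.single j 1) i *
      localKernel K i j (x - y) := fun i j =>
    ((hL i j).integrable.comp_sub_left x).const_mul _
  have hN := hK.integrable_kernel (hη.contDiff hα0).continuous x
  have hLs : Integrable fun y => ∑ i, ∑ j, fderiv ℝ η x (Pi.single j 1) i *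
      localKernel K i j (x - y) :=
    integrable_finsetSum _ fun i _ => integrable_finsetSum _ fun j _ => hLi i j
  have hw : Integrable fun y => A * Mη * remMajorant α (x - y) :=
    ((integrable_remMajorant hd hα0).comp_sub_left x).const_mul _
  have e1 : ∫ y in S, ∑ i, ∑ j, fderiv ℝ η x (Pi.single j 1) i * localKernel K i j (x - y) =
      ∑ i, ∑ j, fderiv ℝ η x (Pi.single j 1) i * ∫ y in S, localKernel K i j (x - y) := by
    rw [integral_finsetSum _ fun i _ => integrable_finsetSum _ fun j _ => (hLi i j).integrableOn]
    refine Finset.sum_congr rfl fun i _ => ?_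
    rw [integral_finsetSum _ fun j _ => (hLi i j).integrableOn]
    exact Finset.sum_congr rfl fun j _ => integral_const_mul _ _
  have b1 : |∫ y in S, ∑ i, ∑ j, fderiv ℝ η x (Pi.single j 1) i * localKernel K i j (x - y)| ≤
      d * d * (Mη * (2 * A₁)) := by
    rw [e1]
    have : ∀ i j, |fderiv ℝ η x (Pi.single j 1) i * ∫ y in S, localKernel K i j (x - y)| ≤
        Mη * (2 * A₁) := fun i j => by
      rw [abs_mul]
      exact mul_le_mul ((hη.inCa_coord (norm_single_one_le j) i).1 x) (hS i j) (abs_nonneg _) hM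
    refine (Finset.abs_sum_le_sum_abs _ _).trans ((Finset.sum_le_sum fun i _ =>
      (Finset.abs_sum_le_sum_abs _ _).trans (Finset.sum_le_sum fun j _ => this i j)).trans ?_)
    simp [mul_assoc]
  have b2 : |∫ y in S, (fderiv ℝ K (x - y) (η x - η y) -
      ∑ i, ∑ j, fderiv ℝ η x (Pi.single j 1) i * localKernel K i j (x - y))| ≤
      A * Mη * ∫ z : Euc d, remMajorant α z := by
    rw [← Real.norm_eq_abs]
    refine (norm_integral_le_of_norm_le hw.integrableOn (Eventually.of_forall fun y =>
      hK.abs_kernel_sub_le hα0 hη x y)).trans ?_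
    refine (setIntegral_le_integral hw (Eventually.of_forall fun y =>
      mul_nonneg (by positivity) (remMajorant_nonneg _ _))).trans_eq ?_
    rw [integral_const_mul, integral_sub_left_eq_self (remMajorant α) volume x]
  rw [integral_sub hN.integrableOn hLs.integrableOn] at b2
  rw [abs_le] at b1 b2 ⊢
  constructor <;> nlinarith [b1.1, b1.2, b2.1, b2.2]

theorem IsCZ.abs_kernel_le (hK : IsCZ A K) (hη : InC1a α Mη η) (x y : Euc d) :
    |fderiv ℝ K (x - y) (η x - η y)| ≤ A * Mη * ‖x - y‖ ^ (-(d : ℝ)) := by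
  have hA := hK.nonneg
  have hM := hη.nonneg
  rcases eq_or_ne x y with rfl | hne
  · simp only [sub_self, map_zero, abs_zero]; positivity
  have hp : 0 < ‖x - y‖ := norm_pos_iff.2 (sub_ne_zero.2 hne)
  calc _ ≤ A * ‖x - y‖ ^ (-1 - (d : ℝ)) * (Mη * ‖x - y‖) :=
        ((fderiv ℝ K (x - y)).le_opNorm _).trans (mul_le_mul (hK.grad _) (hη.lipschitz x y)
          (norm_nonneg _) (by positivity))
    _ = A * Mη * (‖x - y‖ ^ (-1 - (d : ℝ)) * ‖x - y‖ ^ (1 : ℝ)) := by rw [Real.rpow_one]; ring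
    _ = _ := by rw [← Real.rpow_add hp]; congr 2; ring

theorem IsCZTwo.abs_kernel_sub_kernel_le (hK : IsCZTwo A K) (hη : InC1a α Mη η) (x x' y : Euc d)
    (hxy : 2 * ‖x - x'‖ ≤ ‖x - y‖) :
    |fderiv ℝ K (x - y) (η x - η y) - fderiv ℝ K (x' - y) (η x' - η y)| ≤
      (2 ^ (2 + (d : ℝ)) + 2 ^ (1 + (d : ℝ))) * A * Mη * ‖x - x'‖ * ‖x - y‖ ^ (-1 - (d : ℝ)) := by
  have hA := hK.nonneg
  have hM := hη.nonneg
  rcases eq_or_ne x y with rfl | hne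
  · have : x = x' := sub_eq_zero.1 (norm_le_zero_iff.1 (by rw [sub_self, norm_zero] at hxy; linarith))
    subst this; simp
  have hp : 0 < ‖x - y‖ := norm_pos_iff.2 (sub_ne_zero.2 hne)
  have hDK : Differentiable ℝ (fderiv ℝ K) :=
    (hK.contDiff_two.fderiv_right (m := 1) (by norm_num)).differentiable one_ne_zero
  have hab : (x - y) - (x' - y) = x - x' := by abel
  have h1 := norm_sub_le_of_fderiv_decay hDK hA (s := 2 + d) (by positivity)
    (fun z => by rw [neg_add']; exact hK.hess z) (a := x - y) (b := x' - y) (by rw [hab]; exact hxy)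
  rw [hab, neg_add'] at h1
  have h2 : ‖x - y‖ / 2 ≤ ‖x' - y‖ := by
    have : ‖x - y‖ ≤ ‖x - x'‖ + ‖x' - y‖ := by
      rw [← sub_add_sub_cancel x x' y]; exact norm_add_le _ _
    linarith
  have h3 : ‖x' - y‖ ^ (-1 - (d : ℝ)) ≤ 2 ^ (1 + (d : ℝ)) * ‖x - y‖ ^ (-1 - (d : ℝ)) := by
    have hd0 : (0 : ℝ) ≤ d := Nat.cast_nonneg d
    refine (Real.rpow_le_rpow_of_nonpos (by positivity) h2 (by linarith)).trans_eq ?_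
    rw [Real.div_rpow hp.le (by norm_num), show (-1 - (d : ℝ)) = -(1 + d) by ring,
      Real.rpow_neg (by norm_num : (0 : ℝ) ≤ 2), div_inv_eq_mul, mul_comm]
  have e : fderiv ℝ K (x - y) (η x - η y) - fderiv ℝ K (x' - y) (η x' - η y) =
      (fderiv ℝ K (x - y) - fderiv ℝ K (x' - y)) (η x - η y) +
        fderiv ℝ K (x' - y) (η x - η x') := by
    rw [sub_apply]; simp only [map_sub]; ring
  have b1 : |(fderiv ℝ K (x - y) - fderiv ℝ K (x' - y)) (η x - η y)| ≤
      A * 2 ^ (2 + (d : ℝ)) * ‖x - y‖ ^ (-2 - (d : ℝ)) * ‖x - x'‖ * (Mη * ‖x - y‖) :=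
    ((fderiv ℝ K (x - y) - fderiv ℝ K (x' - y)).le_opNorm _).trans
      (mul_le_mul h1 (hη.lipschitz x y) (norm_nonneg _) (by positivity))
  have b2 : |fderiv ℝ K (x' - y) (η x - η x')| ≤
      A * (2 ^ (1 + (d : ℝ)) * ‖x - y‖ ^ (-1 - (d : ℝ))) * (Mη * ‖x - x'‖) :=
    ((fderiv ℝ K (x' - y)).le_opNorm _).trans
      (mul_le_mul ((hK.grad _).trans (by gcongr)) (hη.lipschitz x x') (norm_nonneg _)
        (by positivity))
  have e2 : ‖x - y‖ ^ (-2 - (d : ℝ)) * ‖x - y‖ = ‖x - y‖ ^ (-1 - (d : ℝ)) := by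
    conv_lhs => rw [← Real.rpow_one ‖x - y‖, Real.rpow_one ‖x - y‖]
    nth_rewrite 2 [← Real.rpow_one ‖x - y‖]
    rw [← Real.rpow_add hp]; congr 1; ring
  rw [e]
  calc _ ≤ _ := abs_add_le _ _
    _ ≤ _ := add_le_add b1 b2
    _ = A * 2 ^ (2 + (d : ℝ)) * ‖x - x'‖ * Mη * (‖x - y‖ ^ (-2 - (d : ℝ)) * ‖x - y‖) +
        A * (2 ^ (1 + (d : ℝ)) * ‖x - y‖ ^ (-1 - (d : ℝ))) * (Mη * ‖x - x'‖) := by ring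
    _ = _ := by rw [e2]; ring

/-- A Hölder bound for the singular part of the commutator. -/
theorem exists_czC_holder (hd : 1 ≤ d) (A : ℝ) (hα0 : 0 < α) (hα1 : α < 1) :
    ∃ C : ℝ, 0 ≤ C ∧ ∀ K : Euc d → ℝ, IsCZTwo A K → ∀ (η : Euc d → Euc d) (Mη : ℝ), InC1a α Mη η →
      ∀ (f : Euc d → ℝ) (M : ℝ), InCa α M f → ∀ x x',
        ‖czC K η f x - czC K η f x'‖ ≤ C * Mη * M * ‖x - x'‖ ^ α := by
  obtain ⟨A₁, hA₁⟩ := exists_isCZ_localKernel hd A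
  set W := ∫ z : Euc d, remMajorant α z with hW
  have hW0 : 0 ≤ W := integral_nonneg fun z => remMajorant_nonneg α z
  have hh := holderConst_nonneg d hα0 hα1
  set D := d * d * (2 * |A₁|) + |A| * W with hD
  set R := (2 ^ (2 + (d : ℝ)) + 2 ^ (1 + (d : ℝ))) * |A| with hR
  have hD0 : 0 ≤ D := by positivity
  have hR0 : 0 ≤ R := by positivity
  refine ⟨holderConst d α * (|A| + R + D) + D +
    (holderConst d α * 2 ^ (d + 1) + 1) * |A| * d, by positivity, fun K hK η Mη hη f M hf x x' => ?_⟩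
  have hA := hK.nonneg
  have hM := hη.nonneg
  have hMf := hf.nonneg
  rw [abs_of_nonneg hA] at hD hR ⊢
  have hAL := hA₁ K hK
  have hA₁0 : 0 ≤ A₁ := by
    obtain ⟨i⟩ : Nonempty (Fin d) := ⟨⟨0, hd⟩⟩
    exact (hAL i i).nonneg
  rw [abs_of_nonneg hA₁0] at hD
  have hηc := hη.contDiff hα0
  have hfc := hf.continuous hα0
  have hNi := fun x => hK.integrable_kernel hηc.continuous x
  have hcanc : ∀ x r, 0 < r → |∫ y in {y | r ≤ ‖x - y‖}, fderiv ℝ K (x - y) (η x - η y)| ≤ D * Mη :=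
    fun x r hr => hD ▸ hK.abs_setIntegral_kernel_le hd hα0 hAL hη x fun i j =>
      (hAL i j).abs_setIntegral_far_le x hr
  have hn : ∀ x, |∫ y, fderiv ℝ K (x - y) (η x - η y)| ≤ D * Mη := fun x => by
    rw [← setIntegral_univ, hD]
    refine hK.abs_setIntegral_kernel_le hd hα0 hAL hη x fun i j => ?_
    rw [setIntegral_univ, integral_sub_left_eq_self (localKernel K i j) volume x]
    linarith [(hAL i j).abs_integral_le]
  have s := holder_singular hd hα0 hα1 (A := (A + R + D) * Mη) (M := M)
    (N := fun x y => fderiv ℝ K (x - y) (η x - η y)) (f := f) hNi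
    (fun x y => (hK.abs_kernel_le hη x y).trans (by gcongr; linarith))
    (fun x x' y h => (hK.abs_kernel_sub_kernel_le hη x x' y h).trans (by
      rw [← hR]; gcongr; linarith))
    (fun x r hr => (hcanc x r hr).trans (by gcongr; linarith)) hfc ⟨M, hf.1⟩ hf.2 x x'
  have hdiv := hη.inCa_divVec
  have t := czT_holder hd hα0 hα1 hK.toIsCZ (f := divVec η) (hdiv.continuous hα0) ⟨_, hdiv.1⟩
    hdiv.2 x x'
  have hn' : ∀ x, czT K (divVec η) x = -∫ y, fderiv ℝ K (x - y) (η x - η y) := fun x => by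
    rw [hK.integral_kernel_eq hηc, neg_neg]
  rw [hn', hn'] at t
  have e : ∀ x, czC K η f x = (∫ y, fderiv ℝ K (x - y) (η x - η y) * (f y - f x)) +
      f x * ∫ y, fderiv ℝ K (x - y) (η x - η y) := fun x => by
    rw [← integral_const_mul, ← integral_add, czC]
    · congr 1; ext y; ring
    · exact hK.integrable_fderiv_mul (hfc.sub continuous_const)
        (continuous_const.sub hηc.continuous) x
    · exact (hNi x).const_mul _
  have ex : czC K η f x - czC K η f x' =
      ((∫ y, fderiv ℝ K (x - y) (η x - η y) * (f y - f x)) -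
        ∫ y, fderiv ℝ K (x' - y) (η x' - η y) * (f y - f x')) +
      (f x - f x') * (∫ y, fderiv ℝ K (x - y) (η x - η y)) +
      f x' * ((∫ y, fderiv ℝ K (x - y) (η x - η y)) - ∫ y, fderiv ℝ K (x' - y) (η x' - η y)) := by
    rw [e, e]; ring
  have t' : |(∫ y, fderiv ℝ K (x - y) (η x - η y)) - ∫ y, fderiv ℝ K (x' - y) (η x' - η y)| ≤
      (holderConst d α * 2 ^ (d + 1) + 1) * A * (d * Mη) * ‖x - x'‖ ^ α := by
    rw [← abs_neg]; convert t using 2; ring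
  rw [ex]
  have b2 := mul_le_mul (hf.2 x x') (hn x) (abs_nonneg _) (by positivity)
  have b3 := mul_le_mul (hf.1 x') t' (abs_nonneg _) hMf
  rw [Real.norm_eq_abs, ← abs_mul] at b2 b3
  calc _ ≤ _ := norm_add₃_le
    _ ≤ _ := add_le_add (add_le_add s b2) b3
    _ = _ := by ring

/-- The singular part of the commutator is bounded on `C^{α,p}`. -/
theorem exists_inCap_czC (hd : 1 ≤ d) (A : ℝ) {p : ℝ} (hα0 : 0 < α) (hα1 : α < 1) (hp : 1 < p) :
    ∃ C : ℝ, 0 ≤ C ∧ ∀ K : Euc d → ℝ, IsCZTwo A K → ∀ (η : Euc d → Euc d) (Mη : ℝ), InC1a α Mη η →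
      ∀ (f : Euc d → ℝ) (M : ℝ), InCap α p M f → InCap α p (C * Mη * M) (czC K η f) := by
  obtain ⟨A₁, hA₁⟩ := exists_isCZ_localKernel hd A
  obtain ⟨C₁, hC₁0, hC₁⟩ := exists_czC_holder hd A hα0 hα1
  obtain ⟨C₂, hC₂0, hC₂⟩ := exists_inCap_czT hd A₁ hα0 hα1 hp
  set W := ∫ z : Euc d, remMajorant α z with hW
  have hW0 : 0 ≤ W := integral_nonneg fun z => remMajorant_nonneg α z
  refine ⟨C₁ + (d * d * (2 * C₂) + |A| * W), by positivity, fun K hK η Mη hη f M hf => ?_⟩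
  have hA := hK.nonneg
  have hM := hη.nonneg
  have hMf := hf.nonneg
  rw [abs_of_nonneg hA]
  have hfc := hf.continuous hα0
  have hηc := hη.contDiff hα0
  have hH := hC₁ K hK η Mη hη f M hf.1
  have hcc : Continuous (czC K η f) := continuous_of_holder hα0 hH
  set P : Euc d → ℝ := fun x => ∑ i, ∑ j, fderiv ℝ η x (Pi.single j 1) i *
    czT (localKernel K i j) f x with hPdef
  have hP : InCap α p (∑ _i : Fin d, ∑ _j : Fin d, 2 * Mη * (C₂ * M)) P :=
    InCap.sum hα0 hp.le _ fun i _ => InCap.sum hα0 hp.le _ fun j _ =>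
      InCap.mul (hη.inCa_coord (norm_single_one_le j) i) (hC₂ _ (hA₁ K hK i j) f M hf)
  have hR : ∀ x, czC K η f x - P x = ∫ y, (fderiv ℝ K (x - y) (η x - η y) -
      ∑ i, ∑ j, fderiv ℝ η x (Pi.single j 1) i * localKernel K i j (x - y)) * f y := by
    intro x
    have hLi : ∀ i j, Integrable fun y => fderiv ℝ η x (Pi.single j 1) i *
        (localKernel K i j (x - y) * f y) := fun i j =>
      ((hA₁ K hK i j).integrable_mul hfc.locallyIntegrable x).const_mul _
    have eP : P x = ∫ y, ∑ i, ∑ j, fderiv ℝ η x (Pi.single j 1) i *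
        (localKernel K i j (x - y) * f y) := by
      rw [integral_finsetSum _ fun i _ => integrable_finsetSum _ fun j _ => hLi i j]
      refine Finset.sum_congr rfl fun i _ => ?_
      rw [integral_finsetSum _ fun j _ => hLi i j]
      exact Finset.sum_congr rfl fun j _ => (integral_const_mul _ _).symm
    rw [eP, czC, ← integral_sub (hK.integrable_fderiv_mul hfc (u := fun y => η x - η y)
      (continuous_const.sub hηc.continuous) x)
      (integrable_finsetSum _ fun i _ => integrable_finsetSum _ fun j _ => hLi i j)]
    congr 1; ext y
    simp only [sub_mul, Finset.sum_mul, mul_assoc]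
  have hYoung := eLpNorm_le_of_enorm_le_lintegral hp (w := fun z => A * Mη * remMajorant α z)
    (u := fun x => czC K η f x - P x) (f := f) ((measurable_remMajorant α).const_mul _)
    ((integrable_remMajorant hd hα0).const_mul _)
    (fun z => mul_nonneg (by positivity) (remMajorant_nonneg _ _)) hfc (fun x => by
      simp only [hR]
      refine (enorm_integral_le_lintegral_enorm _).trans (lintegral_mono fun y => ?_)
      rw [enorm_mul]
      gcongr
      rw [enorm_le_iff_norm_le, Real.norm_of_nonneg (r := A * Mη * remMajorant α (x - y))
        (mul_nonneg (by positivity) (remMajorant_nonneg _ _))]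
      exact hK.abs_kernel_sub_le hα0 hη x y)
  rw [integral_const_mul] at hYoung
  have hLp : eLpNorm (czC K η f) (ENNReal.ofReal p) volume ≤
      ENNReal.ofReal ((d * d * (2 * C₂) + A * W) * Mη * M) := by
    have e : czC K η f = P + fun x => czC K η f x - P x := by ext x; simp
    rw [e]
    refine (eLpNorm_add_le (hP.continuous hα0).aestronglyMeasurable
      (hcc.sub (hP.continuous hα0)).aestronglyMeasurable
      (by rw [ENNReal.one_le_ofReal]; exact hp.le)).trans ?_
    refine (add_le_add hP.2 (hYoung.trans (mul_le_mul_right hf.2 _))).trans ?_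
    rw [← ENNReal.ofReal_mul (by positivity), ← ENNReal.ofReal_add (by positivity) (by positivity)]
    refine ENNReal.ofReal_le_ofReal (le_of_eq ?_)
    simp; ring
  exact (inCap_of_holder hα0 hp.le (by positivity) (by positivity) hH hLp).mono (by nlinarith)

/-- The commutator of `η · ∇` with convolution by a truncated kernel. -/
theorem exists_inCap_commutator (hd : 1 ≤ d) (A : ℝ) {p : ℝ} (hα0 : 0 < α) (hα1 : α < 1)
    (hp : 1 < p) :
    ∃ C : ℝ, 0 ≤ C ∧ ∀ K : Euc d → ℝ, IsCZTwo A K → ∀ (η : Euc d → Euc d) (Mη : ℝ), InC1a α Mη η →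
      ∀ (f : Euc d → ℝ) (M : ℝ), ContDiff ℝ 1 f → InCap α p M f → InCap α p (C * Mη * M)
        (fun x => fderiv ℝ (czT K f) x (η x) - czT K (fun y => fderiv ℝ f y (η y)) x) := by
  obtain ⟨C₁, hC₁0, hC₁⟩ := exists_inCap_czC hd A hα0 hα1 hp
  obtain ⟨C₂, hC₂0, hC₂⟩ := exists_inCap_czT hd A hα0 hα1 hp
  refine ⟨C₁ + C₂ * (2 * d), by positivity, fun K hK η Mη hη f M hf hfM => ?_⟩
  rw [show (fun x => fderiv ℝ (czT K f) x (η x) - czT K (fun y => fderiv ℝ f y (η y)) x) =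
    fun x => czC K η f x + czT K (fun y => divVec η y * f y) x from
      funext fun x => hK.commutator_eq hf (hη.contDiff hα0) x]
  refine (InCap.add hα0 hp.le (hC₁ K hK η Mη hη f M hfM)
    (hC₂ K hK.toIsCZ _ _ (InCap.mul hη.inCa_divVec hfM))).mono (le_of_eq ?_)
  ring

end

section
variable {d : ℕ} {A B : ℝ} {k χ : Euc d → ℝ}

theorem fderiv_smul_of_homogeneous {F : Type*} [NormedAddCommGroup F] [NormedSpace ℝ F]
    {G : Euc d → F} {s : ℝ} (hG : ∀ c : ℝ, 0 < c → ∀ z, z ≠ 0 → G (c • z) = c ^ s • G z)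
    {c : ℝ} (hc : 0 < c) {z : Euc d} (hz : z ≠ 0) :
    fderiv ℝ G (c • z) = c ^ (s - 1) • fderiv ℝ G z := by
  have h1 : (fun w => G (c • w)) =ᶠ[𝓝 z] c ^ s • G := by
    filter_upwards [isOpen_ne.mem_nhds hz] with w hw
    exact hG c hc w hw
  have h2 := h1.fderiv_eq (𝕜 := ℝ)
  rw [fderiv_comp_smul, fderiv_const_smul_field] at h2
  have h3 : c⁻¹ • c • fderiv ℝ G (c • z) = c⁻¹ • (c ^ s • fderiv ℝ G) z := by rw [h2]
  rw [inv_smul_smul₀ hc.ne'] at h3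
  rw [h3, Pi.smul_apply, smul_smul, Real.rpow_sub_one hc.ne', div_eq_inv_mul]

theorem exists_norm_le_of_homogeneous {F : Type*} [NormedAddCommGroup F] [NormedSpace ℝ F]
    {G : Euc d → F} {s : ℝ} (hG : ∀ c : ℝ, 0 < c → ∀ z, z ≠ 0 → G (c • z) = c ^ s • G z)
    (hc : ContinuousOn G {z | z ≠ 0}) :
    ∃ A : ℝ, 0 ≤ A ∧ ∀ z, z ≠ 0 → ‖G z‖ ≤ A * ‖z‖ ^ s := by
  obtain ⟨A, hA⟩ := (isCompact_sphere (0 : Euc d) 1).exists_bound_of_continuousOn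
    (hc.mono fun z hz => Metric.ne_of_mem_sphere hz one_ne_zero)
  refine ⟨|A|, abs_nonneg A, fun z hz => ?_⟩
  have hp : 0 < ‖z‖ := norm_pos_iff.2 hz
  have h1 : ‖z‖ • (‖z‖⁻¹ • z) = z := smul_inv_smul₀ hp.ne' z
  have h2 : ‖(‖z‖⁻¹ • z)‖ = 1 := by
    rw [norm_smul, norm_inv, norm_norm, inv_mul_cancel₀ hp.ne']
  have h3 : ‖z‖⁻¹ • z ≠ 0 := norm_ne_zero_iff.1 (by rw [h2]; exact one_ne_zero)
  rw [← h1, hG _ hp _ h3, h1, norm_smul, Real.norm_of_nonneg (by positivity), mul_comm]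
  gcongr
  exact (hA _ (by simpa using h2)).trans (le_abs_self A)

/-- A smooth convolution kernel, homogeneous of degree `-d` and with mean zero on annuli. -/
structure IsHomKernel (k : Euc d → ℝ) : Prop where
  contDiffOn : ContDiffOn ℝ (⊤ : ℕ∞) k {x | x ≠ 0}
  hom : ∀ c : ℝ, 0 < c → ∀ x, x ≠ 0 → k (c • x) = c ^ (-(d : ℝ)) * k x
  mean : ∀ r₁ r₂ : ℝ, 0 < r₁ → r₁ ≤ r₂ → ∫ z in {z : Euc d | r₁ ≤ ‖z‖ ∧ ‖z‖ ≤ r₂}, k z = 0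

/-- Size bounds for a homogeneous kernel and its first two derivatives. -/
structure HomBound (A : ℝ) (k : Euc d → ℝ) : Prop where
  nonneg : 0 ≤ A
  size : ∀ z, z ≠ 0 → |k z| ≤ A * ‖z‖ ^ (-(d : ℝ))
  grad : ∀ z, z ≠ 0 → ‖fderiv ℝ k z‖ ≤ A * ‖z‖ ^ (-1 - (d : ℝ))
  hess : ∀ z, z ≠ 0 → ‖fderiv ℝ (fderiv ℝ k) z‖ ≤ A * ‖z‖ ^ (-2 - (d : ℝ))

theorem IsHomKernel.exists_homBound (hk : IsHomKernel k) : ∃ A, HomBound A k := by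
  have ho : IsOpen {x : Euc d | x ≠ 0} := isOpen_ne
  have g0 : ∀ c : ℝ, 0 < c → ∀ z, z ≠ 0 → k (c • z) = c ^ (-(d : ℝ)) • k z := hk.hom
  have g1 := fun (c : ℝ) (hc : 0 < c) (z : Euc d) (hz : z ≠ 0) =>
    fderiv_smul_of_homogeneous g0 hc hz
  have g2 := fun (c : ℝ) (hc : 0 < c) (z : Euc d) (hz : z ≠ 0) =>
    fderiv_smul_of_homogeneous (G := fderiv ℝ k) g1 hc hz
  have c1 : ContDiffOn ℝ 1 (fderiv ℝ k) {x | x ≠ 0} :=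
    hk.contDiffOn.fderiv_of_isOpen ho (by norm_cast)
  obtain ⟨A0, h0, b0⟩ := exists_norm_le_of_homogeneous g0 hk.contDiffOn.continuousOn
  obtain ⟨A1, h1, b1⟩ := exists_norm_le_of_homogeneous g1 c1.continuousOn
  obtain ⟨A2, h2, b2⟩ := exists_norm_le_of_homogeneous g2 (c1.continuousOn_fderiv_of_isOpen ho le_rfl)
  refine ⟨A0 + A1 + A2, by positivity, fun z hz => (b0 z hz).trans ?_, fun z hz => ?_,
    fun z hz => ?_⟩
  · gcongr; linarith
  · refine (b1 z hz).trans ?_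
    rw [show -(d : ℝ) - 1 = -1 - d by ring]; gcongr; linarith
  · refine (b2 z hz).trans ?_
    rw [show -(d : ℝ) - 1 - 1 = -2 - d by ring]; gcongr; linarith

theorem norm_fderiv_smul_fun_le {E F : Type*} [NormedAddCommGroup E] [NormedSpace ℝ E]
    [NormedAddCommGroup F] [NormedSpace ℝ F] {a : E → ℝ} {G : E → F} {z : E}
    (ha : DifferentiableAt ℝ a z) (hG : DifferentiableAt ℝ G z) :
    ‖fderiv ℝ (fun w => a w • G w) z‖ ≤ |a z| * ‖fderiv ℝ G z‖ + ‖fderiv ℝ a z‖ * ‖G z‖ := by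
  rw [fderiv_fun_smul ha hG]
  refine (norm_add_le _ _).trans ?_
  rw [ContinuousLinearMap.norm_smulRight_apply, norm_smul, Real.norm_eq_abs]

theorem norm_fderiv_fun_sub_le {E F : Type*} [NormedAddCommGroup E] [NormedSpace ℝ E]
    [NormedAddCommGroup F] [NormedSpace ℝ F] {G H : E → F} {z : E}
    (hG : DifferentiableAt ℝ G z) (hH : DifferentiableAt ℝ H z) :
    ‖fderiv ℝ (fun w => G w - H w) z‖ ≤ ‖fderiv ℝ G z‖ + ‖fderiv ℝ H z‖ := by
  rw [fderiv_fun_sub hG hH]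
  exact norm_sub_le _ _

theorem norm_fderiv_eq_zero_of_eventuallyEq {E F : Type*} [NormedAddCommGroup E]
    [NormedSpace ℝ E] [NormedAddCommGroup F] [NormedSpace ℝ F] {G : E → F} {z : E}
    (hG : G =ᶠ[𝓝 z] fun _ => 0) : ‖fderiv ℝ G z‖ = 0 := by
  rw [hG.fderiv_eq]
  simp

theorem norm_fderiv_fderiv_mul_le {E : Type*} [NormedAddCommGroup E] [NormedSpace ℝ E]
    {a b : E → ℝ} {z : E} (ha : ContDiffAt ℝ 2 a z) (hb : ContDiffAt ℝ 2 b z) :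
    ‖fderiv ℝ (fderiv ℝ fun w => a w * b w) z‖ ≤
      |a z| * ‖fderiv ℝ (fderiv ℝ b) z‖ + 2 * (‖fderiv ℝ a z‖ * ‖fderiv ℝ b z‖) +
        |b z| * ‖fderiv ℝ (fderiv ℝ a) z‖ := by
  have hda := (ha.fderiv_right (m := 1) (by norm_num)).differentiableAt one_ne_zero
  have hdb := (hb.fderiv_right (m := 1) (by norm_num)).differentiableAt one_ne_zero
  have ha1 := ha.differentiableAt two_ne_zero
  have hb1 := hb.differentiableAt two_ne_zero
  have h : (fderiv ℝ fun w => a w * b w) =ᶠ[𝓝 z]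
      fun w => a w • fderiv ℝ b w + b w • fderiv ℝ a w := by
    filter_upwards [ha.eventually (by norm_num), hb.eventually (by norm_num)] with w h1 h2
    exact fderiv_fun_mul (h1.differentiableAt two_ne_zero) (h2.differentiableAt two_ne_zero)
  rw [h.fderiv_eq, fderiv_fun_add (ha1.fun_smul hdb) (hb1.fun_smul hda)]
  calc _ ≤ _ := norm_add_le _ _
    _ ≤ _ := add_le_add (norm_fderiv_smul_fun_le ha1 hdb) (norm_fderiv_smul_fun_le hb1 hda)
    _ = _ := by ring

theorem IsHomKernel.contDiffAt (hk : IsHomKernel k) {z : Euc d} (hz : z ≠ 0) :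
    ContDiffAt ℝ 2 k z :=
  ((hk.contDiffOn.contDiffAt (isOpen_ne.mem_nhds hz))).of_le (by norm_cast)

theorem IsHomKernel.contDiff_mul (hk : IsHomKernel k) (hχ : IsSymbol B χ)
    (h0 : χ =ᶠ[𝓝 0] fun _ => 0) : ContDiff ℝ 2 fun z => χ z * k z := by
  refine contDiff_iff_contDiffAt.2 fun z => ?_
  rcases eq_or_ne z 0 with rfl | hz
  · refine (contDiffAt_const (c := (0 : ℝ))).congr_of_eventuallyEq ?_
    filter_upwards [h0] with w hw
    rw [hw, zero_mul]
  · exact hχ.contDiff.contDiffAt.mul (hk.contDiffAt hz)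

theorem fderiv_mul_eventuallyEq_zero (h0 : χ =ᶠ[𝓝 0] fun _ => 0) :
    (fderiv ℝ fun z => χ z * k z) =ᶠ[𝓝 0] fun _ => 0 := by
  have : (fun z => χ z * k z) =ᶠ[𝓝 0] fun _ => 0 := by
    filter_upwards [h0] with w hw
    rw [hw, zero_mul]
  filter_upwards [this.fderiv (𝕜 := ℝ)] with w hw
  rw [hw]; simp

theorem HomBound.fderiv_mul_le (hA : HomBound A k) (hk : IsHomKernel k) (hχ : IsSymbol B χ)
    (hB : 0 ≤ B) (h0 : χ =ᶠ[𝓝 0] fun _ => 0) (z : Euc d) :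
    ‖fderiv ℝ (fun z => χ z * k z) z‖ ≤ 4 * A * B * ‖z‖ ^ (-1 - (d : ℝ)) := by
  have hA0 := hA.nonneg
  rcases eq_or_ne z 0 with rfl | hz
  · rw [(fderiv_mul_eventuallyEq_zero h0).eq_of_nhds, norm_zero]; positivity
  have hp := norm_pos_iff.2 hz
  have h := norm_fderiv_smul_fun_le (hχ.contDiff.contDiffAt.differentiableAt two_ne_zero)
    ((hk.contDiffAt hz).differentiableAt two_ne_zero)
  simp only [smul_eq_mul] at h
  have e : ‖z‖ ^ (-1 : ℝ) * ‖z‖ ^ (-(d : ℝ)) = ‖z‖ ^ (-1 - (d : ℝ)) := by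
    rw [← Real.rpow_add hp]; rfl
  calc _ ≤ _ := h
    _ ≤ B * (A * ‖z‖ ^ (-1 - (d : ℝ))) + B * ‖z‖ ^ (-1 : ℝ) * (A * ‖z‖ ^ (-(d : ℝ))) := by
        gcongr
        exacts [hχ.size z, hA.grad z hz, hχ.grad z hz, hA.size z hz]
    _ = B * A * ‖z‖ ^ (-1 - (d : ℝ)) + B * A * (‖z‖ ^ (-1 : ℝ) * ‖z‖ ^ (-(d : ℝ))) := by ring
    _ ≤ _ := by
        rw [e]
        have : 0 ≤ A * B * ‖z‖ ^ (-1 - (d : ℝ)) := by positivity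
        linarith

theorem HomBound.fderiv_fderiv_mul_le (hA : HomBound A k) (hk : IsHomKernel k) (hχ : IsSymbol B χ)
    (hB : 0 ≤ B) (h0 : χ =ᶠ[𝓝 0] fun _ => 0) (z : Euc d) :
    ‖fderiv ℝ (fderiv ℝ fun z => χ z * k z) z‖ ≤ 4 * A * B * ‖z‖ ^ (-2 - (d : ℝ)) := by
  have hA0 := hA.nonneg
  rcases eq_or_ne z 0 with rfl | hz
  · rw [norm_fderiv_eq_zero_of_eventuallyEq (fderiv_mul_eventuallyEq_zero h0)]; positivity
  have hp := norm_pos_iff.2 hz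
  have e1 : ‖z‖ ^ (-1 : ℝ) * ‖z‖ ^ (-1 - (d : ℝ)) = ‖z‖ ^ (-2 - (d : ℝ)) := by
    rw [← Real.rpow_add hp]; congr 1; ring
  have e2 : ‖z‖ ^ (-(d : ℝ)) * ‖z‖ ^ (-2 : ℝ) = ‖z‖ ^ (-2 - (d : ℝ)) := by
    rw [← Real.rpow_add hp]; congr 1; ring
  calc _ ≤ _ := norm_fderiv_fderiv_mul_le hχ.contDiff.contDiffAt (hk.contDiffAt hz)
    _ ≤ B * (A * ‖z‖ ^ (-2 - (d : ℝ))) + 2 * (B * ‖z‖ ^ (-1 : ℝ) * (A * ‖z‖ ^ (-1 - (d : ℝ)))) +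
        A * ‖z‖ ^ (-(d : ℝ)) * (B * ‖z‖ ^ (-2 : ℝ)) := by
        gcongr
        exacts [hχ.size z, hA.hess z hz, hχ.grad z hz, hA.grad z hz, hA.size z hz, hχ.hess z hz]
    _ = B * (A * ‖z‖ ^ (-2 - (d : ℝ))) +
        2 * (B * A * (‖z‖ ^ (-1 : ℝ) * ‖z‖ ^ (-1 - (d : ℝ)))) +
        A * B * (‖z‖ ^ (-(d : ℝ)) * ‖z‖ ^ (-2 : ℝ)) := by ring
    _ = _ := by rw [e1, e2]; ring

theorem IsSymbol.sub {B' : ℝ} {χ' : Euc d → ℝ} (h : IsSymbol B χ) (h' : IsSymbol B' χ') :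
    IsSymbol (B + B') (fun z => χ z - χ' z) := by
  have hd := h.contDiff.differentiable two_ne_zero
  have hd' := h'.contDiff.differentiable two_ne_zero
  have hD := (h.contDiff.fderiv_right (m := 1) (by norm_num)).differentiable one_ne_zero
  have hD' := (h'.contDiff.fderiv_right (m := 1) (by norm_num)).differentiable one_ne_zero
  have e : fderiv ℝ (fun z => χ z - χ' z) = fun z => fderiv ℝ χ z - fderiv ℝ χ' z :=
    funext fun z => fderiv_fun_sub (hd z) (hd' z)
  refine ⟨h.contDiff.sub h'.contDiff, fun z => ?_, fun z hz => ?_, fun z hz => ?_⟩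
  · exact (abs_sub _ _).trans (add_le_add (h.size z) (h'.size z))
  · rw [e, add_mul]
    exact (norm_sub_le _ _).trans (add_le_add (h.grad z hz) (h'.grad z hz))
  · rw [e, add_mul]
    exact (norm_fderiv_fun_sub_le (hD z) (hD' z)).trans (add_le_add (h.hess z hz) (h'.hess z hz))

theorem abs_setIntegral_le_of_annulus (hd : 1 ≤ d) {a b : ℝ} (ha : 0 < a) (hb : 0 < b) (hA : 0 ≤ A)
    {g : Euc d → ℝ} {S : Set (Euc d)} (hS : MeasurableSet S)
    (hg : ∀ z ∈ S, |g z| ≤ A * ‖z‖ ^ (-(d : ℝ)))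
    (hg0 : ∀ z ∈ S, ‖z‖ < a ∨ b < ‖z‖ → g z = 0) :
    |∫ z in S, g z| ≤ A * (radConst d * (b / a)) := by
  have hm : MeasurableSet (S ∩ {z : Euc d | a ≤ ‖z‖ ∧ ‖z‖ ≤ b}) :=
    hS.inter ((measurableSet_le measurable_const measurable_norm).inter
      (measurableSet_le measurable_norm measurable_const))
  rw [setIntegral_eq_of_subset_of_forall_sdiff_eq_zero hS
    (inter_subset_left : S ∩ {z : Euc d | a ≤ ‖z‖ ∧ ‖z‖ ≤ b} ⊆ S)]
  · rw [← Real.norm_eq_abs]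
    exact norm_setIntegral_annulus_le hd ha hb hA 0 hm (fun y hy => by simpa using hy.2.1)
      (fun y hy => by simpa using hy.2.2) (fun y hy => by simpa using hg y hy.1)
  · rintro z ⟨hz, hz'⟩
    refine hg0 z hz ?_
    by_contra hcon
    push Not at hcon
    exact hz' ⟨hz, hcon⟩

theorem IsHomKernel.integral_annulus_ball (hd : 1 ≤ d) (hk : IsHomKernel k) {a b s : ℝ} (ha : 0 < a)
    (hab : a ≤ b) : ∫ z in {z : Euc d | (a ≤ ‖z‖ ∧ ‖z‖ ≤ b) ∧ ‖z‖ < s}, k z = 0 := by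
  have := nontrivial_euc hd
  rcases lt_or_ge b s with h | h
  · rw [show {z : Euc d | (a ≤ ‖z‖ ∧ ‖z‖ ≤ b) ∧ ‖z‖ < s} = {z : Euc d | a ≤ ‖z‖ ∧ ‖z‖ ≤ b} by
      ext z; exact ⟨fun h => h.1, fun h' => ⟨h', h'.2.trans_lt h⟩⟩]
    exact hk.mean a b ha hab
  rcases lt_or_ge s a with h' | h'
  · rw [show {z : Euc d | (a ≤ ‖z‖ ∧ ‖z‖ ≤ b) ∧ ‖z‖ < s} = ∅ by
      ext z; simp only [mem_ofPred_eq, mem_empty_iff_false, iff_false]; rintro ⟨⟨h1, _⟩, h2⟩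
      linarith]
    simp
  · rw [← hk.mean a s ha h']
    refine setIntegral_congr_set ?_
    have hs := Measure.addHaar_sphere (volume : Measure (Euc d)) 0 s
    have hae : ∀ᵐ z : Euc d, z ∉ Metric.sphere (0 : Euc d) s := measure_eq_zero_iff_ae_notMem.1 hs
    filter_upwards [hae] with z hz
    have hz' : ‖z‖ ≠ s := by simpa using hz
    refine propext ⟨fun h1 => ⟨h1.1.1, h1.2.le⟩, fun h1 => ⟨⟨h1.1, h1.2.trans h⟩, lt_of_le_of_ne h1.2 hz'⟩⟩

/-- The kernel `k` truncated smoothly to `(n+1)⁻¹ ≲ ‖z‖ ≲ n+1`. -/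
def truncKernel (k : Euc d → ℝ) (n : ℕ) (z : Euc d) : ℝ :=
  (smoothCut (n + 1) z - smoothCut ((2 * (n + 1))⁻¹) z) * k z

theorem truncKernel_eq_self (k : Euc d → ℝ) {n : ℕ} {z : Euc d} (h1 : ((n : ℝ) + 1)⁻¹ ≤ ‖z‖)
    (h2 : ‖z‖ ≤ n + 1) : truncKernel k n z = k z := by
  have e : 2 * (2 * ((n : ℝ) + 1))⁻¹ = ((n : ℝ) + 1)⁻¹ := by field_simp
  rw [truncKernel, smoothCut_eq_one (by positivity) h2,
    smoothCut_eq_zero (by positivity) (by rw [e]; exact h1), sub_zero, one_mul]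

theorem truncKernel_near (k : Euc d → ℝ) {n : ℕ} {z : Euc d} (h : ‖z‖ ≤ (2 * ((n : ℝ) + 1))⁻¹) :
    truncKernel k n z = 0 := by
  have hn : (0 : ℝ) ≤ n := n.cast_nonneg
  have : (2 * ((n : ℝ) + 1))⁻¹ ≤ n + 1 := by
    rw [inv_le_iff_one_le_mul₀ (by positivity)]; nlinarith
  rw [truncKernel, smoothCut_eq_one (by positivity) (h.trans this),
    smoothCut_eq_one (by positivity) h, sub_self, zero_mul]

theorem truncKernel_far (k : Euc d → ℝ) {n : ℕ} {z : Euc d} (h : 2 * ((n : ℝ) + 1) ≤ ‖z‖) :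
    truncKernel k n z = 0 := by
  have hn : (0 : ℝ) ≤ n := n.cast_nonneg
  have : 2 * (2 * ((n : ℝ) + 1))⁻¹ ≤ 2 * ((n : ℝ) + 1) := by
    gcongr
    rw [inv_le_iff_one_le_mul₀ (by positivity)]; nlinarith
  rw [truncKernel, smoothCut_eq_zero (by positivity) h,
    smoothCut_eq_zero (by positivity) (this.trans h), sub_self, zero_mul]

theorem HomBound.abs_truncKernel_le (hA : HomBound A k) (n : ℕ) (z : Euc d) :
    |truncKernel k n z| ≤ A * ‖z‖ ^ (-(d : ℝ)) := by
  have hA0 := hA.nonneg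
  rcases eq_or_ne z 0 with rfl | hz
  · rw [truncKernel_near k (by rw [norm_zero]; positivity), abs_zero]; positivity
  rw [truncKernel, abs_mul]
  refine (mul_le_of_le_one_left (abs_nonneg _) ?_).trans (hA.size z hz)
  have := smoothCut_nonneg ((n : ℝ) + 1) z
  have := smoothCut_nonneg ((2 * ((n : ℝ) + 1))⁻¹) z
  have := smoothCut_le_one ((n : ℝ) + 1) z
  have := smoothCut_le_one ((2 * ((n : ℝ) + 1))⁻¹) z
  rw [abs_le]; constructor <;> linarith

/-- The truncated kernels satisfy Calderón–Zygmund bounds uniformly in the truncation. -/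
theorem IsHomKernel.exists_isCZTwo (hd : 1 ≤ d) (hk : IsHomKernel k) :
    ∃ A, HomBound A k ∧ ∀ n, IsCZTwo A (truncKernel k n) := by
  obtain ⟨A, hA⟩ := hk.exists_homBound
  obtain ⟨B, hB, hχ⟩ := exists_isSymbol_smoothCut d
  have hA0 := hA.nonneg
  have hrc := radConst_nonneg d
  have hle : A ≤ A + 4 * A * (B + B) + 4 * A * radConst d := by
    have : 0 ≤ 4 * A * (B + B) := by positivity
    have : 0 ≤ 4 * A * radConst d := by positivity
    linarith
  have hle2 : 4 * A * (B + B) ≤ A + 4 * A * (B + B) + 4 * A * radConst d := by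
    have : 0 ≤ 4 * A * radConst d := by positivity
    linarith
  have hle3 : 4 * A * radConst d ≤ A + 4 * A * (B + B) + 4 * A * radConst d := by
    have : 0 ≤ 4 * A * (B + B) := by positivity
    linarith
  refine ⟨A + 4 * A * (B + B) + 4 * A * radConst d, ⟨by positivity,
    fun z hz => (hA.size z hz).trans (by gcongr), fun z hz => (hA.grad z hz).trans (by gcongr),
    fun z hz => (hA.hess z hz).trans (by gcongr)⟩, fun n => ?_⟩
  have hn1 : 0 < (n : ℝ) + 1 := by positivity
  have hn2 : 0 < (2 * ((n : ℝ) + 1))⁻¹ := by positivity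
  have hn3 : ((n : ℝ) + 1)⁻¹ ≤ n + 1 := by
    rw [inv_le_iff_one_le_mul₀ hn1]; nlinarith [(n.cast_nonneg : (0 : ℝ) ≤ n)]
  have hs := (hχ _ hn1).sub (hχ _ hn2)
  have h0 : (fun z : Euc d => smoothCut ((n : ℝ) + 1) z - smoothCut ((2 * ((n : ℝ) + 1))⁻¹) z)
      =ᶠ[𝓝 0] fun _ => 0 := by
    filter_upwards [Metric.ball_mem_nhds (0 : Euc d) hn2] with z hz
    rw [mem_ball_zero_iff] at hz
    have : (2 * ((n : ℝ) + 1))⁻¹ ≤ n + 1 := by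
      rw [inv_le_iff_one_le_mul₀ (by positivity)]; nlinarith [(n.cast_nonneg : (0 : ℝ) ≤ n)]
    rw [smoothCut_eq_one hn1 (hz.le.trans this), smoothCut_eq_one hn2 hz.le, sub_self]
  have hc2 : ContDiff ℝ 2 (truncKernel k n) := hk.contDiff_mul hs h0
  have hcs : HasCompactSupport (truncKernel k n) := by
    refine HasCompactSupport.intro (isCompact_closedBall (0 : Euc d) (2 * ((n : ℝ) + 1))) ?_
    intro z hz
    exact truncKernel_far k (by simpa using (not_le.1 (by simpa using hz)).le)
  have hInt := hc2.continuous.integrable_of_hasCompactSupport hcs (μ := volume)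
  refine ⟨⟨hc2.of_le (by norm_num), hcs, fun z => (hA.abs_truncKernel_le n z).trans (by gcongr),
    fun z => (hA.fderiv_mul_le hk hs (by positivity) h0 z).trans (by gcongr), fun r hr => ?_⟩, hc2,
    fun z => (hA.fderiv_fderiv_mul_le hk hs (by positivity) h0 z).trans (by gcongr)⟩
  have m0 : MeasurableSet {z : Euc d | ‖z‖ < r} := measurableSet_lt measurable_norm measurable_const
  have m1 : MeasurableSet {z : Euc d | ‖z‖ < ((n : ℝ) + 1)⁻¹} :=
    measurableSet_lt measurable_norm measurable_const
  have m2 : MeasurableSet {z : Euc d | ‖z‖ ≤ (n : ℝ) + 1} :=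
    measurableSet_le measurable_norm measurable_const
  have s1 := integral_inter_add_sdiff (s := {z : Euc d | ‖z‖ < r}) m1 hInt.integrableOn
  have s2 := integral_inter_add_sdiff (s := {z : Euc d | ‖z‖ < r} \ {z : Euc d | ‖z‖ < ((n : ℝ) + 1)⁻¹})
    m2 hInt.integrableOn
  have b1 := abs_setIntegral_le_of_annulus hd hn2 (inv_pos.2 hn1) hA0 (m0.inter m1)
    (g := truncKernel k n) (fun z _ => hA.abs_truncKernel_le n z) (fun z hz h => by
      rcases h with h | h
      · exact truncKernel_near k h.le
      · exact absurd hz.2 (not_lt.2 h.le))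
  have b3 := abs_setIntegral_le_of_annulus hd hn1 (b := 2 * ((n : ℝ) + 1)) (by positivity) hA0
    ((m0.diff m1).diff m2)
    (g := truncKernel k n) (fun z _ => hA.abs_truncKernel_le n z) (fun z hz h => by
      rcases h with h | h
      · exact absurd h.le hz.2
      · exact truncKernel_far k h.le)
  have b2 : ∫ z in ({z : Euc d | ‖z‖ < r} \ {z : Euc d | ‖z‖ < ((n : ℝ) + 1)⁻¹}) ∩
      {z : Euc d | ‖z‖ ≤ (n : ℝ) + 1}, truncKernel k n z = 0 := by
    rw [← hk.integral_annulus_ball hd (s := r) (inv_pos.2 hn1) hn3]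
    have e : ({z : Euc d | ‖z‖ < r} \ {z : Euc d | ‖z‖ < ((n : ℝ) + 1)⁻¹}) ∩
      {z : Euc d | ‖z‖ ≤ (n : ℝ) + 1} =
        {z : Euc d | (((n : ℝ) + 1)⁻¹ ≤ ‖z‖ ∧ ‖z‖ ≤ (n : ℝ) + 1) ∧ ‖z‖ < r} := by
      ext z; simp; tauto
    rw [e] 
    refine setIntegral_congr_fun (e ▸ (m0.diff m1).inter m2) fun z hz => ?_
    exact truncKernel_eq_self k hz.1.1 hz.1.2
  rw [b2] at s2
  have e1 : ((n : ℝ) + 1)⁻¹ / (2 * ((n : ℝ) + 1))⁻¹ = 2 := by field_simp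
  have e2 : 2 * ((n : ℝ) + 1) / ((n : ℝ) + 1) = 2 := by field_simp
  rw [e1] at b1
  rw [e2] at b3
  refine le_trans ?_ hle3
  rw [abs_le] at b1 b3 ⊢
  constructor <;> linarith [b1.1, b1.2, b3.1, b3.2]

end

section
variable {d : ℕ} {A α p M : ℝ} {k g : Euc d → ℝ}

/-- The principal value convolution with `k`, with the singularity regularized explicitly. -/
def pvOp (k g : Euc d → ℝ) (x : Euc d) : ℝ :=
  (∫ y in {y | ‖x - y‖ < 1}, k (x - y) * (g y - g x)) + ∫ y in {y | 1 ≤ ‖x - y‖}, k (x - y) * g y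

/-- The smoothly truncated approximations of `pvOp k`. -/
def truncOp (k : Euc d → ℝ) (n : ℕ) (g : Euc d → ℝ) (x : Euc d) : ℝ :=
  czT (truncKernel k n) g x - (∫ z in {z : Euc d | ‖z‖ < 1}, truncKernel k n z) * g x

theorem eventually_truncKernel_eq (k : Euc d → ℝ) {z : Euc d} (hz : z ≠ 0) :
    ∀ᶠ n in atTop, truncKernel k n z = k z := by
  have hp : 0 < ‖z‖ := norm_pos_iff.2 hz
  obtain ⟨N, hN⟩ := exists_nat_ge (max ‖z‖ ‖z‖⁻¹)
  filter_upwards [eventually_ge_atTop N] with n hn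
  have hn' : (N : ℝ) ≤ n := by exact_mod_cast hn
  have h1 := (le_max_left _ _).trans hN
  have h2 := (le_max_right _ _).trans hN
  refine truncKernel_eq_self k ?_ (by linarith)
  rw [inv_le_comm₀ (by positivity) hp]
  linarith

theorem IsHomKernel.aestronglyMeasurable_comp (hd : 1 ≤ d) (hk : IsHomKernel k) (x : Euc d)
    {μ : Measure (Euc d)} (hμ : μ ≪ volume) : AEStronglyMeasurable (fun y => k (x - y)) μ := by
  have := nontrivial_euc hd
  obtain ⟨A, -, hA⟩ := hk.exists_isCZTwo hd
  refine AEStronglyMeasurable.mono_ac hμ ?_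
  refine aestronglyMeasurable_of_tendsto_ae atTop (f := fun n y => truncKernel k n (x - y))
    (fun n => ((hA n).contDiff.continuous.comp
      (continuous_const.sub continuous_id)).aestronglyMeasurable) ?_
  have : ∀ᵐ y : Euc d, y ≠ x := by
    simp [ae_iff]
  filter_upwards [this] with y hy
  exact tendsto_const_nhds.congr' ((eventually_truncKernel_eq k
    (sub_ne_zero.2 hy.symm)).mono fun n hn => hn.symm)

theorem integrableOn_norm_rpow_mul_far (hd : 1 ≤ d) (hp : 1 < p)
    (hg : MemLp g (ENNReal.ofReal p) volume) (x : Euc d) :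
    IntegrableOn (fun y => ‖x - y‖ ^ (-(d : ℝ)) * g y) {y | 1 ≤ ‖x - y‖} := by
  have hq := Real.HolderConjugate.conjExponent hp
  set q := p.conjExponent with hqdef
  have hq1 : 1 < q := hq.symm.lt
  have hd' : (1 : ℝ) ≤ d := by exact_mod_cast hd
  have h1 : IntegrableOn (fun z : Euc d => ‖z‖ ^ (-(d * (q - 1)) - (d : ℝ))) {z | 1 ≤ ‖z‖} :=
    integrableOn_norm_rpow_far hd (by nlinarith) one_pos
  have h2 : IntegrableOn (fun y : Euc d => ‖x - y‖ ^ (-(d * (q - 1)) - (d : ℝ)))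
      {y | 1 ≤ ‖x - y‖} :=
    (integrableOn_comp_sub_left {z : Euc d | 1 ≤ ‖z‖}
      (fun z => ‖z‖ ^ (-(d * (q - 1)) - (d : ℝ))) x).2 h1
  have hm : Measurable fun y : Euc d => ‖x - y‖ ^ (-(d : ℝ)) := by fun_prop
  have h3 : MemLp (fun y : Euc d => ‖x - y‖ ^ (-(d : ℝ))) (ENNReal.ofReal q)
      (volume.restrict {y | 1 ≤ ‖x - y‖}) := by
    rw [← integrable_norm_rpow_iff hm.aestronglyMeasurable (by simp; linarith)
      ENNReal.ofReal_ne_top, ENNReal.toReal_ofReal (by linarith)]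
    refine h2.congr (Eventually.of_forall fun y => ?_)
    simp only
    rw [Real.norm_of_nonneg (by positivity), ← Real.rpow_mul (norm_nonneg _)]
    congr 1; ring
  have := hq.symm.ennrealOfReal
  exact h3.integrable_mul (hg.restrict _)

theorem HomBound.norm_near_le (hA : HomBound A k) (hg : InCa α M g)
    (x y : Euc d) {a : ℝ} (ha : |a| ≤ A * ‖x - y‖ ^ (-(d : ℝ))) :
    ‖a * (g y - g x)‖ ≤ A * M * ‖x - y‖ ^ (α - d) := by
  have hA0 := hA.nonneg
  have hM := hg.nonneg
  rcases eq_or_ne x y with rfl | hne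
  · rw [sub_self, mul_zero, norm_zero]; positivity
  have h2 := hg.2 y x
  rw [norm_sub_rev y x] at h2
  rw [norm_mul]
  calc _ ≤ A * ‖x - y‖ ^ (-(d : ℝ)) * (M * ‖x - y‖ ^ α) := by
        gcongr; exact ha
    _ = A * M * (‖x - y‖ ^ (-(d : ℝ)) * ‖x - y‖ ^ α) := by ring
    _ = _ := by rw [rpow_neg_dim_mul (sub_ne_zero.2 hne)]

theorem integrableOn_near (hd : 1 ≤ d) (hα0 : 0 < α) (c : ℝ) (x : Euc d) :
    IntegrableOn (fun y : Euc d => c * ‖x - y‖ ^ (α - d)) {y | ‖x - y‖ < 1} := by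
  have h1 := integrableOn_norm_rpow_ball hd hα0 1
  have hb : {z : Euc d | ‖z‖ < 1} = Metric.ball 0 1 := by ext; simp
  rw [← hb] at h1
  exact Integrable.const_mul ((integrableOn_comp_sub_left {z : Euc d | ‖z‖ < 1}
      (fun z => ‖z‖ ^ (α - d)) x).2 h1) c

theorem truncOp_eq (hK : ∀ n, IsCZTwo A (truncKernel k n)) (hg : Continuous g) (n : ℕ) (x : Euc d) :
    truncOp k n g x = (∫ y in {y | ‖x - y‖ < 1}, truncKernel k n (x - y) * (g y - g x)) +
      ∫ y in {y | 1 ≤ ‖x - y‖}, truncKernel k n (x - y) * g y := by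
  have hi := (hK n).integrable_mul hg.locallyIntegrable x
  have hi' := (hK n).integrable_mul (f := fun _ => g x) continuous_const.locallyIntegrable x
  have e1 := integral_add_compl (measurableSet_norm_sub_lt x 1) hi
  have e2 : {y | ‖x - y‖ < 1}ᶜ = {y | 1 ≤ ‖x - y‖} := by ext; simp
  have e3 : ∫ y in {y | ‖x - y‖ < 1}, truncKernel k n (x - y) =
      ∫ z in {z : Euc d | ‖z‖ < 1}, truncKernel k n z :=
    setIntegral_comp_sub_left {z : Euc d | ‖z‖ < 1} (truncKernel k n) x
  have e4 : ∫ y in {y | ‖x - y‖ < 1}, truncKernel k n (x - y) * (g y - g x) =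
      (∫ y in {y | ‖x - y‖ < 1}, truncKernel k n (x - y) * g y) -
        (∫ z in {z : Euc d | ‖z‖ < 1}, truncKernel k n z) * g x := by
    rw [← e3, ← integral_mul_const, ← integral_sub hi.integrableOn hi'.integrableOn]
    congr 1; ext y; ring
  rw [e2] at e1
  rw [truncOp, czT, e4, ← e1]; ring

theorem tendsto_truncOp (hd : 1 ≤ d) (hα0 : 0 < α) (hp : 1 < p) (hA : HomBound A k)
    (hK : ∀ n, IsCZTwo A (truncKernel k n)) (hg : InCap α p M g) (x : Euc d) :
    Tendsto (fun n => truncOp k n g x) atTop (𝓝 (pvOp k g x)) := by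
  have hA0 := hA.nonneg
  have hgc := hg.continuous hα0
  simp_rw [truncOp_eq hK hgc]
  have hc : ∀ n, Continuous fun y => truncKernel k n (x - y) := fun n =>
    (hK n).contDiff.continuous.comp (continuous_const.sub continuous_id)
  refine Tendsto.add ?_ ?_
  · refine tendsto_integral_of_dominated_convergence _ (fun n =>
      ((hc n).mul (hgc.sub continuous_const)).aestronglyMeasurable)
      (integrableOn_near hd hα0 (A * M) x) (fun n => Eventually.of_forall fun y =>
        hA.norm_near_le hg.1 x y (hA.abs_truncKernel_le n _)) (Eventually.of_forall fun y => ?_)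
    rcases eq_or_ne x y with rfl | hne
    · simp
    · exact tendsto_const_nhds.congr' ((eventually_truncKernel_eq k
        (sub_ne_zero.2 hne)).mono fun n hn => by simp only [hn])
  · refine tendsto_integral_of_dominated_convergence
      (fun y => A * ‖‖x - y‖ ^ (-(d : ℝ)) * g y‖) (fun n =>
      ((hc n).mul hgc).aestronglyMeasurable)
      (Integrable.const_mul (integrableOn_norm_rpow_mul_far hd hp (hg.memLp hα0) x).norm A)
      (fun n => Eventually.of_forall fun y => ?_)
      ((ae_restrict_iff' (measurableSet_le_norm_sub x 1)).2 (Eventually.of_forall fun y hy => ?_))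
    · rw [norm_mul, norm_mul, ← mul_assoc, Real.norm_of_nonneg (r := ‖x - y‖ ^ (-(d : ℝ)))
        (by positivity)]
      gcongr
      exact hA.abs_truncKernel_le n _
    · have hne : x - y ≠ 0 := norm_pos_iff.1 (lt_of_lt_of_le one_pos hy)
      exact tendsto_const_nhds.congr' ((eventually_truncKernel_eq k
        hne).mono fun n hn => by simp only [hn])

theorem pvConv_eq_pvOp (hd : 1 ≤ d) (hα0 : 0 < α) (hp : 1 < p) (hk : IsHomKernel k)
    (hA : HomBound A k) (hg : InCap α p M g) (x : Euc d) : pvConv k g x = pvOp k g x := by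
  have hnt := nontrivial_euc hd
  have hA0 := hA.nonneg
  have hgc := hg.continuous hα0
  have hm : AEStronglyMeasurable (fun y => k (x - y)) volume :=
    hk.aestronglyMeasurable_comp hd x Measure.AbsolutelyContinuous.rfl
  have mnear := measurableSet_norm_sub_lt x 1
  have mfar := measurableSet_le_norm_sub x 1
  have hnear : IntegrableOn (fun y => k (x - y) * (g y - g x)) {y | ‖x - y‖ < 1} := by
    refine (integrableOn_near hd hα0 (A * M) x).mono'
      (hm.restrict.mul (hgc.sub continuous_const).aestronglyMeasurable)
      (Eventually.of_forall fun y => ?_)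
    rcases eq_or_ne x y with rfl | hne
    · have := hg.nonneg
      simp only [sub_self, mul_zero, norm_zero]; positivity
    · exact hA.norm_near_le hg.1 x y (hA.size _ (sub_ne_zero.2 hne))
  have hfar : IntegrableOn (fun y => k (x - y) * g y) {y | 1 ≤ ‖x - y‖} := by
    refine (Integrable.const_mul (integrableOn_norm_rpow_mul_far hd hp (hg.memLp hα0) x).norm
      A).mono' (hm.restrict.mul hgc.aestronglyMeasurable)
      ((ae_restrict_iff' mfar).2 (Eventually.of_forall fun y hy => ?_))
    have hne : x - y ≠ 0 := norm_pos_iff.1 (lt_of_lt_of_le one_pos hy)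
    rw [norm_mul, norm_mul, ← mul_assoc, Real.norm_of_nonneg (r := ‖x - y‖ ^ (-(d : ℝ)))
        (by positivity)]
    gcongr
    exact hA.size _ hne
  have key : ∀ ε : ℝ, 0 < ε → ε < 1 → ∫ y in {y | ε < ‖x - y‖}, k (x - y) • g y =
      (∫ y in {y | ‖x - y‖ < 1}, {y | ε < ‖x - y‖}.indicator
        (fun y => k (x - y) * (g y - g x)) y) + ∫ y in {y | 1 ≤ ‖x - y‖}, k (x - y) * g y := by
    intro ε hε hε1
    have mε : MeasurableSet {y | ε < ‖x - y‖} := by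
      exact measurableSet_lt measurable_const (by fun_prop)
    set S := {y | ‖x - y‖ < 1} ∩ {y | ε < ‖x - y‖} with hS
    have hu : {y | ε < ‖x - y‖} = S ∪ {y | 1 ≤ ‖x - y‖} := by
      ext y
      simp only [hS, mem_union, mem_inter_iff, mem_ofPred_eq]
      constructor
      · intro h
        rcases lt_or_ge ‖x - y‖ 1 with h' | h'
        exacts [Or.inl ⟨h', h⟩, Or.inr h']
      · rintro (h | h)
        exacts [h.2, hε1.trans_le h]
    have hdisj : Disjoint S {y | 1 ≤ ‖x - y‖} := by
      rw [Set.disjoint_left]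
      intro y hy hy'
      exact absurd (show ‖x - y‖ < 1 from hy.1) (not_lt.2 hy')
    have hSfin : volume S ≠ ⊤ := by
      refine ((measure_mono inter_subset_left).trans_lt ?_).ne
      have : {y | ‖x - y‖ < 1} = Metric.ball x 1 := by ext; simp [dist_eq_norm, norm_sub_rev]
      rw [this]; exact measure_ball_lt_top
    have hkS : IntegrableOn (fun y => k (x - y)) S := by
      refine Measure.integrableOn_of_bounded (M := A * ε ^ (-(d : ℝ))) hSfin hm
        ((ae_restrict_iff' (mnear.inter mε)).2 (Eventually.of_forall fun y hy => ?_))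
      have h1 : ε < ‖x - y‖ := hy.2
      refine (hA.size _ (norm_pos_iff.1 (hε.trans h1))).trans ?_
      exact mul_le_mul_of_nonneg_left (Real.rpow_le_rpow_of_nonpos hε h1.le (by simp)) hA0
    have hS1 : IntegrableOn (fun y => k (x - y) * (g y - g x)) S := hnear.mono_set inter_subset_left
    have hS2 : IntegrableOn (fun y => k (x - y) * g y) S := by
      refine (hS1.add (Integrable.mul_const hkS (g x))).congr (Eventually.of_forall fun y => ?_)
      simp only [Pi.add_apply]; ring
    have hmean : ∫ y in S, k (x - y) = 0 := by
      have e : S = {y | x - y ∈ {z : Euc d | ‖z‖ < 1 ∧ ε < ‖z‖}} := rfl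
      rw [e, setIntegral_comp_sub_left,
        ← hk.integral_annulus_ball hd (s := 1) hε hε1.le]
      refine setIntegral_congr_set ?_
      have hs := Measure.addHaar_sphere (volume : Measure (Euc d)) 0 ε
      filter_upwards [measure_eq_zero_iff_ae_notMem.1 hs] with z hz
      have hz' : ‖z‖ ≠ ε := by simpa using hz
      exact propext ⟨fun h => ⟨⟨h.2.le, h.1.le⟩, h.1⟩,
        fun h => ⟨h.2, lt_of_le_of_ne h.1.1 hz'.symm⟩⟩
    simp only [smul_eq_mul]
    rw [hu, setIntegral_union hdisj mfar hS2 hfar, ← hu, setIntegral_indicator mε, ← hS]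
    congr 1
    have : ∫ y in S, k (x - y) * g y = ∫ y in S, (k (x - y) * (g y - g x) + k (x - y) * g x) := by
      congr 1; ext y; ring
    rw [this, integral_add hS1 (Integrable.mul_const hkS (g x)), integral_mul_const, hmean,
      zero_mul, add_zero]
  refine Tendsto.limUnder_eq ?_
  have hev : ∀ᶠ ε : ℝ in 𝓝[>] 0, 0 < ε ∧ ε < 1 := by
    filter_upwards [Ioo_mem_nhdsGT (one_pos : (0 : ℝ) < 1)] with ε hε using hε
  refine Tendsto.congr' (hev.mono fun ε hε => (key ε hε.1 hε.2).symm) ?_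
  refine Tendsto.add_const _ ?_
  refine tendsto_integral_filter_of_dominated_convergence (fun y => ‖k (x - y) * (g y - g x)‖)
    (Eventually.of_forall fun ε => ?_) (Eventually.of_forall fun ε => Eventually.of_forall fun y =>
      norm_indicator_le_norm_self _ _) hnear.norm (Eventually.of_forall fun y => ?_)
  · exact hnear.aestronglyMeasurable.indicator (measurableSet_lt measurable_const (by fun_prop))
  · rcases eq_or_ne x y with rfl | hne
    · refine tendsto_const_nhds.congr fun ε => ?_
      simp only [indicator_apply, sub_self, mul_zero, ite_self]
    · have hpos : 0 < ‖x - y‖ := norm_pos_iff.2 (sub_ne_zero.2 hne)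
      refine tendsto_const_nhds.congr' ?_
      filter_upwards [Ioo_mem_nhdsGT hpos] with ε hε
      exact (indicator_of_mem (show y ∈ {y | ε < ‖x - y‖} from hε.2)
        (fun y => k (x - y) * (g y - g x))).symm

end

section
variable {d : ℕ} {A α p M : ℝ} {k f g : Euc d → ℝ}

theorem InCap.congr (hf : InCap α p M f) (h : ∀ x, f x = g x) : InCap α p M g :=
  (funext h : f = g) ▸ hf

theorem InCap.of_tendsto (hα0 : 0 < α) {u : ℕ → Euc d → ℝ} {v : Euc d → ℝ}
    (hu : ∀ n, InCap α p M (u n)) (huv : ∀ x, Tendsto (fun n => u n x) atTop (𝓝 (v x))) :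
    InCap α p M v := by
  refine ⟨⟨fun x => le_of_tendsto (huv x).norm (Eventually.of_forall fun n => (hu n).1.1 x),
    fun x y => le_of_tendsto ((huv x).sub (huv y)).norm
      (Eventually.of_forall fun n => (hu n).1.2 x y)⟩, ?_⟩
  refine (Lp.eLpNorm_lim_le_liminf_eLpNorm
    (fun n => ((hu n).continuous hα0).aestronglyMeasurable) _ (Eventually.of_forall huv)).trans ?_
  exact liminf_le_of_frequently_le' (Frequently.of_forall fun n => (hu n).2)

theorem exists_inCap_truncOp (hd : 1 ≤ d) (hα0 : 0 < α) (hα1 : α < 1) (hp : 1 < p)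
    (hA : ∀ n, IsCZTwo A (truncKernel k n)) :
    ∃ C : ℝ, 0 < C ∧ ∀ (n : ℕ) (f : Euc d → ℝ) (M : ℝ), InCap α p M f →
      InCap α p (C * M) (truncOp k n f) := by
  obtain ⟨C, hC0, hC⟩ := exists_inCap_czT hd A hα0 hα1 hp
  have hA0 := (hA 0).toIsCZ.nonneg
  refine ⟨C + A, by positivity, fun n f M hf => ?_⟩
  have h := InCap.add hα0 hp.le (hC _ (hA n).toIsCZ f M hf)
    (hf.const_mul (-∫ z in {z : Euc d | ‖z‖ < 1}, truncKernel k n z))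
  have e : truncOp k n f = fun x => czT (truncKernel k n) f x +
      -(∫ z in {z : Euc d | ‖z‖ < 1}, truncKernel k n z) * f x := by
    ext x; simp only [truncOp]; ring
  rw [e]
  refine h.mono ?_
  have h1 := (hA n).toIsCZ.canc 1 one_pos
  have := hf.nonneg
  rw [abs_neg, add_mul]
  gcongr

theorem truncOp_sub {n : ℕ} (hK : IsCZ A (truncKernel k n)) (hf : Continuous f) (hg : Continuous g)
    (x : Euc d) : truncOp k n (fun y => f y - g y) x = truncOp k n f x - truncOp k n g x := by
  simp only [truncOp, czT, mul_sub]
  rw [integral_sub (hK.integrable_mul hf.locallyIntegrable x)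
    (hK.integrable_mul hg.locallyIntegrable x)]
  ring

/-- A pointwise limit of functions with equi-Hölder, pointwise convergent derivatives. -/
theorem hasFDerivAt_of_tendsto_of_holder {H : ℝ} (hα0 : 0 < α) {u : ℕ → Euc d → ℝ} {v : Euc d → ℝ}
    {L : Euc d →L[ℝ] ℝ} {x : Euc d} (hu : ∀ n, Differentiable ℝ (u n))
    (hH : ∀ n y, ‖fderiv ℝ (u n) y - fderiv ℝ (u n) x‖ ≤ H * ‖y - x‖ ^ α)
    (huv : ∀ y, Tendsto (fun n => u n y) atTop (𝓝 (v y)))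
    (hL : ∀ w, Tendsto (fun n => fderiv ℝ (u n) x w) atTop (𝓝 (L w))) : HasFDerivAt v L x := by
  have taylor : ∀ n y, ‖u n y - u n x - fderiv ℝ (u n) x (y - x)‖ ≤
      |H| * ‖y - x‖ ^ α * ‖y - x‖ := by
    intro n y
    refine (convex_segment x y).norm_image_sub_le_of_norm_fderiv_le' (𝕜 := ℝ)
      (f := u n) (φ := fderiv ℝ (u n) x) (fun w _ => hu n w)
      (fun w hw => ?_) (left_mem_segment ℝ x y) (right_mem_segment ℝ x y)
    have hw' : ‖w - x‖ ≤ ‖y - x‖ := by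
      rw [norm_sub_rev y x, norm_sub_rev w x, ← dist_eq_norm, ← dist_eq_norm]
      have := dist_add_dist_of_mem_segment hw
      have := dist_nonneg (x := w) (y := y)
      linarith
    refine (hH n w).trans ?_
    gcongr
    exact le_abs_self H
  have lim : ∀ y, ‖v y - v x - L (y - x)‖ ≤ |H| * ‖y - x‖ ^ α * ‖y - x‖ := fun y =>
    le_of_tendsto (((huv y).sub (huv x)).sub (hL _)).norm (Eventually.of_forall fun n => taylor n y)
  rw [hasFDerivAt_iff_isLittleO]
  refine Asymptotics.IsLittleO.of_norm_left ?_
  have hs : Tendsto (fun y => |H| * ‖y - x‖ ^ α) (𝓝 x) (𝓝 0) := by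
    have : Continuous fun y => |H| * ‖y - x‖ ^ α :=
      continuous_const.mul ((continuous_norm.comp (continuous_id.sub continuous_const)).rpow_const
        fun _ => Or.inr hα0.le)
    have h := this.tendsto x
    simpa [Real.zero_rpow hα0.ne'] using h
  refine Asymptotics.isLittleO_iff.2 fun c hc => ?_
  filter_upwards [hs.eventually (gt_mem_nhds hc)] with y hy
  rw [norm_norm]
  refine (lim y).trans ?_
  gcongr

/-- Functions which, with their first partial derivatives, lie in `C^α ∩ L^p`. -/
structure InCapOne (α p : ℝ) (f : Euc d → ℝ) : Prop where
  contDiff : ContDiff ℝ 1 f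
  inCap : ∃ M, InCap α p M f
  partials : ∀ i, ∃ M, InCap α p M (fun x => fderiv ℝ f x (Pi.single i 1))

theorem InCapOne.add (hα0 : 0 < α) (hp : 1 ≤ p) (hf : InCapOne α p f) (hg : InCapOne α p g) :
    InCapOne α p (fun x => f x + g x) := by
  refine ⟨hf.contDiff.add hg.contDiff, ?_, fun i => ?_⟩
  · obtain ⟨M, hM⟩ := hf.inCap
    obtain ⟨M', hM'⟩ := hg.inCap
    exact ⟨_, hM.add hα0 hp hM'⟩
  · obtain ⟨M, hM⟩ := hf.partials i
    obtain ⟨M', hM'⟩ := hg.partials i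
    refine ⟨_, (hM.add hα0 hp hM').congr fun x => ?_⟩
    rw [fderiv_fun_add (hf.contDiff.differentiable one_ne_zero x)
      (hg.contDiff.differentiable one_ne_zero x), add_apply]

theorem InCapOne.const_mul (hf : InCapOne α p f) (c : ℝ) : InCapOne α p (fun x => c * f x) := by
  refine ⟨contDiff_const.mul hf.contDiff, ?_, fun i => ?_⟩
  · obtain ⟨M, hM⟩ := hf.inCap
    exact ⟨_, hM.const_mul c⟩
  · obtain ⟨M, hM⟩ := hf.partials i
    refine ⟨_, (hM.const_mul c).congr fun x => ?_⟩
    rw [fderiv_const_mul (hf.contDiff.differentiable one_ne_zero x), smul_apply, smul_eq_mul]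

theorem InCapOne.exists_inCap_fderiv_apply {η : Euc d → Euc d} {Mη : ℝ} (hα0 : 0 < α)
    (hα1 : α < 1) (hp : 1 ≤ p) (hf : InCapOne α p f) (hη : InC1a α Mη η) :
    ∃ M, InCap α p M (fun x => fderiv ℝ f x (η x)) := by
  choose M hM using hf.partials
  refine ⟨_, (InCap.sum hα0 hp Finset.univ fun i _ =>
    InCap.mul (hη.inCa_apply hα0 hα1 i) (hM i)).congr fun x => ?_⟩
  rw [clm_apply_eq_sum (fderiv ℝ f x) (η x)]
  rfl

theorem norm_le_sum_apply_single (L : Euc d →L[ℝ] ℝ) : ‖L‖ ≤ ∑ i, ‖L (Pi.single i 1)‖ := by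
  refine L.opNorm_le_bound (Finset.sum_nonneg fun i _ => norm_nonneg _) fun u => ?_
  rw [clm_apply_eq_sum L u, Finset.sum_mul]
  refine (norm_sum_le _ _).trans (Finset.sum_le_sum fun i _ => ?_)
  rw [norm_smul, mul_comm]
  exact mul_le_mul_of_nonneg_left (norm_le_pi_norm u i) (norm_nonneg _)

theorem contDiff_truncOp {n : ℕ} (hK : IsCZ A (truncKernel k n)) (hf : ContDiff ℝ 1 f) :
    ContDiff ℝ 1 (truncOp k n f) :=
  (hK.contDiff_czT hf.continuous.locallyIntegrable).sub (contDiff_const.mul hf)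

theorem fderiv_truncOp {n : ℕ} (hK : IsCZ A (truncKernel k n)) (hf : ContDiff ℝ 1 f)
    (x w : Euc d) : fderiv ℝ (truncOp k n f) x w = fderiv ℝ (czT (truncKernel k n) f) x w -
      (∫ z in {z : Euc d | ‖z‖ < 1}, truncKernel k n z) * fderiv ℝ f x w := by
  have h1 := (hK.contDiff_czT hf.continuous.locallyIntegrable).differentiable one_ne_zero x
  have h2 := hf.differentiable one_ne_zero x
  unfold truncOp
  rw [fderiv_fun_sub h1 (h2.const_mul _), fderiv_const_mul h2]
  rfl

theorem hasFDerivAt_pvOp (hd : 1 ≤ d) (hα0 : 0 < α) (hα1 : α < 1) (hp : 1 < p)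
    (hA : HomBound A k) (hK : ∀ n, IsCZTwo A (truncKernel k n)) (hf : InCapOne α p f) (x : Euc d) :
    HasFDerivAt (pvOp k f) (∑ i, pvOp k (fun y => fderiv ℝ f y (Pi.single i 1)) x •
      (ContinuousLinearMap.proj i : Euc d →L[ℝ] ℝ)) x := by
  obtain ⟨C, -, hC⟩ := exists_inCap_truncOp hd hα0 hα1 hp hK
  obtain ⟨M, hM⟩ := hf.inCap
  choose N hN using hf.partials
  have hD : ∀ n y i, fderiv ℝ (truncOp k n f) y (Pi.single i 1) =
      truncOp k n (fun z => fderiv ℝ f z (Pi.single i 1)) y := fun n y i => by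
    rw [fderiv_truncOp (hK n).toIsCZ hf.contDiff, (hK n).toIsCZ.fderiv_czT hf.contDiff, truncOp]
  refine hasFDerivAt_of_tendsto_of_holder hα0 (H := ∑ i, C * N i) (u := fun n => truncOp k n f)
    (fun n => (contDiff_truncOp (hK n).toIsCZ hf.contDiff).differentiable one_ne_zero)
    (fun n y => ?_) (fun y => tendsto_truncOp hd hα0 hp hA hK hM y) (fun w => ?_)
  · refine (norm_le_sum_apply_single _).trans ?_
    rw [Finset.sum_mul]
    refine Finset.sum_le_sum fun i _ => ?_
    rw [sub_apply, hD, hD]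
    exact (hC n _ _ (hN i)).1.2 y x
  · have e : ∀ n, fderiv ℝ (truncOp k n f) x w =
        ∑ i, w i • truncOp k n (fun z => fderiv ℝ f z (Pi.single i 1)) x := fun n => by
      rw [clm_apply_eq_sum]
      simp only [hD]
    simp only [e, sum_apply, smul_apply,
      ContinuousLinearMap.proj_apply]
    refine tendsto_finsetSum _ fun i _ => ?_
    rw [smul_eq_mul, mul_comm]
    exact (tendsto_truncOp hd hα0 hp hA hK (hN i) x).const_mul _

theorem exists_inCap_pvOp (hd : 1 ≤ d) (hα0 : 0 < α) (hα1 : α < 1) (hp : 1 < p)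
    (hA : HomBound A k) (hK : ∀ n, IsCZTwo A (truncKernel k n)) :
    ∃ C : ℝ, 0 < C ∧ ∀ (f : Euc d → ℝ) (M : ℝ), InCap α p M f → InCap α p (C * M) (pvOp k f) := by
  obtain ⟨C, hC0, hC⟩ := exists_inCap_truncOp hd hα0 hα1 hp hK
  exact ⟨C, hC0, fun f M hf => InCap.of_tendsto hα0 (fun n => hC n f M hf)
    (tendsto_truncOp hd hα0 hp hA hK hf)⟩

theorem fderiv_pvOp_single (hd : 1 ≤ d) (hα0 : 0 < α) (hα1 : α < 1) (hp : 1 < p)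
    (hA : HomBound A k) (hK : ∀ n, IsCZTwo A (truncKernel k n)) (hf : InCapOne α p f)
    (x : Euc d) (i : Fin d) : fderiv ℝ (pvOp k f) x (Pi.single i 1) =
      pvOp k (fun y => fderiv ℝ f y (Pi.single i 1)) x := by
  rw [(hasFDerivAt_pvOp hd hα0 hα1 hp hA hK hf x).fderiv]
  simp [Pi.single_apply]

theorem InCapOne.pvOp (hd : 1 ≤ d) (hα0 : 0 < α) (hα1 : α < 1) (hp : 1 < p)
    (hA : HomBound A k) (hK : ∀ n, IsCZTwo A (truncKernel k n)) (hf : InCapOne α p f) :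
    InCapOne α p (pvOp k f) := by
  obtain ⟨C, -, hC⟩ := exists_inCap_pvOp hd hα0 hα1 hp hA hK
  obtain ⟨M, hM⟩ := hf.inCap
  choose N hN using hf.partials
  have hderiv := hasFDerivAt_pvOp hd hα0 hα1 hp hA hK hf
  refine ⟨contDiff_one_iff_fderiv.2 ⟨fun x => (hderiv x).differentiableAt, ?_⟩, ⟨_, hC f M hM⟩,
    fun i => ⟨_, (hC _ _ (hN i)).congr fun x =>
      (fderiv_pvOp_single hd hα0 hα1 hp hA hK hf x i).symm⟩⟩
  rw [show fderiv ℝ (_root_.pvOp k f) = _ from funext fun x => (hderiv x).fderiv]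
  exact continuous_finsetSum _ fun i _ =>
    ((hC _ _ (hN i)).continuous hα0).smul continuous_const

theorem tendsto_fderiv_truncOp (hd : 1 ≤ d) (hα0 : 0 < α) (hα1 : α < 1) (hp : 1 < p)
    (hA : HomBound A k) (hK : ∀ n, IsCZTwo A (truncKernel k n)) (hf : InCapOne α p f)
    (x w : Euc d) :
    Tendsto (fun n => fderiv ℝ (truncOp k n f) x w) atTop (𝓝 (fderiv ℝ (pvOp k f) x w)) := by
  choose N hN using hf.partials
  simp only [clm_apply_eq_sum _ w, fderiv_pvOp_single hd hα0 hα1 hp hA hK hf]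
  refine tendsto_finsetSum _ fun i _ => Tendsto.const_smul ?_ _
  refine (tendsto_truncOp hd hα0 hp hA hK (hN i) x).congr fun n => ?_
  rw [fderiv_truncOp (hK n).toIsCZ hf.contDiff, (hK n).toIsCZ.fderiv_czT hf.contDiff, truncOp]

/-- The commutator of `η · ∇` with a principal value convolution. -/
theorem exists_inCap_commutator_pvOp (hd : 1 ≤ d) (hα0 : 0 < α) (hα1 : α < 1) (hp : 1 < p)
    (hA : HomBound A k) (hK : ∀ n, IsCZTwo A (truncKernel k n)) :
    ∃ C : ℝ, 0 ≤ C ∧ ∀ (η : Euc d → Euc d) (Mη : ℝ), InC1a α Mη η →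
      ∀ (f : Euc d → ℝ) (M : ℝ), InCapOne α p f → InCap α p M f → InCap α p (C * Mη * M)
        (fun x => fderiv ℝ (pvOp k f) x (η x) - pvOp k (fun y => fderiv ℝ f y (η y)) x) := by
  obtain ⟨C, hC0, hC⟩ := exists_inCap_commutator hd A hα0 hα1 hp
  refine ⟨C, hC0, fun η Mη hη f M hf hM => ?_⟩
  obtain ⟨N, hN⟩ := hf.exists_inCap_fderiv_apply hα0 hα1 hp.le hη
  refine InCap.of_tendsto hα0 (fun n => hC _ (hK n) η Mη hη f M hf.contDiff hM) fun x => ?_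
  refine ((tendsto_fderiv_truncOp hd hα0 hα1 hp hA hK hf x (η x)).sub
    (tendsto_truncOp hd hα0 hp hA hK hN x)).congr fun n => ?_
  rw [fderiv_truncOp (hK n).toIsCZ hf.contDiff, truncOp]
  ring

theorem pvOp_sub (hd : 1 ≤ d) (hα0 : 0 < α) (hp : 1 < p)
    (hA : HomBound A k) (hK : ∀ n, IsCZTwo A (truncKernel k n)) {M' : ℝ} (hf : InCap α p M f)
    (hg : InCap α p M' g) (x : Euc d) :
    pvOp k (fun y => f y - g y) x = pvOp k f x - pvOp k g x := by
  have hfg : InCap α p (M + |-1| * M') (fun y => f y - g y) :=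
    (hf.add hα0 hp.le (hg.const_mul (-1))).congr fun y => by ring
  refine tendsto_nhds_unique (tendsto_truncOp hd hα0 hp hA hK hfg x)
    (((tendsto_truncOp hd hα0 hp hA hK hf x).sub
      (tendsto_truncOp hd hα0 hp hA hK hg x)).congr fun n => ?_)
  exact (truncOp_sub (hK n).toIsCZ (hf.continuous hα0) (hg.continuous hα0) x).symm

theorem inCapOne_of_contDiff (hα0 : 0 < α) (hα1 : α < 1) (hf : ContDiff ℝ (⊤ : ℕ∞) f)
    (hfc : HasCompactSupport f) : InCapOne α p f := by
  have key : ∀ g : Euc d → ℝ, ContDiff ℝ 1 g → HasCompactSupport g → ∃ M, InCap α p M g := by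
    intro g hg hgc
    obtain ⟨B, hB⟩ := hgc.exists_bound_of_continuous hg.continuous
    obtain ⟨D, hD⟩ := (hgc.fderiv (𝕜 := ℝ)).exists_bound_of_continuous
      (hg.continuous_fderiv one_ne_zero)
    have hB0 : 0 ≤ B := (norm_nonneg _).trans (hB 0)
    have hD0 : 0 ≤ D := (norm_nonneg _).trans (hD 0)
    have hL := (hg.continuous.memLp_of_hasCompactSupport (p := ENNReal.ofReal p)
      (μ := volume) hgc)
    set E := (eLpNorm g (ENNReal.ofReal p) volume).toReal
    have hE0 : 0 ≤ E := ENNReal.toReal_nonneg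
    refine ⟨2 * B + D + E, ⟨fun x => (hB x).trans (by linarith), fun x y => ?_⟩, ?_⟩
    · rcases le_or_gt ‖x - y‖ 1 with hxy | hxy
      · have h1 : ‖g x - g y‖ ≤ D * ‖x - y‖ :=
          convex_univ.norm_image_sub_le_of_norm_fderiv_le (𝕜 := ℝ)
            (fun w _ => hg.differentiable one_ne_zero w) (fun w _ => hD w) (mem_univ _)
            (mem_univ _)
        have h2 : ‖x - y‖ ≤ ‖x - y‖ ^ α :=
          Real.self_le_rpow_of_le_one (norm_nonneg _) hxy hα1.le
        refine h1.trans (mul_le_mul (by linarith) h2 (norm_nonneg _) (by positivity))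
      · have h1 : ‖g x - g y‖ ≤ 2 * B := (norm_sub_le _ _).trans (by linarith [hB x, hB y])
        have h2 : 1 ≤ ‖x - y‖ ^ α := Real.one_le_rpow hxy.le hα0.le
        refine h1.trans ?_
        nlinarith
    · rw [← ENNReal.ofReal_toReal hL.2.ne]
      exact ENNReal.ofReal_le_ofReal (by linarith)
  refine ⟨hf.of_le (by exact_mod_cast le_top), key f (hf.of_le (by exact_mod_cast le_top)) hfc,
    fun i => key _ ?_ ?_⟩
  · exact (hf.fderiv_right (m := 1) (by norm_cast)).clm_apply contDiff_const
  · exact hfc.fderiv_apply ℝ _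

end

/-- Remark after Lemma `steadycomm`: the commutator bound also holds for
products (compositions) of two classical Calderón–Zygmund operators
`𝕂ᵢ = cᵢ·Id + p.v. kᵢ *`, by telescoping. -/
theorem stmt6 (d : ℕ) (hd : 1 ≤ d) (α p : ℝ) (hα0 : 0 < α) (hα1 : α < 1) (hp : 1 < p)
    (k₁ k₂ : Euc d → ℝ) (c₁ c₂ : ℝ)
    (hk₁_smooth : ContDiffOn ℝ (⊤ : ℕ∞) k₁ {x : Euc d | x ≠ 0})
    (hk₂_smooth : ContDiffOn ℝ (⊤ : ℕ∞) k₂ {x : Euc d | x ≠ 0})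
    (hk₁_hom : ∀ c : ℝ, 0 < c → ∀ x : Euc d, x ≠ 0 → k₁ (c • x) = c ^ (-(d : ℝ)) * k₁ x)
    (hk₂_hom : ∀ c : ℝ, 0 < c → ∀ x : Euc d, x ≠ 0 → k₂ (c • x) = c ^ (-(d : ℝ)) * k₂ x)
    (hk₁_mean : ∀ r₁ r₂ : ℝ, 0 < r₁ → r₁ ≤ r₂ →
      (∫ z in {z : Euc d | r₁ ≤ ‖z‖ ∧ ‖z‖ ≤ r₂}, k₁ z) = 0)
    (hk₂_mean : ∀ r₁ r₂ : ℝ, 0 < r₁ → r₁ ≤ r₂ →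
      (∫ z in {z : Euc d | r₁ ≤ ‖z‖ ∧ ‖z‖ ≤ r₂}, k₂ z) = 0) :
    ∃ C > (0 : ℝ), ∀ (η : Euc d → Euc d) (Mη : ℝ), InC1a α Mη η →
      ∀ (σ : Euc d → ℝ) (Mσ : ℝ), ContDiff ℝ (⊤ : ℕ∞) σ → HasCompactSupport σ →
        InCap α p Mσ σ →
        InCap α p (C * Mη * Mσ)
          (fun x =>
            fderiv ℝ (fun z =>
              c₁ * (c₂ * σ z + pvConv k₂ σ z) +
                pvConv k₁ (fun w => c₂ * σ w + pvConv k₂ σ w) z) x (η x) -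
            (c₁ * (c₂ * fderiv ℝ σ x (η x) +
                pvConv k₂ (fun y => fderiv ℝ σ y (η y)) x) +
              pvConv k₁ (fun w => c₂ * fderiv ℝ σ w (η w) +
                pvConv k₂ (fun y => fderiv ℝ σ y (η y)) w) x)) := by
  have hk₁ : IsHomKernel k₁ := ⟨hk₁_smooth, hk₁_hom, hk₁_mean⟩
  have hk₂ : IsHomKernel k₂ := ⟨hk₂_smooth, hk₂_hom, hk₂_mean⟩
  obtain ⟨A₁, hA₁, hK₁⟩ := hk₁.exists_isCZTwo hd
  obtain ⟨A₂, hA₂, hK₂⟩ := hk₂.exists_isCZTwo hd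
  obtain ⟨B₁, hB₁0, hB₁⟩ := exists_inCap_pvOp hd hα0 hα1 hp hA₁ hK₁
  obtain ⟨B₂, hB₂0, hB₂⟩ := exists_inCap_pvOp hd hα0 hα1 hp hA₂ hK₂
  obtain ⟨D₁, hD₁0, hD₁⟩ := exists_inCap_commutator_pvOp hd hα0 hα1 hp hA₁ hK₁
  obtain ⟨D₂, hD₂0, hD₂⟩ := exists_inCap_commutator_pvOp hd hα0 hα1 hp hA₂ hK₂
  refine ⟨|c₁| * D₂ + D₁ * (|c₂| + B₂) + B₁ * D₂ + 1, by positivity,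
    fun η Mη hη σ Mσ hσ hσc hσM => ?_⟩
  have hMη := hη.nonneg
  have hMσ := hσM.nonneg
  have hσ1 : InCapOne α p σ := inCapOne_of_contDiff hα0 hα1 hσ hσc
  obtain ⟨N, hN⟩ := hσ1.exists_inCap_fderiv_apply hα0 hα1 hp.le hη
  have hP₂1 : InCapOne α p (pvOp k₂ σ) := hσ1.pvOp hd hα0 hα1 hp hA₂ hK₂
  -- `g = 𝕂₂ σ`, `h = 𝕂₂ (η · ∇ σ)` and `q = [η · ∇, 𝕂₂] σ`
  set g : Euc d → ℝ := fun w => c₂ * σ w + pvOp k₂ σ w with hg_def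
  set h : Euc d → ℝ := fun w => c₂ * fderiv ℝ σ w (η w) +
    pvOp k₂ (fun y => fderiv ℝ σ y (η y)) w with hh_def
  set q : Euc d → ℝ := fun w => fderiv ℝ (pvOp k₂ σ) w (η w) -
    pvOp k₂ (fun y => fderiv ℝ σ y (η y)) w with hq_def
  have hg1 : InCapOne α p g := (hσ1.const_mul c₂).add hα0 hp.le hP₂1
  have hgM : InCap α p (|c₂| * Mσ + B₂ * Mσ) g :=
    (hσM.const_mul c₂).add hα0 hp.le (hB₂ σ Mσ hσM)
  have hhM : InCap α p (|c₂| * N + B₂ * N) h := (hN.const_mul c₂).add hα0 hp.le (hB₂ _ _ hN)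
  have hq : InCap α p (D₂ * Mη * Mσ) q := hD₂ η Mη hη σ Mσ hσ1 hσM
  have hg' : ∀ w, fderiv ℝ g w (η w) = h w + q w := by
    intro w
    have h1 := hσ1.contDiff.differentiable one_ne_zero w
    have h2 := hP₂1.contDiff.differentiable one_ne_zero w
    rw [hg_def, fderiv_fun_add (h1.const_mul c₂) h2, fderiv_const_mul h1]
    simp only [hh_def, hq_def, add_apply, smul_apply, smul_eq_mul]
    ring
  have e₁ : (fun w => c₂ * σ w + pvConv k₂ σ w) = g :=
    funext fun w => by rw [pvConv_eq_pvOp hd hα0 hp hk₂ hA₂ hσM]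
  have e₂ : (fun w => c₂ * fderiv ℝ σ w (η w) + pvConv k₂ (fun y => fderiv ℝ σ y (η y)) w) = h :=
    funext fun w => by rw [pvConv_eq_pvOp hd hα0 hp hk₂ hA₂ hN]
  obtain ⟨N', hN'⟩ := hg1.exists_inCap_fderiv_apply hα0 hα1 hp.le hη
  have hP₁q : ∀ x, pvOp k₁ (fun w => fderiv ℝ g w (η w)) x - pvOp k₁ h x = pvOp k₁ q x := by
    intro x
    rw [← pvOp_sub hd hα0 hp hA₁ hK₁ hN' hhM]
    congr 1
    ext w
    rw [hg']
    ring
  have hsum := ((hq.const_mul c₁).add hα0 hp.le (hD₁ η Mη hη g _ hg1 hgM)).add hα0 hp.le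
    (hB₁ q _ hq)
  refine (hsum.congr fun x => ?_).mono ?_
  · have h1 := hg1.contDiff.differentiable one_ne_zero x
    have h2 := (hg1.pvOp hd hα0 hα1 hp hA₁ hK₁).contDiff.differentiable one_ne_zero x
    have e₃ : (fun z => c₁ * (c₂ * σ z + pvConv k₂ σ z) +
        pvConv k₁ (fun w => c₂ * σ w + pvConv k₂ σ w) z) = fun z => c₁ * g z + pvOp k₁ g z := by
      ext z
      rw [e₁, pvConv_eq_pvOp hd hα0 hp hk₁ hA₁ hgM, ← congrFun e₁ z]
    have e₄ := congrFun e₂ x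
    rw [e₃, e₂, e₄, pvConv_eq_pvOp hd hα0 hp hk₁ hA₁ hhM, fderiv_fun_add (h1.const_mul c₁) h2,
      fderiv_const_mul h1]
    simp only [add_apply, smul_apply, smul_eq_mul]
    rw [← hP₁q, hg']
    ring
  · have : 0 ≤ Mη * Mσ := mul_nonneg hMη hMσ
    nlinarith

end
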